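/- Let T_w ⊂ S² denote a regular spherical triangle of width w with 0 < w ≤ π/2. There exists a constant c_w > 0 depending only on w such that for every ε > 0 and every convex body K ⊂ S² with w(K) = w and area(K) ≤ area(T_w) + ε, there exists a regular spherical triangle T of width w with δ(K,T) ≤ c_w·ε. -/

import Mathlib

open scoped RealInnerProductSpace
open Real MeasureTheory

noncomputable section

namespace SphericalPal

/-- Ambient Euclidean space of the sphere `Sⁿ`. -/
abbrev E (n : ℕ) := EuclideanSpace ℝ (Fin (n + 1))

/-- The unit sphere `Sⁿ ⊂ ℝⁿ⁺¹`. -/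
def unitSphere (n : ℕ) : Set (E n) := Metric.sphere 0 1

variable {n : ℕ}

/-- Geodesic (angular) distance on the unit sphere. -/
def gdist (x y : E n) : ℝ := Real.arccos ⟪x, y⟫

/-- The geodesic segment joining `x` and `y` on the sphere. -/
def seg (x y : E n) : Set (E n) :=
  {z ∈ unitSphere n | gdist x z + gdist z y = gdist x y}

/-- A subset of the sphere is spherically convex if it lies on the sphere, is contained
in an open hemisphere and contains the geodesic segment joining any two of its points. -/
def SConvex (X : Set (E n)) : Prop :=
  X ⊆ unitSphere n ∧
  (∃ u ∈ unitSphere n, ∀ x ∈ X, 0 < ⟪u, x⟫) ∧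
  ∀ x ∈ X, ∀ y ∈ X, seg x y ⊆ X

/-- Spherical convex hull. -/
def sconv (X : Set (E n)) : Set (E n) := ⋂₀ {C | SConvex C ∧ X ⊆ C}

/-- Relative (spherical) interior of a subset of the sphere. -/
def sInterior (X : Set (E n)) : Set (E n) :=
  {x ∈ X | ∃ ε > 0, ∀ y ∈ unitSphere n, gdist x y < ε → y ∈ X}

/-- A spherical convex body: compact, spherically convex, with nonempty relative interior. -/
def IsConvexBody (K : Set (E n)) : Prop :=
  SConvex K ∧ IsCompact K ∧ (sInterior K).Nonempty

/-- The lune determined by `u` and `v` (intersection of the closed hemispheres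
opposite to `u` and to `v`). -/
def lune (u v : E n) : Set (E n) := {x ∈ unitSphere n | ⟪x, u⟫ ≤ 0 ∧ ⟪x, v⟫ ≤ 0}

/-- The bounding hemisphere of `lune u v` contained in the great sphere orthogonal to `u`. -/
def luneFace (u v : E n) : Set (E n) := {x ∈ unitSphere n | ⟪x, u⟫ = 0 ∧ ⟪x, v⟫ ≤ 0}

/-- The center (midpoint) of the bounding hemisphere `luneFace u v`. -/
def luneFaceCenter (u v : E n) : E n :=
  ‖(⟪u, v⟫ • u - v : E n)‖⁻¹ • (⟪u, v⟫ • u - v)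

/-- The breadth of the lune `lune u v`: the geodesic distance of the centers of the
two bounding hemispheres. -/
def breadth (u v : E n) : ℝ := gdist (luneFaceCenter u v) (luneFaceCenter v u)

/-- `lune u v` is a supporting lune of `K`. -/
def IsSupportingLune (K : Set (E n)) (u v : E n) : Prop :=
  u ∈ unitSphere n ∧ v ∈ unitSphere n ∧ u ≠ v ∧ u ≠ -v ∧
  K ⊆ lune u v ∧ (K ∩ luneFace u v).Nonempty ∧ (K ∩ luneFace v u).Nonempty

/-- The (minimal) width of a spherical convex body. -/
def width (K : Set (E n)) : ℝ :=
  sInf {b | ∃ u v : E n, IsSupportingLune K u v ∧ b = breadth u v}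

/-- The width of `K` with respect to the supporting great hypersphere orthogonal to `u`:
the minimal breadth among supporting lunes of `K` having one bounding hemisphere
contained in that great hypersphere. -/
def widthAt (K : Set (E n)) (u : E n) : ℝ :=
  sInf {b | ∃ v : E n, IsSupportingLune K u v ∧ b = breadth u v}

/-- The great hypersphere orthogonal to `u` supports `K`. -/
def IsSupportingSphere (K : Set (E n)) (u : E n) : Prop :=
  u ∈ unitSphere n ∧ (∀ x ∈ K, ⟪x, u⟫ ≤ 0) ∧ ∃ x ∈ K, ⟪x, u⟫ = 0

/-- `K` is of constant width `w`. -/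
def HasConstantWidth (K : Set (E n)) (w : ℝ) : Prop :=
  ∀ u : E n, IsSupportingSphere K u → widthAt K u = w

/-- `K` is a reduced convex body. -/
def IsReduced (K : Set (E n)) : Prop :=
  IsConvexBody K ∧ ∀ L : Set (E n), IsConvexBody L → L ⊆ K → L ≠ K → width L < width K

/-- The spherical polar set. -/
def polar (A : Set (E n)) : Set (E n) := {u ∈ unitSphere n | ∀ a ∈ A, ⟪a, u⟫ ≤ 0}

/-- Closed geodesic ball on the sphere. -/
def gball (p : E n) (r : ℝ) : Set (E n) := {x ∈ unitSphere n | gdist p x ≤ r}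

/-- The inradius of `K`: the largest `r` such that some geodesic ball of radius `r`
is contained in `K`. -/
def inradius (K : Set (E n)) : ℝ :=
  sSup {r | 0 ≤ r ∧ ∃ p ∈ unitSphere n, gball p r ⊆ K}

/-- Geodesic distance from a point to a set. -/
def sdist (x : E n) (A : Set (E n)) : ℝ := sInf (gdist x '' A)

/-- Hausdorff distance with respect to the geodesic metric. -/
def hausdorffG (A B : Set (E n)) : ℝ :=
  max (sSup ((fun x => sdist x B) '' A)) (sSup ((fun y => sdist y A) '' B))

/-- Two subsets of the sphere are congruent, i.e., isometric by an orthogonal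
transformation of the ambient Euclidean space. -/
def Congruent (A B : Set (E n)) : Prop :=
  ∃ f : E n ≃ₗᵢ[ℝ] E n, f '' A = B

/-- Spherical surface measure on `S²` (2-dimensional Hausdorff measure). -/
def area (X : Set (E 2)) : ℝ := (μH[2] X).toReal

/-- The spherical angle `∠(x, p, y)` at `p` between the geodesic segments `[p,x]`, `[p,y]`. -/
def sangle (x p y : E 2) : ℝ :=
  InnerProductGeometry.angle (x - ⟪p, x⟫ • p) (y - ⟪p, y⟫ • p)

/-- `T` is a regular spherical triangle: the spherical convex hull of three points
with equal pairwise geodesic distances, not lying on a common great circle. -/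
def IsRegularTriangle (T : Set (E 2)) : Prop :=
  ∃ v₁ v₂ v₃ : E 2, v₁ ∈ unitSphere 2 ∧ v₂ ∈ unitSphere 2 ∧ v₃ ∈ unitSphere 2 ∧
    LinearIndependent ℝ ![v₁, v₂, v₃] ∧
    gdist v₁ v₂ = gdist v₂ v₃ ∧ gdist v₂ v₃ = gdist v₁ v₃ ∧
    T = sconv {v₁, v₂, v₃}

/-- Three points on the sphere with equal pairwise geodesic distance `a`
(the vertices of a regular spherical triangle of side length `a`). -/
def IsRegularCenters (x₁ x₂ x₃ : E 2) (a : ℝ) : Prop :=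
  x₁ ∈ unitSphere 2 ∧ x₂ ∈ unitSphere 2 ∧ x₃ ∈ unitSphere 2 ∧
  gdist x₁ x₂ = a ∧ gdist x₂ x₃ = a ∧ gdist x₁ x₃ = a

/-- `U` is a spherical Reuleaux triangle: intersection of three geodesic balls of radius `r`
whose centers have pairwise geodesic distance `r`. -/
def IsReuleaux (U : Set (E 2)) (r : ℝ) : Prop :=
  ∃ x₁ x₂ x₃ : E 2, IsRegularCenters x₁ x₂ x₃ r ∧
    U = gball x₁ r ∩ gball x₂ r ∩ gball x₃ r

/-- The body `U°_{π-w}` for `w > π/2`: the spherical convex hull of three geodesic balls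
of radius `w - π/2` (whose centers are meant to form a regular triangle of side `π - w`). -/
def polarReuleaux (x₁ x₂ x₃ : E 2) (w : ℝ) : Set (E 2) :=
  sconv (gball x₁ (w - π / 2) ∪ gball x₂ (w - π / 2) ∪ gball x₃ (w - π / 2))

end SphericalPal

open SphericalPal

namespace Pal

/-- surface measure on the sphere as a measure on the ambient space -/
def sm : Measure (E 2) := (μH[2] : Measure (E 2)).restrict (unitSphere 2)

lemma mem_unit {n : ℕ} {x : E n} : x ∈ unitSphere n ↔ ‖x‖ = 1 := by
  simp [unitSphere]

lemma isClosed_unit : IsClosed (unitSphere 2) := Metric.isClosed_sphere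

lemma meas_unit : MeasurableSet (unitSphere 2) := isClosed_unit.measurableSet

def sphMap (q : ℝ × ℝ) : E 2 := !₂[cos q.1 * cos q.2, sin q.1 * cos q.2, sin q.2]

lemma contDiff_sphMap : ContDiff ℝ 1 sphMap := by
  unfold sphMap
  rw [contDiff_euclidean]
  intro i
  fin_cases i <;> simp <;> fun_prop

lemma hausdorff_unit_lt_top : (μH[2] : Measure (E 2)) (unitSphere 2) < ⊤ := by
  obtain ⟨C, hC⟩ := LocallyLipschitzOn.exists_lipschitzOnWith_of_compact
    (s := Set.Icc (-π) π ×ˢ Set.Icc (-π) π) (isCompact_Icc.prod isCompact_Icc)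
    (contDiff_sphMap.locallyLipschitz.locallyLipschitzOn)
  have h1 := hC.hausdorffMeasure_image_le (d := 2) (by norm_num)
  rw [hausdorffMeasure_prod_real] at h1
  have h2 : unitSphere 2 ⊆ sphMap '' (Set.Icc (-π) π ×ˢ Set.Icc (-π) π) := by
    intro x hx
    rw [mem_unit] at hx
    have hx2 : x 0 ^ 2 + x 1 ^ 2 + x 2 ^ 2 = 1 := by
      have := EuclideanSpace.real_norm_sq_eq x
      rw [hx, Fin.sum_univ_three] at this
      linarith
    have hz : x 2 ^ 2 ≤ 1 := by nlinarith [sq_nonneg (x 0), sq_nonneg (x 1)]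
    have hz1 : -1 ≤ x 2 := by nlinarith
    have hz2 : x 2 ≤ 1 := by nlinarith
    set z : ℂ := ⟨x 0, x 1⟩ with hzdef
    have hn : ‖z‖ = √(1 - x 2 ^ 2) := by
      rw [Complex.norm_def, Complex.normSq_mk]
      congr 1; nlinarith
    refine ⟨(z.arg, arcsin (x 2)), ⟨⟨(Complex.neg_pi_lt_arg z).le, Complex.arg_le_pi z⟩,
      ⟨?_, ?_⟩⟩, ?_⟩
    · have := neg_pi_div_two_le_arcsin (x 2); simp only; linarith [pi_pos]
    · have := arcsin_le_pi_div_two (x 2); simp only; linarith [pi_pos]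
    · unfold sphMap
      have hc : cos (arcsin (x 2)) = ‖z‖ := by rw [Real.cos_arcsin, hn]
      have e0 := Complex.norm_mul_cos_arg z
      have e1 := Complex.norm_mul_sin_arg z
      ext i
      fin_cases i
      · simp [hc]; rw [mul_comm, e0]
      · simp [hc]; rw [mul_comm, e1]
      · simp [Real.sin_arcsin hz1 hz2]
  refine lt_of_le_of_lt (measure_mono h2) (lt_of_le_of_lt h1 ?_)
  refine ENNReal.mul_lt_top (by simp) ?_
  exact (isCompact_Icc.prod isCompact_Icc).measure_lt_top

lemma hausdorff_unit_pos : 0 < (μH[2] : Measure (E 2)) (unitSphere 2) := by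
  let p : E 2 → ℝ × ℝ := fun x => (x 0, x 1)
  have hp : LipschitzWith 1 p := by
    apply LipschitzWith.mk_one
    intro x y
    rw [Prod.dist_eq, max_le_iff]
    have h := fun i => EuclideanSpace.norm_eq (x - y) ▸ (PiLp.norm_apply_le (x - y) i)
    constructor
    · have := PiLp.norm_apply_le (x - y) 0
      rw [dist_eq_norm x y]; simpa [Real.dist_eq, p] using this
    · have := PiLp.norm_apply_le (x - y) 1
      rw [dist_eq_norm x y]; simpa [Real.dist_eq, p] using this
  have h1 := hp.hausdorffMeasure_image_le (d := 2) (by norm_num) (unitSphere 2)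
  rw [hausdorffMeasure_prod_real] at h1
  have h2 : Set.Icc (0 : ℝ) (1/2) ×ˢ Set.Icc (0 : ℝ) (1/2) ⊆ p '' (unitSphere 2) := by
    rintro ⟨a, b⟩ ⟨⟨ha, ha'⟩, ⟨hb, hb'⟩⟩
    simp only at ha ha' hb hb'
    refine ⟨!₂[a, b, √(1 - a^2 - b^2)], ?_, by simp [p]⟩
    rw [mem_unit]
    have h0 : 0 ≤ 1 - a^2 - b^2 := by nlinarith
    have := EuclideanSpace.real_norm_sq_eq (!₂[a, b, √(1 - a^2 - b^2)] : E 2)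
    rw [Fin.sum_univ_three] at this
    simp at this
    rw [Real.sq_sqrt h0] at this
    have h3 : ‖(!₂[a, b, √(1 - a^2 - b^2)] : E 2)‖ ^ 2 = 1 := by rw [this]; ring
    have h4 := norm_nonneg (!₂[a, b, √(1 - a^2 - b^2)] : E 2)
    nlinarith
  have h3 : 0 < (volume : Measure (ℝ × ℝ)) (Set.Icc (0 : ℝ) (1/2) ×ˢ Set.Icc (0 : ℝ) (1/2)) := by
    rw [Measure.volume_eq_prod, Measure.prod_prod]
    simp
  have h4 := (h3.trans_le (measure_mono h2)).trans_le h1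
  simpa using h4

instance : IsFiniteMeasure sm := ⟨by
  unfold sm; rw [Measure.restrict_apply_univ]; exact hausdorff_unit_lt_top⟩

lemma sm_univ_pos : 0 < sm.real Set.univ := by
  rw [measureReal_def, ENNReal.toReal_pos_iff]
  refine ⟨?_, measure_lt_top _ _⟩
  unfold sm; rw [Measure.restrict_apply_univ]; exact hausdorff_unit_pos

/-- normalising constant: total area is `4 π M`. -/
def M : ℝ := sm.real Set.univ / (4 * π)

lemma M_pos : 0 < M := div_pos sm_univ_pos (by positivity)

lemma sm_univ : sm.real Set.univ = 4 * π * M := by unfold M; field_simp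

lemma area_eq {X : Set (E 2)} (h : X ⊆ unitSphere 2) : area X = sm.real X := by
  unfold area sm
  rw [measureReal_def, Measure.restrict_apply' meas_unit, Set.inter_eq_left.2 h]

lemma sm_preserving (f : E 2 ≃ₗᵢ[ℝ] E 2) : MeasurePreserving f sm sm := by
  have h := (f.toIsometryEquiv).measurePreserving_hausdorffMeasure 2
  have h2 := h.restrict_preimage meas_unit
  have h3 : f.toIsometryEquiv ⁻¹' (unitSphere 2) = unitSphere 2 := by
    ext x; simp [mem_unit]
  rw [h3] at h2
  exact h2

lemma sm_singleton (x : E 2) : sm {x} = 0 := by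
  have : (μH[2] : Measure (E 2)) {x} = 0 := by
    have := Measure.nullSingletonClass_hausdorff (E 2) (d := 2) (by norm_num)
    exact measure_singleton x
  exact le_antisymm ((Measure.restrict_apply_le _ _).trans this.le) (zero_le)

lemma frame2 {o e : E 2} (ho : ‖o‖ = 1) (he : ‖e‖ = 1) (h : ⟪o, e⟫ = 0) :
    ∃ b : OrthonormalBasis (Fin 3) ℝ (E 2), b 0 = o ∧ b 1 = e := by
  have hv : Orthonormal ℝ (({0, 1} : Set (Fin 3)).domRestrict ![o, e, 0]) := by
    constructor
    · rintro ⟨i, hi⟩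
      rcases hi with rfl | hi
      · simpa using ho
      · rw [Set.mem_singleton_iff] at hi; subst hi; simpa using he
    · rintro ⟨i, hi⟩ ⟨j, hj⟩ hij
      rcases hi with rfl | hi <;> rcases hj with rfl | hj
      · exact absurd rfl hij
      · rw [Set.mem_singleton_iff] at hj; subst hj; simpa using h
      · rw [Set.mem_singleton_iff] at hi; subst hi
        simpa [real_inner_comm] using h
      · rw [Set.mem_singleton_iff] at hi hj; subst hi; subst hj; exact absurd rfl hij
  obtain ⟨b, hb⟩ := hv.exists_orthonormalBasis_extension_of_card_eq (by simp)
  exact ⟨b, by simpa using hb 0 (by simp), by simpa using hb 1 (by simp)⟩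

lemma frame1 {o : E 2} (ho : ‖o‖ = 1) :
    ∃ b : OrthonormalBasis (Fin 3) ℝ (E 2), b 0 = o := by
  have hv : Orthonormal ℝ (({0} : Set (Fin 3)).domRestrict ![o, 0, 0]) := by
    constructor
    · rintro ⟨i, hi⟩
      rw [Set.mem_singleton_iff] at hi; subst hi; simpa using ho
    · rintro ⟨i, hi⟩ ⟨j, hj⟩ hij
      rw [Set.mem_singleton_iff] at hi hj; subst hi; subst hj; exact absurd rfl hij
  obtain ⟨b, hb⟩ := hv.exists_orthonormalBasis_extension_of_card_eq (by simp)
  exact ⟨b, by simpa using hb 0 (by simp)⟩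

lemma b_inner (b : OrthonormalBasis (Fin 3) ℝ (E 2)) (x y : E 2) :
    ⟪x, y⟫ = ⟪x, b 0⟫ * ⟪y, b 0⟫ + ⟪x, b 1⟫ * ⟪y, b 1⟫ + ⟪x, b 2⟫ * ⟪y, b 2⟫ := by
  have := b.sum_inner_mul_inner x y
  rw [Fin.sum_univ_three] at this
  rw [← this, real_inner_comm (b 0) y, real_inner_comm (b 1) y, real_inner_comm (b 2) y]

lemma b_repr (b : OrthonormalBasis (Fin 3) ℝ (E 2)) (x : E 2) :
    x = ⟪x, b 0⟫ • b 0 + ⟪x, b 1⟫ • b 1 + ⟪x, b 2⟫ • b 2 := by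
  have := b.sum_repr' x
  rw [Fin.sum_univ_three] at this
  rw [real_inner_comm (b 0) x, real_inner_comm (b 1) x, real_inner_comm (b 2) x]
  exact this.symm

lemma b_one (b : OrthonormalBasis (Fin 3) ℝ (E 2)) (i : Fin 3) : ⟪b i, b i⟫ = 1 := by
  rw [real_inner_self_eq_norm_sq, b.norm_eq_one]; norm_num

lemma b_zero (b : OrthonormalBasis (Fin 3) ℝ (E 2)) {i j : Fin 3} (h : i ≠ j) :
    ⟪b i, b j⟫ = 0 := b.inner_eq_zero h

lemma b_norm (b : OrthonormalBasis (Fin 3) ℝ (E 2)) (x : E 2) :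
    ‖x‖ ^ 2 = ⟪x, b 0⟫ ^ 2 + ⟪x, b 1⟫ ^ 2 + ⟪x, b 2⟫ ^ 2 := by
  rw [← real_inner_self_eq_norm_sq, b_inner b]; ring

lemma norm_one_of_sq {x : E 2} (h : ⟪x, x⟫ = 1) : ‖x‖ = 1 := by
  rw [real_inner_self_eq_norm_sq] at h
  have := norm_nonneg x
  nlinarith

lemma sq_of_norm_one {x : E 2} (h : ‖x‖ = 1) : ⟪x, x⟫ = 1 := by
  rw [real_inner_self_eq_norm_sq, h]; norm_num

end Pal

namespace Pal

instance factTwoPi : Fact (0 < 2 * π) := ⟨by positivity⟩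

/-- rotation about the axis `b 0` -/
lemma exists_rot (b : OrthonormalBasis (Fin 3) ℝ (E 2)) (θ : ℝ) :
    ∃ g : E 2 ≃ₗᵢ[ℝ] E 2, g (b 0) = b 0 ∧
      (∀ x, ⟪g x, b 1⟫ = cos θ * ⟪x, b 1⟫ - sin θ * ⟪x, b 2⟫) ∧
      (∀ x, ⟪g x, b 2⟫ = sin θ * ⟪x, b 1⟫ + cos θ * ⟪x, b 2⟫) := by
  have h00 := b_one b 0
  have h11 := b_one b 1
  have h22 := b_one b 2
  have h01 : ⟪b 0, b 1⟫ = 0 := b_zero b (by decide)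
  have h02 : ⟪b 0, b 2⟫ = 0 := b_zero b (by decide)
  have h12 : ⟪b 1, b 2⟫ = 0 := b_zero b (by decide)
  have h10 : ⟪b 1, b 0⟫ = 0 := b_zero b (by decide)
  have h20 : ⟪b 2, b 0⟫ = 0 := b_zero b (by decide)
  have h21 : ⟪b 2, b 1⟫ = 0 := b_zero b (by decide)
  have hsc := Real.sin_sq_add_cos_sq θ
  let v : Fin 3 → E 2 := ![b 0, cos θ • b 1 + sin θ • b 2, (-sin θ) • b 1 + cos θ • b 2]
  have hv : Orthonormal ℝ v := by
    rw [orthonormal_iff_ite]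
    intro i j
    fin_cases i <;> fin_cases j <;>
      simp only [v, Fin.zero_eta, Fin.mk_one, Fin.reduceFinMk, Matrix.cons_val_zero,
        Matrix.cons_val_one, Matrix.cons_val, inner_add_left, inner_add_right,
        real_inner_smul_left, real_inner_smul_right, h00, h11, h22, h01, h02, h12, h10, h20, h21] <;>
      simp <;> nlinarith
  let B := basisOfOrthonormalOfCardEqFinrank hv (by simp)
  have hB : ∀ i, B i = v i := fun i => by
    simp only [B, coe_basisOfOrthonormalOfCardEqFinrank]
  let b' : OrthonormalBasis (Fin 3) ℝ (E 2) := B.toOrthonormalBasis (by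
    have : (B : Fin 3 → E 2) = v := funext hB
    rw [this]; exact hv)
  have hb' : ∀ i, b' i = v i := fun i => by simp [b', hB]
  let g := b.equiv b' (Equiv.refl _)
  have hg : ∀ i, g (b i) = v i := fun i => by simp [g, hb']
  have hx : ∀ x i, ⟪g x, v i⟫ = ⟪x, b i⟫ := fun x i => by rw [← hg, g.inner_map_map]
  have e1 : b 1 = cos θ • v 1 - sin θ • v 2 := by
    simp only [v, Matrix.cons_val_one, Matrix.cons_val]
    have : b 1 = (sin θ ^ 2 + cos θ ^ 2) • b 1 := by rw [hsc, one_smul]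
    nth_rewrite 1 [this]
    module
  have e2 : b 2 = sin θ • v 1 + cos θ • v 2 := by
    simp only [v, Matrix.cons_val_one, Matrix.cons_val]
    have : b 2 = (sin θ ^ 2 + cos θ ^ 2) • b 2 := by rw [hsc, one_smul]
    nth_rewrite 1 [this]
    module
  refine ⟨g, by rw [hg]; rfl, fun x => ?_, fun x => ?_⟩
  · nth_rewrite 1 [e1]
    rw [inner_sub_right, real_inner_smul_right, real_inner_smul_right, hx, hx]
  · nth_rewrite 1 [e2]
    rw [inner_add_right, real_inner_smul_right, real_inner_smul_right, hx, hx]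

/-- horizontal complex coordinate -/
def zc (b : OrthonormalBasis (Fin 3) ℝ (E 2)) (x : E 2) : ℂ := ⟨⟪x, b 1⟫, ⟪x, b 2⟫⟩

lemma meas_zc (b : OrthonormalBasis (Fin 3) ℝ (E 2)) : Measurable (zc b) := by
  have : zc b = fun x => ((⟪x, b 1⟫ : ℝ) : ℂ) + ((⟪x, b 2⟫ : ℝ) : ℂ) * Complex.I := by
    funext x; apply Complex.ext <;> simp [zc]
  rw [this]
  apply Continuous.measurable
  fun_prop

lemma axis_null (b : OrthonormalBasis (Fin 3) ℝ (E 2)) : sm {x | zc b x = 0} = 0 := by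
  have h : {x | zc b x = 0} ∩ unitSphere 2 ⊆ {b 0} ∪ {-b 0} := by
    rintro x ⟨hx, hx1⟩
    rw [mem_unit] at hx1
    have h1 : ⟪x, b 1⟫ = 0 := by simpa [zc] using congrArg Complex.re hx
    have h2 : ⟪x, b 2⟫ = 0 := by simpa [zc] using congrArg Complex.im hx
    have h3 := b_norm b x
    rw [h1, h2, hx1] at h3
    have h4 := b_repr b x
    rw [h1, h2] at h4
    have h5 : ⟪x, b 0⟫ = 1 ∨ ⟪x, b 0⟫ = -1 := by
      have : (⟪x, b 0⟫ - 1) * (⟪x, b 0⟫ + 1) = 0 := by nlinarith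
      rcases mul_eq_zero.1 this with h | h
      · left; linarith
      · right; linarith
    rcases h5 with h | h
    · left; rw [h] at h4; simpa using h4
    · right; rw [h] at h4; simpa using h4
  have hs : sm {x | zc b x = 0} = sm ({x | zc b x = 0} ∩ unitSphere 2) := by
    unfold sm
    rw [Measure.restrict_apply' meas_unit, Measure.restrict_apply' meas_unit, Set.inter_assoc,
      Set.inter_self]
  rw [hs]
  refine measure_mono_null h (measure_union_null (sm_singleton _) (sm_singleton _))

/-- angular coordinate -/
def ang (b : OrthonormalBasis (Fin 3) ℝ (E 2)) (x : E 2) : AddCircle (2 * π) :=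
  ((zc b x).arg : ℝ)

lemma meas_ang (b : OrthonormalBasis (Fin 3) ℝ (E 2)) : Measurable (ang b) := by
  unfold ang
  exact (AddCircle.measurable_mk').comp (Complex.measurable_arg.comp (meas_zc b))

lemma ang_measure (b : OrthonormalBasis (Fin 3) ℝ (E 2)) (A : Set (E 2)) (hA : MeasurableSet A)
    (hinv : ∀ g : E 2 ≃ₗᵢ[ℝ] E 2, g (b 0) = b 0 → g ⁻¹' A = A)
    (U : Set (AddCircle (2 * π))) (hU : MeasurableSet U) :
    sm.real (A ∩ ang b ⁻¹' U) = sm.real A / (2 * π) * (volume U).toReal := by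
  set A' := A \ {x | zc b x = 0} with hA'
  have hAm : MeasurableSet A' := hA.diff (meas_zc b (measurableSet_singleton 0))
  set ν := (sm.restrict A').map (ang b) with hν
  have hfin : IsFiniteMeasure ν := by rw [hν]; infer_instance
  have hleft : ν.IsAddLeftInvariant := by
    constructor
    intro t
    induction t using QuotientAddGroup.induction_on with
    | H θ =>
    obtain ⟨g, hg0, hg1, hg2⟩ := exists_rot b θ
    have hz : ∀ x, zc b (g x) = Complex.exp (θ * Complex.I) * zc b x := by
      intro x
      rw [Complex.exp_mul_I, ← Complex.ofReal_cos, ← Complex.ofReal_sin]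
      apply Complex.ext
      · simp [zc, hg1, -Complex.ofReal_cos, -Complex.ofReal_sin]
      · simp [zc, hg2, -Complex.ofReal_cos, -Complex.ofReal_sin]; ring
    have hgA : g ⁻¹' A' = A' := by
      rw [hA', Set.preimage_sdiff, hinv g hg0]
      congr 1
      ext x; simp [hz]
    have hmp := (sm_preserving g).restrict_preimage hAm
    rw [hgA] at hmp
    rw [hν, Measure.map_map (by fun_prop) (meas_ang b)]
    have hae : ((fun x => (θ : AddCircle (2*π)) + x) ∘ ang b) =ᵐ[sm.restrict A'] (ang b ∘ g) := by
      filter_upwards [ae_restrict_mem hAm] with x hx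
      have hx0 : zc b x ≠ 0 := hx.2
      simp only [Function.comp, ang, hz]
      have := Complex.arg_mul_coe_angle (Complex.exp_ne_zero (θ * Complex.I)) hx0
      have h2 : ((Complex.exp (θ * Complex.I)).arg : Real.Angle) = θ := by
        have := Complex.arg_cos_add_sin_mul_I_coe_angle (θ : Real.Angle)
        simp only [Real.Angle.cos_coe, Real.Angle.sin_coe] at this
        rw [Complex.exp_mul_I, ← Complex.ofReal_cos, ← Complex.ofReal_sin]
        exact this
      rw [h2] at this
      exact this.symm
    refine (Measure.map_congr hae).trans ?_
    rw [← Measure.map_map (meas_ang b) hmp.measurable, hmp.map_eq]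
  have heq := Measure.isAddLeftInvariant_eq_smul ν (volume : Measure (AddCircle (2 * π)))
  set k := Measure.addHaarScalarFactor ν (volume : Measure (AddCircle (2 * π)))
  have hAA : ∀ V : Set (E 2), sm (A ∩ V) = sm (A' ∩ V) := by
    intro V
    apply le_antisymm
    · have : A ∩ V ⊆ (A' ∩ V) ∪ {x | zc b x = 0} := by
        rintro x ⟨h1, h2⟩
        by_cases h : zc b x = 0
        · right; exact h
        · left; exact ⟨⟨h1, h⟩, h2⟩
      refine (measure_mono this).trans ((measure_union_le _ _).trans ?_)
      rw [axis_null, add_zero]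
    · exact measure_mono (Set.inter_subset_inter_left _ Set.sdiff_subset)
  have hval : ∀ V, MeasurableSet V → sm (A ∩ ang b ⁻¹' V) = k * volume V := by
    intro V hV
    have : ν V = k * volume V := by rw [heq]; simp
    rw [← this, hν, Measure.map_apply (meas_ang b) hV,
      Measure.restrict_apply (meas_ang b hV), hAA, Set.inter_comm]
  have h1 := hval Set.univ MeasurableSet.univ
  rw [Set.preimage_univ, Set.inter_univ, AddCircle.measure_univ] at h1
  rw [measureReal_def, measureReal_def, hval U hU, h1, ENNReal.toReal_mul, ENNReal.toReal_mul,
    ENNReal.toReal_ofReal (by positivity)]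
  field_simp


/-- arc of the circle -/
def arcU (γ : ℝ) : Set (AddCircle (2 * π)) :=
  {t | 0 ≤ Real.Angle.cos t ∧ 0 ≤ Real.Angle.cos (t - (γ : AddCircle (2 * π)))}

lemma coe_mem_arcU (γ t : ℝ) : (t : AddCircle (2 * π)) ∈ arcU γ ↔ 0 ≤ cos t ∧ 0 ≤ cos (t - γ) := by
  have h1 : Real.Angle.cos (t : AddCircle (2 * π)) = cos t := Real.Angle.cos_coe t
  have h2 : Real.Angle.cos ((t : AddCircle (2 * π)) - (γ : AddCircle (2 * π))) = cos (t - γ) :=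
    Real.Angle.cos_coe (t - γ)
  show 0 ≤ _ ∧ 0 ≤ _ ↔ _
  rw [h1, h2]

lemma closed_arcU (γ : ℝ) : IsClosed (arcU γ) := by
  have hc : Continuous (fun t : AddCircle (2 * π) => Real.Angle.cos t) := Real.Angle.continuous_cos
  exact (isClosed_le continuous_const hc).inter
    (isClosed_le continuous_const (hc.comp (continuous_id.sub continuous_const)))

lemma vol_arc {γ : ℝ} (h1 : -π ≤ γ) (h2 : γ ≤ π) :
    (volume (arcU γ)).toReal = π - |γ| := by
  have hp := pi_pos
  rw [AddCircle.add_projection_respects_measure (2 * π) (-π) (closed_arcU γ).measurableSet]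
  set W := (QuotientAddGroup.mk ⁻¹' arcU γ ∩ Set.Ioc (-π) (-π + 2 * π) : Set ℝ) with hW
  have hmem : ∀ t, t ∈ W ↔ (0 ≤ cos t ∧ 0 ≤ cos (t - γ)) ∧ -π < t ∧ t ≤ -π + 2 * π := fun t =>
    and_congr (coe_mem_arcU γ t) Iff.rfl
  have hsub : W ⊆ Set.Icc (max (-(π/2)) (γ - π/2)) (min (π/2) (γ + π/2)) ∪ {π/2, -(π/2)} := by
    intro t ht
    obtain ⟨⟨a1, a2⟩, a3, a4⟩ := (hmem t).1 ht
    have b1 : -(π/2) ≤ t := by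
      by_contra hcon
      push Not at hcon
      have := cos_neg_of_pi_div_two_lt_of_lt (x := -t) (by linarith) (by linarith)
      rw [cos_neg] at this; linarith
    have b2 : t ≤ π/2 := by
      by_contra hcon
      push Not at hcon
      have := cos_neg_of_pi_div_two_lt_of_lt (x := t) (by linarith) (by linarith)
      linarith
    by_cases e1 : t = π/2
    · right; left; exact e1
    by_cases e2 : t = -(π/2)
    · right; right; exact e2
    left
    have e1 := lt_of_le_of_ne b2 e1
    have e2 := lt_of_le_of_ne b1 (Ne.symm e2)
    refine ⟨max_le b1 ?_, le_min b2 ?_⟩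
    · by_contra hcon
      push Not at hcon
      have := cos_neg_of_pi_div_two_lt_of_lt (x := -(t - γ)) (by linarith) (by linarith)
      rw [cos_neg] at this; linarith
    · by_contra hcon
      push Not at hcon
      have := cos_neg_of_pi_div_two_lt_of_lt (x := t - γ) (by linarith) (by linarith)
      linarith
  have hsup : Set.Icc (max (-(π/2)) (γ - π/2)) (min (π/2) (γ + π/2)) ⊆ W := by
    rintro t ⟨ht1, ht2⟩
    rw [max_le_iff] at ht1
    rw [le_min_iff] at ht2
    rw [hmem]
    refine ⟨⟨cos_nonneg_of_neg_pi_div_two_le_of_le ht1.1 ht2.1,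
      cos_nonneg_of_neg_pi_div_two_le_of_le (by linarith) (by linarith)⟩, by linarith, by linarith⟩
  have hv : volume W = volume (Set.Icc (max (-(π/2)) (γ - π/2)) (min (π/2) (γ + π/2))) := by
    apply le_antisymm _ (measure_mono hsup)
    refine (measure_mono hsub).trans ((measure_union_le _ _).trans ?_)
    have : volume ({π/2, -(π/2)} : Set ℝ) = 0 := (Set.Finite.measure_zero (by simp) _)
    rw [this, add_zero]
  rw [hv, Real.volume_Icc]
  rcases le_total 0 γ with h | h
  · rw [max_eq_right (by linarith), min_eq_left (by linarith), abs_of_nonneg h,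
      ENNReal.toReal_ofReal (by linarith)]; ring
  · rw [max_eq_left (by linarith), min_eq_right (by linarith), abs_of_nonpos h,
      ENNReal.toReal_ofReal (by linarith)]; ring

lemma wedge {o n₁ n₂ : E 2} (ho : ‖o‖ = 1) (h1 : ‖n₁‖ = 1) (h2 : ‖n₂‖ = 1)
    (ho1 : ⟪o, n₁⟫ = 0) (ho2 : ⟪o, n₂⟫ = 0) (A : Set (E 2)) (hA : MeasurableSet A)
    (hinv : ∀ g : E 2 ≃ₗᵢ[ℝ] E 2, g o = o → g ⁻¹' A = A) :
    sm.real (A ∩ {x | 0 ≤ ⟪x, n₁⟫ ∧ 0 ≤ ⟪x, n₂⟫}) =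
      sm.real A / (2 * π) * (π - arccos ⟪n₁, n₂⟫) := by
  obtain ⟨b, hb0, hb1⟩ := frame2 ho h1 ho1
  set z := zc b n₂ with hz
  have hn2 : ⟪n₂, b 1⟫ ^ 2 + ⟪n₂, b 2⟫ ^ 2 = 1 := by
    have := b_norm b n₂
    rw [h2, hb0, real_inner_comm, ho2] at this
    linarith
  have hz1 : ‖z‖ = 1 := by
    rw [Complex.norm_def, Complex.normSq_apply]
    simp only [hz, zc]
    rw [Real.sqrt_eq_one]; nlinarith
  set γ := z.arg with hγ
  have hcg : cos γ = ⟪n₂, b 1⟫ := by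
    have := Complex.norm_mul_cos_arg z
    rw [hz1, one_mul] at this; exact this
  have hsg : sin γ = ⟪n₂, b 2⟫ := by
    have := Complex.norm_mul_sin_arg z
    rw [hz1, one_mul] at this; exact this
  have habs : |γ| = arccos ⟪n₁, n₂⟫ := by
    rw [← hb1, real_inner_comm, ← hcg, ← cos_abs, arccos_cos (abs_nonneg _)]
    exact Complex.abs_arg_le_pi z
  have key := ang_measure b A hA (by rw [hb0]; exact hinv) (arcU γ) (closed_arcU γ).measurableSet
  rw [vol_arc (Complex.neg_pi_lt_arg z).le (Complex.arg_le_pi z), habs] at key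
  rw [← key]
  rw [measureReal_def, measureReal_def]
  congr 1
  apply measure_congr
  have hax : ∀ᵐ x ∂sm, zc b x ≠ 0 := by
    rw [ae_iff]; simpa using axis_null b
  filter_upwards [hax] with x hx
  have hpos : 0 < ‖zc b x‖ := norm_pos_iff.2 hx
  have e1 : ⟪x, n₁⟫ = ‖zc b x‖ * cos (zc b x).arg := by
    rw [Complex.norm_mul_cos_arg, ← hb1]; rfl
  have e2 : ⟪x, n₂⟫ = ‖zc b x‖ * cos ((zc b x).arg - γ) := by
    rw [cos_sub, mul_add, ← mul_assoc, ← mul_assoc, Complex.norm_mul_cos_arg,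
      Complex.norm_mul_sin_arg, b_inner b x n₂, hcg, hsg, hb0, real_inner_comm o n₂, ho2]
    simp [zc]
  have : (x ∈ A ∩ {x | 0 ≤ ⟪x, n₁⟫ ∧ 0 ≤ ⟪x, n₂⟫}) = (x ∈ A ∩ ang b ⁻¹' arcU γ) := by
    apply propext
    refine and_congr Iff.rfl ?_
    refine Iff.trans ?_ (coe_mem_arcU γ _).symm
    show 0 ≤ ⟪x, n₁⟫ ∧ 0 ≤ ⟪x, n₂⟫ ↔ _
    rw [e1, e2, mul_nonneg_iff_of_pos_left hpos, mul_nonneg_iff_of_pos_left hpos]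
  exact this

/-- area of a lune -/
lemma lune_area {n₁ n₂ : E 2} (h1 : ‖n₁‖ = 1) (h2 : ‖n₂‖ = 1) :
    sm.real {x | 0 ≤ ⟪x, n₁⟫ ∧ 0 ≤ ⟪x, n₂⟫} = 2 * M * (π - arccos ⟪n₁, n₂⟫) := by
  obtain ⟨o, ho, ho1, ho2⟩ : ∃ o : E 2, ‖o‖ = 1 ∧ ⟪o, n₁⟫ = 0 ∧ ⟪o, n₂⟫ = 0 := by
    obtain ⟨b, hb⟩ := frame1 h1
    have h01 : ⟪b 1, b 0⟫ = 0 := b_zero b (by decide)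
    have h02 : ⟪b 2, b 0⟫ = 0 := b_zero b (by decide)
    have h12 : ⟪b 1, b 2⟫ = 0 := b_zero b (by decide)
    have h21 : ⟪b 2, b 1⟫ = 0 := b_zero b (by decide)
    have e1 := b_one b 1
    have e2 := b_one b 2
    by_cases h : ⟪b 1, n₂⟫ = 0
    · exact ⟨b 1, b.norm_eq_one 1, by rw [← hb]; exact h01, h⟩
    · set t := ⟪b 1, n₂⟫
      set v := t • b 2 - ⟪b 2, n₂⟫ • b 1 with hv
      have hv0 : v ≠ 0 := by
        intro h0
        have : ⟪v, b 2⟫ = t := by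
          rw [hv, inner_sub_left, real_inner_smul_left, real_inner_smul_left, e2, h12]; ring
        rw [h0, inner_zero_left] at this
        exact h this.symm
      refine ⟨‖v‖⁻¹ • v, norm_smul_inv_norm hv0, ?_, ?_⟩
      · rw [real_inner_smul_left, hv, ← hb, inner_sub_left, real_inner_smul_left,
          real_inner_smul_left, h01, h02]; ring
      · rw [real_inner_smul_left, hv, inner_sub_left, real_inner_smul_left,
          real_inner_smul_left]; ring
  have := wedge ho h1 h2 ho1 ho2 Set.univ MeasurableSet.univ (by simp)
  rw [Set.univ_inter, sm_univ] at this
  rw [this]; field_simp; ring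

lemma circle_null {n : E 2} (h : ‖n‖ = 1) : sm {x | ⟪x, n⟫ = 0} = 0 := by
  have h1 := lune_area (n₁ := n) (n₂ := -n) h (by rw [norm_neg, h])
  have h2 : {x : E 2 | 0 ≤ ⟪x, n⟫ ∧ 0 ≤ ⟪x, -n⟫} = {x | ⟪x, n⟫ = 0} := by
    ext x; simp only [Set.mem_ofPred_eq, inner_neg_right]
    constructor
    · rintro ⟨a, b⟩; linarith
    · intro a; rw [a]; simp
  rw [h2, inner_neg_right, sq_of_norm_one h, arccos_neg_one, sub_self, mul_zero] at h1
  rwa [measureReal_eq_zero_iff] at h1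

end Pal

namespace Pal

lemma hs_closed (u : E 2) : IsClosed {x : E 2 | 0 ≤ ⟪x, u⟫} :=
  isClosed_le continuous_const (by fun_prop)

lemma hemi_area {u : E 2} (h : ‖u‖ = 1) : sm.real {x : E 2 | 0 ≤ ⟪x, u⟫} = 2 * π * M := by
  have h1 := lune_area h h
  simp only [and_self] at h1
  rw [h1, sq_of_norm_one h, arccos_one]; ring

/-- Girard formula -/
lemma tri_area {u₁ u₂ u₃ : E 2} (h1 : ‖u₁‖ = 1) (h2 : ‖u₂‖ = 1) (h3 : ‖u₃‖ = 1) :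
    sm.real {x | 0 ≤ ⟪x, u₁⟫ ∧ 0 ≤ ⟪x, u₂⟫ ∧ 0 ≤ ⟪x, u₃⟫} =
      M * ((π - arccos ⟪u₁, u₂⟫) + (π - arccos ⟪u₁, u₃⟫) + (π - arccos ⟪u₂, u₃⟫) - π) := by
  set H₁ := {x : E 2 | 0 ≤ ⟪x, u₁⟫}
  set H₂ := {x : E 2 | 0 ≤ ⟪x, u₂⟫}
  set H₃ := {x : E 2 | 0 ≤ ⟪x, u₃⟫}
  have m1 : MeasurableSet H₁ := (hs_closed u₁).measurableSet
  have m2 : MeasurableSet H₂ := (hs_closed u₂).measurableSet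
  have m3 : MeasurableSet H₃ := (hs_closed u₃).measurableSet
  have L12 : sm.real (H₁ ∩ H₂) = 2 * M * (π - arccos ⟪u₁, u₂⟫) := lune_area h1 h2
  have L13 : sm.real (H₁ ∩ H₃) = 2 * M * (π - arccos ⟪u₁, u₃⟫) := lune_area h1 h3
  have L23 : sm.real (H₂ ∩ H₃) = 2 * M * (π - arccos ⟪u₂, u₃⟫) := lune_area h2 h3
  have L1 : sm.real H₁ = 2 * π * M := hemi_area h1
  have hT : {x : E 2 | 0 ≤ ⟪x, u₁⟫ ∧ 0 ≤ ⟪x, u₂⟫ ∧ 0 ≤ ⟪x, u₃⟫} = (H₁ ∩ H₂) ∩ H₃ := by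
    ext x; exact and_assoc.symm
  rw [hT]
  have e1 := measureReal_inter_add_sdiff (μ := sm) (s := H₁ ∩ H₃) m2
  have e2 := measureReal_inter_add_sdiff (μ := sm) (s := H₁) m2
  have e3 := measureReal_inter_add_sdiff (μ := sm) (s := H₁ \ H₂) m3
  have e4 := measureReal_inter_add_sdiff (μ := sm) (s := H₂ ∩ H₃) m1
  have r1 : H₁ ∩ H₃ ∩ H₂ = H₁ ∩ H₂ ∩ H₃ := by ext x; simp; tauto
  have r2 : H₂ ∩ H₃ ∩ H₁ = H₁ ∩ H₂ ∩ H₃ := by ext x; simp; tauto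
  have r3 : (H₁ \ H₂) ∩ H₃ = (H₁ ∩ H₃) \ H₂ := by ext x; simp; tauto
  have r4 : sm.real ((H₁ \ H₂) \ H₃) = sm.real ((H₂ ∩ H₃) \ H₁) := by
    have hp := (sm_preserving (LinearIsometryEquiv.neg ℝ)).measure_preimage
      (((m1.diff m2).diff m3).nullMeasurableSet)
    rw [measureReal_def, measureReal_def, ← hp]
    congr 1
    apply measure_congr
    have n1 : ∀ᵐ x ∂sm, ⟪x, u₁⟫ ≠ 0 := by rw [ae_iff]; simpa using circle_null h1
    have n2 : ∀ᵐ x ∂sm, ⟪x, u₂⟫ ≠ 0 := by rw [ae_iff]; simpa using circle_null h2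
    have n3 : ∀ᵐ x ∂sm, ⟪x, u₃⟫ ≠ 0 := by rw [ae_iff]; simpa using circle_null h3
    filter_upwards [n1, n2, n3] with x k1 k2 k3
    apply propext
    show (((0 ≤ ⟪-x, u₁⟫) ∧ ¬ (0 ≤ ⟪-x, u₂⟫)) ∧ ¬ (0 ≤ ⟪-x, u₃⟫)) ↔
      ((0 ≤ ⟪x, u₂⟫) ∧ (0 ≤ ⟪x, u₃⟫)) ∧ ¬ (0 ≤ ⟪x, u₁⟫)
    simp only [inner_neg_left, not_le]
    have k1' := lt_or_gt_of_ne k1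
    have k2' := lt_or_gt_of_ne k2
    have k3' := lt_or_gt_of_ne k3
    constructor
    · rintro ⟨⟨a, b⟩, c⟩
      refine ⟨⟨by linarith, by linarith⟩, ?_⟩
      rcases k1' with h | h
      · exact h
      · linarith
    · rintro ⟨⟨a, b⟩, c⟩
      refine ⟨⟨by linarith, ?_⟩, ?_⟩
      · rcases k2' with h | h <;> linarith
      · rcases k3' with h | h <;> linarith
  rw [r1] at e1
  rw [r2] at e4
  rw [r3, r4] at e3
  have L12' := L12
  nlinarith

/-- spherical cap -/
def cap (o : E 2) (r : ℝ) : Set (E 2) := {x ∈ unitSphere 2 | cos r ≤ ⟪x, o⟫}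

lemma cap_meas (o : E 2) (r : ℝ) : MeasurableSet (cap o r) :=
  (isClosed_unit.inter (isClosed_le (f := fun _ : E 2 => cos r) (g := fun x : E 2 => ⟪x, o⟫)
    continuous_const (by fun_prop))).measurableSet

lemma cap_inv (o : E 2) (r : ℝ) (g : E 2 ≃ₗᵢ[ℝ] E 2) (hg : g o = o) :
    g ⁻¹' (cap o r) = cap o r := by
  ext x
  simp only [cap, Set.mem_preimage, Set.mem_ofPred_eq, mem_unit, g.norm_map]
  nth_rewrite 1 [← hg]
  rw [g.inner_map_map]

end Pal

namespace Pal
set_option linter.unusedSimpArgs false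

lemma sm_real_mono_sphere {X Y : Set (E 2)} (h : ∀ x ∈ X, ‖x‖ = 1 → x ∈ Y) :
    sm.real X ≤ sm.real Y := by
  have : sm.real X = sm.real (X ∩ unitSphere 2) := by
    unfold sm
    rw [measureReal_def, measureReal_def, Measure.restrict_apply' meas_unit,
      Measure.restrict_apply' meas_unit, Set.inter_assoc, Set.inter_self]
  rw [this]
  exact measureReal_mono (fun x hx => h x hx.1 (mem_unit.1 hx.2))

lemma wedge_normals_inner {f g : E 2} (hf : ⟪f, f⟫ = 1) (hg : ⟪g, g⟫ = 1)
    (hfg : ⟪f, g⟫ = 0) (ψ : ℝ) :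
    ⟪sin ψ • f - cos ψ • g, sin ψ • f + cos ψ • g⟫ = - cos (2 * ψ) := by
  have hgf : ⟪g, f⟫ = 0 := by rw [real_inner_comm]; exact hfg
  simp only [inner_sub_left, inner_add_right, real_inner_smul_left, real_inner_smul_right,
    hf, hg, hfg, hgf, cos_two_mul]
  nlinarith [sin_sq_add_cos_sq ψ]

lemma wedge_normal_norm {f g : E 2} (hf : ⟪f, f⟫ = 1) (hg : ⟪g, g⟫ = 1)
    (hfg : ⟪f, g⟫ = 0) (ψ : ℝ) :
    ‖sin ψ • f - cos ψ • g‖ = 1 ∧ ‖sin ψ • f + cos ψ • g‖ = 1 := by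
  have hgf : ⟪g, f⟫ = 0 := by rw [real_inner_comm]; exact hfg
  constructor <;> apply norm_one_of_sq <;>
  simp only [inner_sub_left, inner_add_right, inner_sub_right, inner_add_left,
    real_inner_smul_left, real_inner_smul_right, hf, hg, hfg, hgf] <;>
  nlinarith [sin_sq_add_cos_sq ψ]

lemma cap_wedge {o f g : E 2} (ho : ‖o‖ = 1) (hf : ⟪f, f⟫ = 1) (hg : ⟪g, g⟫ = 1)
    (hof : ⟪o, f⟫ = 0) (hog : ⟪o, g⟫ = 0)
    (hfg : ⟪f, g⟫ = 0) (r : ℝ) {ψ : ℝ} (h0 : 0 ≤ ψ) (h1 : ψ ≤ π / 2) :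
    sm.real (cap o r ∩ {x | 0 ≤ ⟪x, sin ψ • f - cos ψ • g⟫ ∧ 0 ≤ ⟪x, sin ψ • f + cos ψ • g⟫}) =
      sm.real (cap o r) * (ψ / π) := by
  obtain ⟨k1, k2⟩ := wedge_normal_norm hf hg hfg ψ
  rw [wedge ho k1 k2 (by simp [inner_sub_right, real_inner_smul_right, hof, hog])
    (by simp [inner_add_right, real_inner_smul_right, hof, hog]) _ (cap_meas o r) (cap_inv o r),
    wedge_normals_inner hf hg hfg, arccos_neg, arccos_cos (by linarith) (by linarith)]
  field_simp; ring

lemma cap_alg {a p q c s cp sp : ℝ} (hc : 0 < c) (hs : 0 < s) (hcp : 0 < cp) (hsp : 0 < sp)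
    (hrs : s ^ 2 + c ^ 2 = 1) (hps : sp ^ 2 + cp ^ 2 = 1) (hx : 1 ^ 2 = a ^ 2 + p ^ 2 + q ^ 2)
    (a1 : 0 ≤ sp * p - cp * q) (a2 : 0 ≤ sp * p + cp * q) (a3 : 0 ≤ s * cp * a - c * p) :
    c ≤ a := by
  have hp : 0 ≤ p := by
    have : 0 ≤ sp * p := by linarith
    exact nonneg_of_mul_nonneg_right this hsp
  have ha : 0 ≤ a := by
    have h2 : 0 ≤ c * p := by positivity
    have h3 : 0 < s * cp := by positivity
    have : 0 ≤ (s * cp) * a := by linarith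
    exact nonneg_of_mul_nonneg_right this h3
  have hq : cp ^ 2 * q ^ 2 ≤ sp ^ 2 * p ^ 2 := by
    linarith [mul_nonneg a1 a2]
  have h4 : c ^ 2 * p ^ 2 ≤ s ^ 2 * cp ^ 2 * a ^ 2 := by
    have : 0 ≤ s * cp * a + c * p := by positivity
    linarith [mul_nonneg a3 this]
  have h5 : cp ^ 2 * (p ^ 2 + q ^ 2) ≤ p ^ 2 := by
    have : p ^ 2 = (sp ^ 2 + cp ^ 2) * p ^ 2 := by rw [hps]; ring
    linarith
  have h6 : cp ^ 2 * (c ^ 2 * (1 - a ^ 2)) ≤ cp ^ 2 * (s ^ 2 * a ^ 2) := by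
    have h8 : 1 - a ^ 2 = p ^ 2 + q ^ 2 := by linarith
    rw [h8]
    have : c ^ 2 * (cp ^ 2 * (p ^ 2 + q ^ 2)) ≤ c ^ 2 * p ^ 2 :=
      mul_le_mul_of_nonneg_left h5 (by positivity)
    linarith
  have h7 := le_of_mul_le_mul_left h6 (by positivity)
  apply abs_le_of_sq_le_sq' _ ha |>.2
  have : a ^ 2 = (s ^ 2 + c ^ 2) * a ^ 2 := by rw [hrs]; ring
  linarith

lemma cap_ineq {o : E 2} (ho : ‖o‖ = 1) {r : ℝ} (hr : 0 < r) (hr2 : r < π / 2) {ψ : ℝ}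
    (h0 : 0 < ψ) (h1 : ψ < π / 2) :
    2 * M * (ψ - arcsin (cos r * sin ψ / √(sin r ^ 2 * cos ψ ^ 2 + cos r ^ 2))) ≤
      sm.real (cap o r) * (ψ / π) := by
  obtain ⟨b, hb⟩ := frame1 ho
  have h00 := b_one b 0
  have h11 := b_one b 1
  have h22 := b_one b 2
  have h01 : ⟪b 0, b 1⟫ = 0 := b_zero b (by decide)
  have h02 : ⟪b 0, b 2⟫ = 0 := b_zero b (by decide)
  have h12 : ⟪b 1, b 2⟫ = 0 := b_zero b (by decide)
  have h10 : ⟪b 1, b 0⟫ = 0 := b_zero b (by decide)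
  have h20 : ⟪b 2, b 0⟫ = 0 := b_zero b (by decide)
  have h21 : ⟪b 2, b 1⟫ = 0 := b_zero b (by decide)
  have hc := cos_pos_of_mem_Ioo ⟨by linarith, hr2⟩
  have hs := sin_pos_of_pos_of_lt_pi hr (by linarith)
  have hcp := cos_pos_of_mem_Ioo ⟨by linarith, h1⟩
  have hsp := sin_pos_of_pos_of_lt_pi h0 (by linarith)
  have hrs := sin_sq_add_cos_sq r
  have hps := sin_sq_add_cos_sq ψ
  set N := √(sin r ^ 2 * cos ψ ^ 2 + cos r ^ 2) with hN
  have hNpos : 0 < N := sqrt_pos.2 (by positivity)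
  have hN2 : N ^ 2 = sin r ^ 2 * cos ψ ^ 2 + cos r ^ 2 := sq_sqrt (by positivity)
  obtain ⟨k1, k2⟩ := wedge_normal_norm h11 h22 h12 ψ
  have hcw := cap_wedge ho h11 h22 (by rw [← hb]; exact h01) (by rw [← hb]; exact h02) h12 r h0.le h1.le
  set n₁ := sin ψ • b 1 - cos ψ • b 2 with hn1
  set n₂ := sin ψ • b 1 + cos ψ • b 2 with hn2
  set m := N⁻¹ • ((sin r * cos ψ) • b 0 - cos r • b 1) with hm
  have km : ‖m‖ = 1 := by
    apply norm_one_of_sq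
    rw [hm]
    simp only [inner_sub_left, inner_sub_right, real_inner_smul_left, real_inner_smul_right, h00, h11, h01, h10]
    field_simp
    nlinarith
  have i1 : ⟪n₁, m⟫ = - (cos r * sin ψ / N) := by
    rw [hm, hn1]
    simp only [inner_sub_left, inner_sub_right, real_inner_smul_left, real_inner_smul_right, h00, h11, h01, h10, h20, h21]
    field_simp; ring
  have i2 : ⟪n₂, m⟫ = - (cos r * sin ψ / N) := by
    rw [hm, hn2]
    simp only [inner_add_left, inner_sub_right, real_inner_smul_left, real_inner_smul_right, h00, h11, h01, h10, h20, h21]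
    field_simp; ring
  have ht := tri_area k1 k2 km
  rw [i1, i2, wedge_normals_inner h11 h22 h12, arccos_neg, arccos_neg,
    arccos_cos (by linarith) (by linarith)] at ht
  rw [← hcw]
  have hle : sm.real {x | 0 ≤ ⟪x, n₁⟫ ∧ 0 ≤ ⟪x, n₂⟫ ∧ 0 ≤ ⟪x, m⟫} ≤
      sm.real (cap o r ∩ {x | 0 ≤ ⟪x, n₁⟫ ∧ 0 ≤ ⟪x, n₂⟫}) := by
    apply sm_real_mono_sphere
    rintro x ⟨a1, a2, a3⟩ hx
    refine ⟨⟨mem_unit.2 hx, ?_⟩, a1, a2⟩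
    have hxn := b_norm b x
    rw [hx] at hxn
    rw [← hb]
    simp only [hn1, hn2, hm, inner_add_right, inner_sub_right, real_inner_smul_right] at a1 a2 a3
    have a3' : 0 ≤ sin r * cos ψ * ⟪x, b 0⟫ - cos r * ⟪x, b 1⟫ := by
      by_contra hcon
      push Not at hcon
      have := mul_neg_of_pos_of_neg (inv_pos.2 hNpos) hcon
      linarith
    exact cap_alg hc hs hcp hsp hrs hps hxn a1 a2 a3'
  refine le_trans (le_of_eq ?_) hle
  rw [ht, arccos_eq_pi_div_two_sub_arcsin]
  ring

lemma cap_area {o : E 2} (ho : ‖o‖ = 1) {r : ℝ} (hr : 0 < r) (hr2 : r < π / 2) :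
    2 * π * M * (1 - cos r) ≤ sm.real (cap o r) := by
  set S := sm.real (cap o r)
  let G : ℝ → ℝ := fun ψ => S * (ψ / π) - 
    2 * M * (ψ - arcsin (cos r * sin ψ / √(sin r ^ 2 * cos ψ ^ 2 + cos r ^ 2)))
  have hd : HasDerivAt G (S / π - 2 * M * (1 - cos r)) 0 := by
    have d1 : HasDerivAt (fun ψ => sin r ^ 2 * cos ψ ^ 2 + cos r ^ 2) 0 0 := by
      have := (((hasDerivAt_cos 0).pow 2).const_mul (sin r ^ 2)).add_const (cos r ^ 2)
      simpa using this
    have e0 : sin r ^ 2 * cos 0 ^ 2 + cos r ^ 2 = 1 := by simp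
    have d2 := d1.sqrt (by rw [e0]; norm_num)
    have d3 := ((hasDerivAt_sin 0).const_mul (cos r)).div d2 (by rw [e0]; norm_num)
    have d4 : HasDerivAt (fun ψ => cos r * sin ψ / √(sin r ^ 2 * cos ψ ^ 2 + cos r ^ 2)) (cos r) 0 := by
      convert! d3 using 1
      simp
    have d5 := (hasDerivAt_arcsin (x := (fun ψ => cos r * sin ψ / √(sin r ^ 2 * cos ψ ^ 2 + cos r ^ 2)) 0) (by simp) (by simp)).comp 0 d4
    have d6 := (((hasDerivAt_id (0:ℝ)).div_const π).const_mul S).sub (((hasDerivAt_id (0:ℝ)).sub d5).const_mul (2 * M))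
    convert! d6 using 1
    simp
    ring
  have h0 : G 0 = 0 := by simp [G]
  have ht := hd.tendsto_slope_zero_right
  have hge : 0 ≤ S / π - 2 * M * (1 - cos r) := by
    refine ge_of_tendsto ht ?_
    have : Set.Ioo (0:ℝ) (π/2) ∈ nhdsWithin (0:ℝ) (Set.Ioi 0) := Ioo_mem_nhdsGT (by positivity)
    filter_upwards [this] with t htm
    rw [zero_add, h0, sub_zero]
    have := cap_ineq ho hr hr2 htm.1 htm.2
    exact smul_nonneg (inv_nonneg.2 htm.1.le) (by simp only [G]; linarith)
  have hp := pi_pos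
  have : 2 * M * (1 - cos r) ≤ S / π := by linarith
  rw [le_div_iff₀ hp] at this
  linarith

end Pal

namespace Pal
set_option linter.unusedSimpArgs false

/-- positive hull closedness (on the unit sphere) -/
def PosClosed (K : Set (E 2)) : Prop := ∀ x ∈ K, ∀ y ∈ K, ∀ z ∈ K, ∀ a b c : ℝ, 0 ≤ a → 0 ≤ b →
  0 ≤ c → ‖a • x + b • y + c • z‖ = 1 → a • x + b • y + c • z ∈ K

/-- orthonormal triple with completeness -/
structure Frame (o f g : E 2) : Prop where
  oo : ⟪o, o⟫ = 1
  ff : ⟪f, f⟫ = 1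
  gg : ⟪g, g⟫ = 1
  of : ⟪o, f⟫ = 0
  og : ⟪o, g⟫ = 0
  fg : ⟪f, g⟫ = 0
  rep : ∀ x : E 2, x = ⟪x, o⟫ • o + ⟪x, f⟫ • f + ⟪x, g⟫ • g

lemma exists_Frame {o f : E 2} (ho : ‖o‖ = 1) (hf : ‖f‖ = 1) (h : ⟪o, f⟫ = 0) :
    ∃ g, Frame o f g := by
  obtain ⟨b, h0, h1⟩ := frame2 ho hf h
  refine ⟨b 2, ⟨sq_of_norm_one ho, sq_of_norm_one hf, b_one b 2, h, ?_, ?_, ?_⟩⟩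
  · rw [← h0]; exact b_zero b (by decide)
  · rw [← h1]; exact b_zero b (by decide)
  · intro x; rw [← h0, ← h1]; exact b_repr b x

lemma Frame.neg {o f g : E 2} (F : Frame o f g) : Frame o f (-g) := by
  refine ⟨F.oo, F.ff, by rw [inner_neg_neg]; exact F.gg, F.of, by simp [F.og], by simp [F.fg], fun x => ?_⟩
  have := F.rep x
  simpa using this

lemma Frame.nsq {o f g : E 2} (F : Frame o f g) (x : E 2) :
    ⟪x, x⟫ = ⟪x, o⟫ ^ 2 + ⟪x, f⟫ ^ 2 + ⟪x, g⟫ ^ 2 := by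
  nth_rewrite 2 [F.rep x]
  simp only [inner_add_right, real_inner_smul_right]; ring

lemma tri_in {K : Set (E 2)} (hK : PosClosed K) {o f g : E 2} (F : Frame o f g)
    {r R φ : ℝ} (hs : 0 < sin r) (hR : 0 < sin R) (hφ : 0 < sin φ)
    (hrel : sin r * cos R = cos r * sin R * cos φ)
    (hcap : cap o r ⊆ K) (hcr : cos r ≤ 1) (hp : cos R • o + sin R • f ∈ K) {x : E 2} (hx : ‖x‖ = 1)
    (h1 : 0 ≤ ⟪x, sin φ • f - cos φ • g⟫) (h2 : 0 ≤ ⟪x, g⟫)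
    (h3 : 0 ≤ ⟪x, sin r • o - cos r • (cos φ • f + sin φ • g)⟫) : x ∈ K := by
  have hgf : ⟪g, f⟫ = 0 := by rw [real_inner_comm]; exact F.fg
  have hfo : ⟪f, o⟫ = 0 := by rw [real_inner_comm]; exact F.of
  have hgo : ⟪g, o⟫ = 0 := by rw [real_inner_comm]; exact F.og
  have hoK : o ∈ K := hcap ⟨mem_unit.2 (norm_one_of_sq F.oo), by rw [F.oo]; exact hcr⟩
  set t := cos r • o + sin r • (cos φ • f + sin φ • g) with ht
  have htK : t ∈ K := by
    apply hcap
    refine ⟨mem_unit.2 (norm_one_of_sq ?_), ?_⟩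
    · rw [ht]
      simp only [inner_add_left, inner_add_right, real_inner_smul_left, real_inner_smul_right,
        F.oo, F.ff, F.gg, F.of, F.og, F.fg, hgf, hfo, hgo]
      linear_combination sin_sq_add_cos_sq r + sin r ^ 2 * sin_sq_add_cos_sq φ
    · rw [ht]
      simp only [inner_add_left, real_inner_smul_left, F.oo, hfo, hgo]
      linarith
  simp only [inner_add_right, inner_sub_right, real_inner_smul_right] at h1 h3
  have hrep := F.rep x
  set a := ⟪x, o⟫
  set p := ⟪x, f⟫
  set q := ⟪x, g⟫
  set A := (sin r * a - cos r * (cos φ * p + sin φ * q)) / sin r with hA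
  set B := q / (sin r * sin φ) with hB
  set C := (sin φ * p - cos φ * q) / (sin R * sin φ) with hC
  have key : x = A • o + B • t + C • (cos R • o + sin R • f) := by
    have e0 : A + B * cos r + C * cos R = a := by
      rw [hA, hB, hC]
      have h' : cos R = cos r * sin R * cos φ / sin r := by field_simp; linarith
      rw [h']
      field_simp
      linear_combination (- cos r * q) * sin_sq_add_cos_sq φ
    have e1 : B * sin r * cos φ + C * sin R = p := by
      rw [hB, hC]; field_simp; ring
    have e2 : B * sin r * sin φ = q := by rw [hB]; field_simp
    rw [hrep, ← e0, ← e1, ← e2, ht]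
    module
  rw [key]
  apply hK o hoK t htK _ hp
  · exact div_nonneg h3 hs.le
  · exact div_nonneg h2 (by positivity)
  · exact div_nonneg h1 (by positivity)
  · rw [← key]; exact hx

lemma tri_right_area {o f g : E 2} (F : Frame o f g) {r φ : ℝ} (hφ : 0 ≤ φ) (hφ' : φ ≤ π) :
    sm.real {x | 0 ≤ ⟪x, sin φ • f - cos φ • g⟫ ∧ 0 ≤ ⟪x, g⟫ ∧
      0 ≤ ⟪x, sin r • o - cos r • (cos φ • f + sin φ • g)⟫} =
      M * (φ + arccos (cos r * sin φ) - π / 2) := by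
  have hgf : ⟪g, f⟫ = 0 := by rw [real_inner_comm]; exact F.fg
  have hfo : ⟪f, o⟫ = 0 := by rw [real_inner_comm]; exact F.of
  have hgo : ⟪g, o⟫ = 0 := by rw [real_inner_comm]; exact F.og
  have h1 := (wedge_normal_norm F.ff F.gg F.fg φ).1
  have h3 : ‖sin r • o - cos r • (cos φ • f + sin φ • g)‖ = 1 := by
    apply norm_one_of_sq
    simp only [inner_add_left, inner_add_right, inner_sub_left, inner_sub_right,
      real_inner_smul_left, real_inner_smul_right,
      F.oo, F.ff, F.gg, F.of, F.og, F.fg, hgf, hfo, hgo]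
    linear_combination sin_sq_add_cos_sq r + cos r ^ 2 * sin_sq_add_cos_sq φ
  rw [tri_area h1 (norm_one_of_sq F.gg) h3]
  have i1 : ⟪sin φ • f - cos φ • g, g⟫ = - cos φ := by
    rw [inner_sub_left, real_inner_smul_left, real_inner_smul_left, F.fg, F.gg]; ring
  have i2 : ⟪sin φ • f - cos φ • g, sin r • o - cos r • (cos φ • f + sin φ • g)⟫ = 0 := by
    simp only [inner_add_left, inner_add_right, inner_sub_left, inner_sub_right,
      real_inner_smul_left, real_inner_smul_right,
      F.oo, F.ff, F.gg, F.of, F.og, F.fg, hgf, hfo, hgo]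
    ring
  have i3 : ⟪g, sin r • o - cos r • (cos φ • f + sin φ • g)⟫ = - (cos r * sin φ) := by
    simp only [inner_add_left, inner_add_right, inner_sub_left, inner_sub_right,
      real_inner_smul_left, real_inner_smul_right,
      F.oo, F.ff, F.gg, F.of, F.og, F.fg, hgf, hfo, hgo]
    ring
  rw [i1, i2, i3, arccos_neg, arccos_neg, arccos_zero, arccos_cos hφ hφ']
  ring

/-- open angular sector -/
def sect (f g : E 2) (φ : ℝ) : Set (E 2) :=
  {x | 0 < ⟪x, sin φ • f - cos φ • g⟫ ∧ 0 < ⟪x, sin φ • f + cos φ • g⟫}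

lemma sect_meas (f g : E 2) (φ : ℝ) : MeasurableSet (sect f g φ) := by
  apply IsOpen.measurableSet
  exact (isOpen_lt (f := fun _ : E 2 => (0:ℝ)) (g := fun x : E 2 => ⟪x, sin φ • f - cos φ • g⟫)
    continuous_const (by fun_prop)).inter (isOpen_lt (f := fun _ : E 2 => (0:ℝ))
    (g := fun x : E 2 => ⟪x, sin φ • f + cos φ • g⟫) continuous_const (by fun_prop))

lemma sect_closed_eq {o f g : E 2} (F : Frame o f g) (φ : ℝ) (X : Set (E 2)) :
    sm.real (X ∩ sect f g φ) =
    sm.real (X ∩ {x | 0 ≤ ⟪x, sin φ • f - cos φ • g⟫ ∧ 0 ≤ ⟪x, sin φ • f + cos φ • g⟫}) := by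
  obtain ⟨h1, h2⟩ := wedge_normal_norm F.ff F.gg F.fg φ
  have n1 : ∀ᵐ x ∂sm, ⟪x, sin φ • f - cos φ • g⟫ ≠ 0 := by
    rw [ae_iff]; simpa only [not_not, ne_eq] using circle_null h1
  have n2 : ∀ᵐ x ∂sm, ⟪x, sin φ • f + cos φ • g⟫ ≠ 0 := by
    rw [ae_iff]; simpa only [not_not, ne_eq] using circle_null h2
  rw [measureReal_def, measureReal_def]
  congr 1
  apply measure_congr
  filter_upwards [n1, n2] with x k1 k2
  apply propext
  refine and_congr Iff.rfl ?_
  show (0 < _ ∧ 0 < _) ↔ (0 ≤ _ ∧ 0 ≤ _)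
  constructor
  · rintro ⟨a, b⟩; exact ⟨a.le, b.le⟩
  · rintro ⟨a, b⟩; exact ⟨lt_of_le_of_ne a k1.symm, lt_of_le_of_ne b k2.symm⟩

lemma sect_area {K : Set (E 2)} (hK : PosClosed K) {o f g : E 2} (F : Frame o f g)
    {r R φ : ℝ} (hs : 0 < sin r) (hR : 0 < sin R) (hφ0 : 0 < φ) (hφ1 : φ ≤ π / 2)
    (hrel : sin r * cos R = cos r * sin R * cos φ)
    (hcap : cap o r ⊆ K) (hcr : cos r ≤ 1) (hp : cos R • o + sin R • f ∈ K) :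
    2 * M * (φ + arccos (cos r * sin φ) - π / 2) ≤ sm.real (K ∩ sect f g φ) := by
  have hpi := pi_pos
  have hsφ : 0 < sin φ := sin_pos_of_pos_of_lt_pi hφ0 (by linarith)
  have hcφ : 0 ≤ cos φ := cos_nonneg_of_neg_pi_div_two_le_of_le (by linarith) hφ1
  rw [sect_closed_eq F]
  have a1 := tri_right_area F (r := r) hφ0.le (by linarith)
  have a2 := tri_right_area F.neg (r := r) hφ0.le (by linarith)
  set D₁ := {x | 0 ≤ ⟪x, sin φ • f - cos φ • g⟫ ∧ 0 ≤ ⟪x, g⟫ ∧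
      0 ≤ ⟪x, sin r • o - cos r • (cos φ • f + sin φ • g)⟫} with hD1
  set D₂ := {x | 0 ≤ ⟪x, sin φ • f - cos φ • -g⟫ ∧ 0 ≤ ⟪x, -g⟫ ∧
      0 ≤ ⟪x, sin r • o - cos r • (cos φ • f + sin φ • -g)⟫} with hD2
  have hm2 : MeasurableSet {x : E 2 | 0 ≤ ⟪x, g⟫} := (hs_closed g).measurableSet
  set W := {x | 0 ≤ ⟪x, sin φ • f - cos φ • g⟫ ∧ 0 ≤ ⟪x, sin φ • f + cos φ • g⟫} with hW
  have e := measureReal_inter_add_sdiff (μ := sm) (s := K ∩ W) hm2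
  have b1 : sm.real D₁ ≤ sm.real (K ∩ W ∩ {x : E 2 | 0 ≤ ⟪x, g⟫}) := by
    apply sm_real_mono_sphere
    rintro x ⟨h1, h2, h3⟩ hx
    refine ⟨⟨tri_in hK F hs hR hsφ hrel hcap hcr hp hx h1 h2 h3, h1, ?_⟩, h2⟩
    simp only [inner_sub_right, inner_add_right, real_inner_smul_right] at h1 ⊢
    have := mul_nonneg hcφ h2
    linarith
  have b2 : sm.real D₂ ≤ sm.real ((K ∩ W) \ {x : E 2 | 0 ≤ ⟪x, g⟫}) := by
    have n1 : ∀ᵐ x ∂sm, ⟪x, g⟫ ≠ 0 := by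
      rw [ae_iff]; simpa only [not_not, ne_eq] using circle_null (norm_one_of_sq F.gg)
    have : sm.real D₂ = sm.real (D₂ ∩ {x | ⟪x, g⟫ ≠ 0}) := by
      rw [measureReal_def, measureReal_def]
      congr 1
      apply measure_congr
      filter_upwards [n1] with x hx
      apply propext
      exact ⟨fun h => ⟨h, hx⟩, fun h => h.1⟩
    rw [this]
    apply sm_real_mono_sphere
    rintro x ⟨⟨h1, h2, h3⟩, h4⟩ hx
    refine ⟨⟨tri_in hK F.neg hs hR hsφ hrel hcap hcr hp hx h1 h2 h3, ?_, ?_⟩, ?_⟩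
    · simp only [inner_sub_right, inner_neg_right, real_inner_smul_right] at h1 h2 ⊢
      have := mul_nonneg hcφ h2
      linarith
    · simpa [sub_eq_add_neg] using h1
    · intro h5
      rw [inner_neg_right] at h2
      exact h4 (le_antisymm (by linarith) h5)
  rw [← e]
  linarith

lemma sect_disjoint {o f g f' g' : E 2} (F : Frame o f g) (F' : Frame o f' g') {φ : ℝ}
    (hφ0 : 0 < φ) (hφ1 : φ ≤ π / 3) (h : ⟪f, f'⟫ ≤ cos (2 * φ)) :
    Disjoint (sect f g φ) (sect f' g' φ) := by
  have hpi := pi_pos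
  rw [Set.disjoint_left]
  intro x hx hx'
  set y := x - ⟪x, o⟫ • o with hy
  have hsφ : 0 < sin φ := sin_pos_of_pos_of_lt_pi hφ0 (by linarith)
  have hcφ : 0 < cos φ := cos_pos_of_mem_Ioo ⟨by linarith, by linarith⟩
  have key : ∀ {f g : E 2}, Frame o f g → x ∈ sect f g φ → InnerProductGeometry.angle y f < φ := by
    intro f g F hx
    obtain ⟨h1, h2⟩ := hx
    simp only [inner_sub_right, inner_add_right, real_inner_smul_right] at h1 h2
    have hyf : ⟪y, f⟫ = ⟪x, f⟫ := by rw [hy, inner_sub_left, real_inner_smul_left, F.of]; ring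
    have hyg : ⟪y, g⟫ = ⟪x, g⟫ := by rw [hy, inner_sub_left, real_inner_smul_left, F.og]; ring
    have hyo : ⟪y, o⟫ = 0 := by rw [hy, inner_sub_left, real_inner_smul_left, F.oo]; ring
    have hn := F.nsq y
    rw [hyo, hyf, hyg, real_inner_self_eq_norm_sq] at hn
    set p := ⟪x, f⟫
    set q := ⟪x, g⟫
    have hp : 0 < p := by
      have : 0 < sin φ * p := by linarith
      exact pos_of_mul_pos_right this hsφ.le
    have hyp : 0 < ‖y‖ := by
      have := norm_nonneg y
      rcases this.lt_or_eq with h | h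
      · exact h
      · rw [← h] at hn
        have := sq_nonneg q
        have := pow_pos hp 2
        linarith
    have hlt : cos φ * ‖y‖ < p := by
      apply abs_lt_of_sq_lt_sq' _ hp.le |>.2
      rw [mul_pow, hn]
      have h3 := mul_pos h1 h2
      have : p ^ 2 = (sin φ ^ 2 + cos φ ^ 2) * p ^ 2 := by rw [sin_sq_add_cos_sq]; ring
      linarith
    unfold InnerProductGeometry.angle
    rw [hyf, norm_one_of_sq F.ff, mul_one]
    calc arccos (p / ‖y‖) < arccos (cos φ) := by
          apply arccos_lt_arccos (by linarith [neg_one_le_cos φ]) (by rwa [lt_div_iff₀ hyp])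
          have h5 := abs_real_inner_le_norm y f
          rw [hyf, norm_one_of_sq F.ff, mul_one] at h5
          rw [div_le_one hyp]; exact (le_abs_self _).trans h5
      _ = φ := arccos_cos hφ0.le (by linarith)
  have k1 := key F hx
  have k2 := key F' hx'
  have k3 := InnerProductGeometry.angle_le_angle_add_angle f y f'
  rw [InnerProductGeometry.angle_comm f y] at k3
  have k4 : InnerProductGeometry.angle f f' = arccos ⟪f, f'⟫ := by
    unfold InnerProductGeometry.angle
    rw [norm_one_of_sq F.ff, norm_one_of_sq F'.ff]; simp
  have k5 : 2 * φ ≤ arccos ⟪f, f'⟫ := by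
    rw [← arccos_cos (x := 2 * φ) (by linarith) (by linarith)]
    exact arccos_le_arccos h
  linarith

lemma split3 (X : Set (E 2)) {A B C : Set (E 2)} (hA : MeasurableSet A) (hB : MeasurableSet B)
    (hC : MeasurableSet C) (hAB : Disjoint A B) (hAC : Disjoint A C) (hBC : Disjoint B C) :
    sm.real X = sm.real (X ∩ A) + sm.real (X ∩ B) + sm.real (X ∩ C) +
      sm.real (((X \ A) \ B) \ C) := by
  rw [Set.disjoint_left] at hAB hAC hBC
  have e1 := measureReal_inter_add_sdiff (μ := sm) (s := X) hA
  have e2 := measureReal_inter_add_sdiff (μ := sm) (s := X \ A) hB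
  have e3 := measureReal_inter_add_sdiff (μ := sm) (s := (X \ A) \ B) hC
  have r2 : (X \ A) ∩ B = X ∩ B := by
    ext x; exact ⟨fun h => ⟨h.1.1, h.2⟩, fun h => ⟨⟨h.1, fun h' => hAB h' h.2⟩, h.2⟩⟩
  have r3 : ((X \ A) \ B) ∩ C = X ∩ C := by
    ext x; exact ⟨fun h => ⟨h.1.1.1, h.2⟩,
      fun h => ⟨⟨⟨h.1, fun h' => hAC h' h.2⟩, fun h' => hBC h' h.2⟩, h.2⟩⟩
  rw [r2] at e2
  rw [r3] at e3
  linarith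

/-- the fundamental lower area bound -/
lemma area_lower {K : Set (E 2)} (hK : PosClosed K) {o f₁ f₂ f₃ : E 2}
    (ho : ‖o‖ = 1) (h1 : ‖f₁‖ = 1) (h2 : ‖f₂‖ = 1) (h3 : ‖f₃‖ = 1)
    (ho1 : ⟪o, f₁⟫ = 0) (ho2 : ⟪o, f₂⟫ = 0) (ho3 : ⟪o, f₃⟫ = 0)
    {r R φ : ℝ} (hr : 0 < r) (hr2 : r < π / 2) (hR : 0 < sin R) (hφ0 : 0 ≤ φ) (hφ1 : φ ≤ π / 3)
    (hrel : sin r * cos R = cos r * sin R * cos φ)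
    (hcap : cap o r ⊆ K)
    (hp1 : cos R • o + sin R • f₁ ∈ K) (hp2 : cos R • o + sin R • f₂ ∈ K)
    (hp3 : cos R • o + sin R • f₃ ∈ K)
    (h12 : ⟪f₁, f₂⟫ ≤ cos (2 * φ)) (h13 : ⟪f₁, f₃⟫ ≤ cos (2 * φ)) (h23 : ⟪f₂, f₃⟫ ≤ cos (2 * φ)) :
    M * (6 * arccos (cos r * sin φ) - π - (2 * π - 6 * φ) * cos r) ≤ sm.real K := by
  have hpi := pi_pos
  have hM := M_pos
  have hS := cap_area ho hr hr2
  have hcapK : sm.real (cap o r) ≤ sm.real K := measureReal_mono hcap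
  rcases hφ0.eq_or_lt with rfl | hφ
  · simp only [sin_zero, mul_zero, arccos_zero]
    linarith
  obtain ⟨g₁, F1⟩ := exists_Frame ho h1 ho1
  obtain ⟨g₂, F2⟩ := exists_Frame ho h2 ho2
  obtain ⟨g₃, F3⟩ := exists_Frame ho h3 ho3
  have hs := sin_pos_of_pos_of_lt_pi hr (by linarith)
  have hcr := cos_le_one r
  have d12 := sect_disjoint F1 F2 hφ hφ1 h12
  have d13 := sect_disjoint F1 F3 hφ hφ1 h13
  have d23 := sect_disjoint F2 F3 hφ hφ1 h23
  have m1 := sect_meas f₁ g₁ φ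
  have m2 := sect_meas f₂ g₂ φ
  have m3 := sect_meas f₃ g₃ φ
  have eK := split3 K m1 m2 m3 d12 d13 d23
  have eC := split3 (cap o r) m1 m2 m3 d12 d13 d23
  have hc : ∀ {f g : E 2}, Frame o f g → sm.real (cap o r ∩ sect f g φ) =
      sm.real (cap o r) * (φ / π) := by
    intro f g F
    rw [sect_closed_eq F]
    exact cap_wedge ho F.ff F.gg F.of F.og F.fg r hφ.le (by linarith)
  rw [hc F1, hc F2, hc F3] at eC
  have s1 := sect_area hK F1 hs hR hφ (by linarith) hrel hcap hcr hp1
  have s2 := sect_area hK F2 hs hR hφ (by linarith) hrel hcap hcr hp2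
  have s3 := sect_area hK F3 hs hR hφ (by linarith) hrel hcap hcr hp3
  have hrest : sm.real (((cap o r \ sect f₁ g₁ φ) \ sect f₂ g₂ φ) \ sect f₃ g₃ φ) ≤
      sm.real (((K \ sect f₁ g₁ φ) \ sect f₂ g₂ φ) \ sect f₃ g₃ φ) :=
    measureReal_mono (fun x hx => ⟨⟨⟨hcap hx.1.1.1, hx.1.1.2⟩, hx.1.2⟩, hx.2⟩)
  have hk : 0 ≤ 1 - 3 * (φ / π) := by
    have : φ / π ≤ 1 / 3 := by rw [div_le_iff₀ hpi]; linarith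
    linarith
  have h5 := mul_le_mul_of_nonneg_right hS hk
  have h6 : 2 * π * M * (1 - cos r) * (1 - 3 * (φ / π)) = M * (1 - cos r) * (2 * π - 6 * φ) := by
    field_simp; ring
  linarith

end Pal

namespace Pal

lemma gdist_eq_angle {x y : E 2} (hx : ‖x‖ = 1) (hy : ‖y‖ = 1) :
    gdist x y = InnerProductGeometry.angle x y := by
  unfold gdist InnerProductGeometry.angle
  rw [hx, hy]; simp

lemma pos2 {K : Set (E 2)} (hK : SConvex K) {x y : E 2} (hx : x ∈ K) (hy : y ∈ K) {a b : ℝ}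
    (ha : 0 ≤ a) (hb : 0 ≤ b) (h : ‖a • x + b • y‖ = 1) : a • x + b • y ∈ K := by
  have hx1 := mem_unit.1 (hK.1 hx)
  have hy1 := mem_unit.1 (hK.1 hy)
  apply hK.2.2 x hx y hy
  refine ⟨mem_unit.2 h, ?_⟩
  rw [gdist_eq_angle hx1 h, gdist_eq_angle h hy1, gdist_eq_angle hx1 hy1]
  symm
  rw [InnerProductGeometry.angle_eq_angle_add_angle_iff (by
    intro h0; rw [h0] at h; simp at h)]
  right
  rw [Submodule.mem_span_pair]
  exact ⟨⟨a, ha⟩, ⟨b, hb⟩, rfl⟩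

lemma pos2n {K : Set (E 2)} (hK : SConvex K) {x y : E 2} (hx : x ∈ K) (hy : y ∈ K) {a b : ℝ}
    (ha : 0 ≤ a) (hb : 0 ≤ b) (h : a • x + b • y ≠ 0) :
    ‖a • x + b • y‖⁻¹ • (a • x + b • y) ∈ K := by
  have hn := norm_pos_iff.2 h
  have : ‖a • x + b • y‖⁻¹ • (a • x + b • y) =
    (‖a • x + b • y‖⁻¹ * a) • x + (‖a • x + b • y‖⁻¹ * b) • y := by module
  have h2 := norm_smul_inv_norm (𝕜 := ℝ) h
  simp only [RCLike.ofReal_real_eq_id, id] at h2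
  rw [this] at h2 ⊢
  exact pos2 hK hx hy (by positivity) (by positivity) h2

lemma posClosed {K : Set (E 2)} (hK : SConvex K) : PosClosed K := by
  intro x hx y hy z hz a b c ha hb hc h
  obtain ⟨u, hu, hu2⟩ := hK.2.1
  by_cases h0 : b • y + c • z = 0
  · have h1 : a • x + b • y + c • z = a • x + (0:ℝ) • y := by
      rw [add_assoc, h0]; simp
    rw [h1] at h ⊢
    exact pos2 hK hx hy ha le_rfl h
  · have h1 := pos2n hK hy hz hb hc h0
    set v := b • y + c • z
    have h2 : a • x + b • y + c • z = a • x + ‖v‖ • (‖v‖⁻¹ • v) := by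
      rw [smul_smul, mul_inv_cancel₀ (norm_ne_zero_iff.2 h0), one_smul, add_assoc]
    rw [h2] at h ⊢
    exact pos2 hK hx h1 ha (norm_nonneg _) h

lemma breadth_eq {u v : E 2} (hu : ‖u‖ = 1) (hv : ‖v‖ = 1) (h1 : u ≠ v) (h2 : u ≠ -v) :
    breadth u v = arccos (-⟪u, v⟫) := by
  have uu := sq_of_norm_one hu
  have vv := sq_of_norm_one hv
  have vu : ⟪v, u⟫ = ⟪u, v⟫ := real_inner_comm _ _
  set k := ⟪u, v⟫ with hk
  have hk1 : k ≠ 1 := fun h => h1 ((inner_eq_one_iff_of_norm_eq_one hu hv).1 h)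
  have hk2 : k ≠ -1 := fun h => h2 (by
    have : ⟪u, -v⟫ = 1 := by rw [inner_neg_right, ← hk, h]; norm_num
    exact (inner_eq_one_iff_of_norm_eq_one hu (by rw [norm_neg, hv])).1 this)
  have hk3 : |k| ≤ 1 := by
    have := abs_real_inner_le_norm u v; rwa [hu, hv, one_mul] at this
  have hk4 : 0 < 1 - k ^ 2 := by
    have := abs_le.1 hk3
    have h5 : k < 1 := lt_of_le_of_ne this.2 hk1
    have h6 : -1 < k := lt_of_le_of_ne this.1 (Ne.symm hk2)
    nlinarith
  have n1 : ‖k • u - v‖ ^ 2 = 1 - k ^ 2 := by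
    rw [← real_inner_self_eq_norm_sq]
    simp only [inner_sub_left, inner_sub_right, real_inner_smul_left, real_inner_smul_right, uu,
      vv, vu, ← hk]; ring
  have n2 : ‖k • v - u‖ ^ 2 = 1 - k ^ 2 := by
    rw [← real_inner_self_eq_norm_sq]
    simp only [inner_sub_left, inner_sub_right, real_inner_smul_left, real_inner_smul_right, uu,
      vv, vu, ← hk]; ring
  have n3 : ‖k • v - u‖ = ‖k • u - v‖ := by
    have := norm_nonneg (k • u - v)
    have := norm_nonneg (k • v - u)
    exact (sq_eq_sq₀ (by assumption) (by assumption)).1 (by rw [n1, n2])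
  unfold breadth gdist luneFaceCenter
  rw [vu, ← hk, n3, real_inner_smul_left, real_inner_smul_right, ← mul_assoc, ← mul_inv,
    ← pow_two, n1]
  congr 1
  simp only [inner_sub_left, inner_sub_right, real_inner_smul_left, real_inner_smul_right, uu,
      vv, vu, ← hk]
  field_simp; ring

lemma width_le {K : Set (E 2)} {u v : E 2} (h : IsSupportingLune K u v) :
    width K ≤ arccos (-⟪u, v⟫) := by
  rw [← breadth_eq (mem_unit.1 h.1) (mem_unit.1 h.2.1) h.2.2.1 h.2.2.2.1]
  apply csInf_le
  · refine ⟨0, ?_⟩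
    rintro b ⟨u, v, -, rfl⟩
    exact arccos_nonneg _
  · exact ⟨u, v, h, rfl⟩

lemma le_width {K : Set (E 2)} {t : ℝ} (h0 : 0 < width K)
    (h : ∀ u v, IsSupportingLune K u v → t ≤ arccos (-⟪u, v⟫)) : t ≤ width K := by
  apply le_csInf
  · by_contra hne
    rw [Set.not_nonempty_iff_eq_empty] at hne
    unfold width at h0
    rw [hne, Real.sInf_empty] at h0
    exact lt_irrefl _ h0
  · rintro b ⟨u, v, huv, rfl⟩
    rw [breadth_eq (mem_unit.1 huv.1) (mem_unit.1 huv.2.1) huv.2.2.1 huv.2.2.2.1]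
    exact h u v huv

lemma polar_closed (K : Set (E 2)) : IsClosed (polar K) := by
  have : polar K = unitSphere 2 ∩ ⋂ a ∈ K, {u | ⟪a, u⟫ ≤ 0} := by
    ext u; simp [polar]
  rw [this]
  refine isClosed_unit.inter (isClosed_biInter fun a _ => ?_)
  exact isClosed_le (f := fun u : E 2 => ⟪a, u⟫) (by fun_prop) continuous_const

lemma polar_compact (K : Set (E 2)) : IsCompact (polar K) :=
  (isCompact_sphere (0 : E 2) 1).of_isClosed_subset (polar_closed K) (fun _ hx => hx.1)

lemma mem_polar {K : Set (E 2)} {u : E 2} :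
    u ∈ polar K ↔ ‖u‖ = 1 ∧ ∀ a ∈ K, ⟪a, u⟫ ≤ 0 := by
  unfold polar; rw [← mem_unit]; rfl

lemma mem_polar_of {K : Set (E 2)} {n : E 2} (hn : n ≠ 0) (h : ∀ a ∈ K, ⟪a, n⟫ ≤ 0) :
    ‖n‖⁻¹ • n ∈ polar K := by
  rw [mem_polar]
  refine ⟨by simpa using norm_smul_inv_norm (𝕜 := ℝ) hn, fun a ha => ?_⟩
  rw [real_inner_smul_right]
  exact mul_nonpos_of_nonneg_of_nonpos (by positivity) (h a ha)

/-- an interior point is strictly inside all polar halfspaces -/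
lemma interior_neg {K : Set (E 2)} {x u : E 2} (hK : K ⊆ unitSphere 2) (hx : x ∈ sInterior K)
    (hu : u ∈ polar K) : ⟪x, u⟫ < 0 := by
  obtain ⟨hxK, ε, hε, hb⟩ := hx
  obtain ⟨hu1, hu2⟩ := mem_polar.1 hu
  refine lt_of_le_of_ne (hu2 x hxK) fun h0 => ?_
  have hx1 := mem_unit.1 (hK hxK)
  set t := min (ε / 2) (π / 2) with ht
  have hp := pi_pos
  have ht0 : 0 < t := lt_min (by positivity) (by positivity)
  have ht1 : t ≤ π / 2 := min_le_right _ _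
  have ht2 : t < ε := lt_of_le_of_lt (min_le_left _ _) (by linarith)
  have hux : ⟪u, x⟫ = 0 := by rw [real_inner_comm]; exact h0
  have hy : cos t • x + sin t • u ∈ K := by
    apply hb
    · rw [mem_unit]
      apply norm_one_of_sq
      simp only [inner_add_left, inner_add_right, real_inner_smul_left, real_inner_smul_right,
        sq_of_norm_one hx1, sq_of_norm_one hu1, h0, hux]
      nlinarith [sin_sq_add_cos_sq t]
    · unfold gdist
      rw [inner_add_right, real_inner_smul_right, real_inner_smul_right, h0, sq_of_norm_one hx1,
        mul_one, mul_zero, add_zero, arccos_cos ht0.le (by linarith)]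
      exact ht2
  have := hu2 _ hy
  rw [inner_add_left, real_inner_smul_left, real_inner_smul_left, h0, sq_of_norm_one hu1] at this
  have := sin_pos_of_pos_of_lt_pi ht0 (by linarith)
  linarith

lemma polar_inner {K : Set (E 2)} (hK : IsConvexBody K) (hw2 : width K ≤ π / 2)
    (hw0 : 0 < width K) {u v : E 2}
    (hu : u ∈ polar K) (hv : v ∈ polar K) : -cos (width K) ≤ ⟪u, v⟫ := by
  by_contra hcon
  push Not at hcon
  have hcw : 0 ≤ cos (width K) := cos_nonneg_of_neg_pi_div_two_le_of_le (by linarith) hw2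
  obtain ⟨⟨u, v⟩, ⟨hu', hv'⟩, hmin⟩ := ((polar_compact K).prod (polar_compact K)).exists_isMinOn
    ⟨(u, v), hu, hv⟩ (f := fun q : E 2 × E 2 => ⟪q.1, q.2⟫) (by fun_prop)
  have hmin' : ∀ a ∈ polar K, ∀ b ∈ polar K, ⟪u, v⟫ ≤ ⟪a, b⟫ := fun a ha b hb =>
    hmin (Set.mk_mem_prod ha hb)
  have hm := (hmin' _ hu _ hv).trans_lt hcon
  clear hu hv hcon hmin
  rename' hu' => hu, hv' => hv
  simp only at hu hv
  obtain ⟨hu1, hu2⟩ := mem_polar.1 hu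
  obtain ⟨hv1, hv2⟩ := mem_polar.1 hv
  have uu := sq_of_norm_one hu1
  have vv := sq_of_norm_one hv1
  set m := ⟪u, v⟫ with hmdef
  have hne1 : u ≠ v := by
    intro h; rw [hmdef, h, vv] at hm; linarith
  obtain ⟨x0, hx0⟩ := hK.2.2
  have hne2 : u ≠ -v := by
    intro h
    have a1 := interior_neg hK.1.1 hx0 hu
    have a2 := interior_neg hK.1.1 hx0 hv
    rw [h, inner_neg_right] at a1
    linarith
  have hm1 : -1 < m := by
    have h3 : |m| ≤ 1 := by
      have := abs_real_inner_le_norm u v; rwa [hu1, hv1, one_mul] at this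
    refine lt_of_le_of_ne (abs_le.1 h3).1 fun h => hne2 ?_
    have : ⟪u, -v⟫ = 1 := by rw [inner_neg_right, ← hmdef, ← h]; norm_num
    exact (inner_eq_one_iff_of_norm_eq_one hu1 (by rw [norm_neg, hv1])).1 this
  -- contact
  have contact : ∀ u v : E 2, u ∈ polar K → v ∈ polar K → ⟪u, v⟫ = m →
      (K ∩ luneFace u v).Nonempty := by
    intro u v hu hv hm'
    obtain ⟨hu1, hu2⟩ := mem_polar.1 hu
    obtain ⟨hv1, hv2⟩ := mem_polar.1 hv
    have uu := sq_of_norm_one hu1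
    have vv := sq_of_norm_one hv1
    obtain ⟨x, hxK, hxmax⟩ := hK.2.1.exists_isMaxOn ⟨x0, hx0.1⟩ (f := fun x : E 2 => ⟪x, u⟫)
      (by fun_prop)
    by_cases hx : ⟪x, u⟫ = 0
    · exact ⟨x, hxK, hK.1.1 hxK, hx, hv2 x hxK⟩
    exfalso
    set t := -⟪x, u⟫ with ht
    have ht0 : 0 < t := by
      have := lt_of_le_of_ne (hu2 x hxK) hx; linarith
    set u' := u - t • v with hu'
    have hn2 : ‖u'‖ ^ 2 = 1 - 2 * t * m + t ^ 2 := by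
      rw [← real_inner_self_eq_norm_sq, hu']
      simp only [inner_sub_left, inner_sub_right, real_inner_smul_left, real_inner_smul_right, uu,
        vv, hm', real_inner_comm u v]
      ring
    have hnp : 1 < ‖u'‖ ^ 2 := by
      rw [hn2]
      have := mul_pos ht0 (show 0 < -m by linarith)
      have := pow_pos ht0 2
      linarith
    have hu0 : u' ≠ 0 := by
      intro h; rw [h] at hnp; norm_num at hnp
    have hmem : ‖u'‖⁻¹ • u' ∈ polar K := by
      apply mem_polar_of hu0
      intro a ha
      have h1 : ⟪a, u⟫ ≤ ⟪x, u⟫ := hxmax ha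
      have h2 : |⟪a, v⟫| ≤ 1 := by
        have := abs_real_inner_le_norm a v
        rwa [mem_unit.1 (hK.1.1 ha), hv1, one_mul] at this
      rw [hu', inner_sub_right, real_inner_smul_right]
      have := (abs_le.1 h2).1
      nlinarith
    have h5 := hmin' _ hmem _ hv
    have hpos : 0 < ‖u'‖ := norm_pos_iff.2 hu0
    rw [real_inner_smul_left, hu', inner_sub_left, real_inner_smul_left, vv, hm', ← hu',
      mul_one, ← div_eq_inv_mul, le_div_iff₀ hpos] at h5
    have h6 : (t - m) ^ 2 ≤ (-m * ‖u'‖) ^ 2 := by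
      apply pow_le_pow_left₀ (by linarith) (by linarith)
    rw [mul_pow, hn2] at h6
    have h7 : 0 < (1 - m ^ 2) * (t * (t - 2 * m)) := by
      apply mul_pos (by nlinarith) (mul_pos ht0 (by linarith))
    linarith
  have hl : IsSupportingLune K u v := by
    refine ⟨hu.1, hv.1, hne1, hne2, fun x hx => ⟨hK.1.1 hx, hu2 x hx, hv2 x hx⟩,
      contact u v hu hv rfl, contact v u hv hu (real_inner_comm _ _)⟩
  have h1 := width_le hl
  have h2 : arccos (-m) < width K := by
    rw [← arccos_cos hw0.le (by linarith [pi_pos])]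
    apply arccos_lt_arccos (by linarith) (by linarith) (by linarith)
  linarith

end Pal

namespace Pal

lemma slice_aux {K : Set (E 2)} (hK : SConvex K) (hc : IsCompact K) {h : E 2}
    (hh : ∀ x ∈ K, 0 < ⟪h, x⟫) :
    Convex ℝ ((fun x : E 2 => (⟪h, x⟫)⁻¹ • x) '' K) ∧
      IsCompact ((fun x : E 2 => (⟪h, x⟫)⁻¹ • x) '' K) := by
  constructor
  · rintro _ ⟨x, hx, rfl⟩ _ ⟨y, hy, rfl⟩ a b ha hb hab
    simp only
    have px := hh x hx
    have py := hh y hy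
    have e : a • (⟪h, x⟫)⁻¹ • x + b • (⟪h, y⟫)⁻¹ • y =
      (a * (⟪h, x⟫)⁻¹) • x + (b * (⟪h, y⟫)⁻¹) • y := by module
    rw [e]
    set z := (a * (⟪h, x⟫)⁻¹) • x + (b * (⟪h, y⟫)⁻¹) • y with hz
    have hz1 : ⟪h, z⟫ = 1 := by
      rw [hz, inner_add_right, real_inner_smul_right, real_inner_smul_right]
      field_simp; exact hab
    have hz0 : z ≠ 0 := by
      intro h0; rw [h0, inner_zero_right] at hz1; norm_num at hz1
    refine ⟨‖z‖⁻¹ • z, pos2n hK hx hy (by positivity) (by positivity) hz0, ?_⟩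
    simp only
    rw [real_inner_smul_right, hz1, mul_one, inv_inv, smul_smul,
      mul_inv_cancel₀ (norm_ne_zero_iff.2 hz0), one_smul]
  · apply hc.image_of_continuousOn
    have h1 : ContinuousOn (fun x : E 2 => (⟪h, x⟫)⁻¹) K :=
      ContinuousOn.inv₀ (by fun_prop) fun x hx => (hh x hx).ne'
    exact h1.smul (f := fun x : E 2 => (⟪h, x⟫)⁻¹) (g := fun x : E 2 => x) (by fun_prop)

lemma separate {K : Set (E 2)} (hK : SConvex K) (hc : IsCompact K) {τ : ℝ} (hτ : 0 ≤ τ) {u : E 2}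
    (hd : ∀ x ∈ K, 0 < τ * ‖x‖ + ⟪x, u⟫) :
    ∃ n : E 2, (∀ x ∈ K, ⟪x, n⟫ < 0) ∧ ∀ b : E 2, τ * ‖b‖ + ⟪b, u⟫ ≤ 0 → 0 ≤ ⟪b, n⟫ := by
  obtain ⟨h, -, hh⟩ := hK.2.1
  obtain ⟨h1, h2⟩ := slice_aux hK hc hh
  have scal : ∀ (t : ℝ), 0 ≤ t → ∀ b : E 2, τ * ‖b‖ + ⟪b, u⟫ ≤ 0 →
      τ * ‖t • b‖ + ⟪t • b, u⟫ ≤ 0 := by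
    intro t ht b hb
    rw [norm_smul, real_inner_smul_left, norm_of_nonneg ht]
    nlinarith
  obtain ⟨f, a1, a2, h3, h4, h5⟩ := geometric_hahn_banach_compact_closed h1 h2
    (t := {b : E 2 | τ * ‖b‖ + ⟪b, u⟫ ≤ 0}) (by
      rintro x hx y hy a b ha hb hab
      simp only [Set.mem_ofPred_eq] at *
      have := norm_add_le (a • x) (b • y)
      rw [norm_smul, norm_smul, norm_of_nonneg ha, norm_of_nonneg hb] at this
      rw [inner_add_left, real_inner_smul_left, real_inner_smul_left]
      have := mul_le_mul_of_nonneg_left this hτ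
      nlinarith [mul_nonneg ha (neg_nonneg.2 hx), mul_nonneg hb (neg_nonneg.2 hy)])
    (isClosed_le (by fun_prop) continuous_const) (by
      rw [Set.disjoint_left]
      rintro _ ⟨x, hx, rfl⟩ hb
      simp only [Set.mem_ofPred_eq] at hb
      have px := hh x hx
      have := scal _ px.le _ hb
      rw [smul_smul, mul_inv_cancel₀ px.ne', one_smul] at this
      linarith [hd x hx])
  have z0 : a2 < 0 := by
    have := h5 0 (by simp)
    simpa using this
  set n := (InnerProductSpace.toDual ℝ (E 2)).symm f with hn
  have hf : ∀ x, f x = ⟪x, n⟫ := by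
    intro x; rw [real_inner_comm, hn, InnerProductSpace.toDual_symm_apply]
  refine ⟨n, fun x hx => ?_, fun b hb => ?_⟩
  · have := h3 _ ⟨x, hx, rfl⟩
    rw [hf, real_inner_smul_left] at this
    have px := hh x hx
    by_contra hcon
    push Not at hcon
    have := mul_nonneg (inv_pos.2 px).le hcon
    linarith
  · by_contra hcon
    push Not at hcon
    have := h5 _ (scal (a2 / ⟪b, n⟫) (by
      apply (div_pos_of_neg_of_neg z0 hcon).le) b hb)
    rw [hf, real_inner_smul_left, div_mul_cancel₀ _ hcon.ne] at this
    exact lt_irrefl _ this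

lemma bipolar {K : Set (E 2)} (hK : IsConvexBody K) {x : E 2} (hx : ‖x‖ = 1)
    (h : ∀ u ∈ polar K, ⟪x, u⟫ ≤ 0) : x ∈ K := by
  by_contra hxK
  obtain ⟨x0, hx0⟩ := hK.2.2
  have hb : ∀ y ∈ K, ⟪y, x⟫ ≤ 1 := by
    intro y hy
    have := real_inner_le_norm y x
    rwa [mem_unit.1 (hK.1.1 hy), hx, one_mul] at this
  obtain ⟨n, h1, h2⟩ := separate hK.1 hK.2.1 zero_le_one (u := -x) (by
    intro y hy
    have hy1 := mem_unit.1 (hK.1.1 hy)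
    rw [hy1, inner_neg_right]
    have := lt_of_le_of_ne (hb y hy) fun h => hxK (by
      rw [inner_eq_one_iff_of_norm_eq_one hy1 hx] at h; rwa [← h])
    linarith)
  have h3 := h2 x (by rw [inner_neg_right, sq_of_norm_one hx, hx]; norm_num)
  obtain ⟨p, hp, hmax⟩ := hK.2.1.exists_isMaxOn ⟨x0, hx0.1⟩ (f := fun y : E 2 => ⟪y, n⟫)
      (by fun_prop)
  set m := -⟪p, n⟫ with hm
  have hm0 : 0 < m := by have := h1 p hp; linarith
  have h4 : 0 < ⟪x, n + m • x⟫ := by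
    rw [inner_add_right, real_inner_smul_right, sq_of_norm_one hx]; linarith
  have h5 : n + m • x ≠ 0 := by
    intro h; rw [h, inner_zero_right] at h4; exact lt_irrefl _ h4
  have h6 := h _ (mem_polar_of (K := K) h5 (by
    intro a ha
    have h7 : ⟪a, n⟫ ≤ ⟪p, n⟫ := hmax ha
    rw [inner_add_right, real_inner_smul_right]
    nlinarith [hb a ha]))
  rw [real_inner_smul_right] at h6
  have := mul_pos (inv_pos.2 (norm_pos_iff.2 h5)) h4
  linarith

lemma far_point {K : Set (E 2)} (hK : IsConvexBody K) (hw2 : width K ≤ π / 2)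
    (hw0 : 0 < width K) {u : E 2} (hu : u ∈ polar K) :
    ∃ p ∈ K, ⟪p, u⟫ ≤ -sin (width K) := by
  by_contra! hcon
  obtain ⟨x0, hx0⟩ := hK.2.2
  obtain ⟨p, hp, hmin⟩ := hK.2.1.exists_isMinOn ⟨x0, hx0.1⟩ (f := fun y : E 2 => ⟪y, u⟫)
      (by fun_prop)
  have hu1 := (mem_polar.1 hu).1
  have uu := sq_of_norm_one hu1
  have hp1 := hcon p hp
  have hp2 := (mem_polar.1 hu).2 p hp
  have hsw : 0 < sin (width K) := sin_pos_of_pos_of_lt_pi hw0 (by linarith [pi_pos])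
  obtain ⟨τ, ht1, ht2⟩ := exists_between (show -⟪p, u⟫ < sin (width K) by linarith)
  have ht0 : 0 ≤ τ := by linarith
  have htl : τ < 1 := ht2.trans_le (sin_le_one _)
  obtain ⟨n, h1, h2⟩ := separate hK.1 hK.2.1 ht0 (u := u) (by
    intro y hy
    have h3 : ⟪p, u⟫ ≤ ⟪y, u⟫ := hmin hy
    rw [mem_unit.1 (hK.1.1 hy)]; linarith)
  have hn0 : n ≠ 0 := by
    intro h; have := h1 p hp; rw [h, inner_zero_right] at this; exact lt_irrefl _ this
  have hnp : 0 < ‖n‖ := norm_pos_iff.2 hn0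
  have hv := mem_polar_of (K := K) hn0 fun a ha => (h1 a ha).le
  set v := ‖n‖⁻¹ • n with hvdef
  have hv1 := (mem_polar.1 hv).1
  have vv := sq_of_norm_one hv1
  have h2' : ∀ b : E 2, τ * ‖b‖ + ⟪b, u⟫ ≤ 0 → 0 ≤ ⟪b, v⟫ := by
    intro b hb
    rw [hvdef, real_inner_smul_right]
    exact mul_nonneg (inv_pos.2 hnp).le (h2 b hb)
  have hk := polar_inner hK hw2 hw0 hu hv
  set k := ⟪u, v⟫ with hkdef
  have hvu : ⟪v, u⟫ = k := real_inner_comm _ _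
  have hk0 : k ≤ 0 := by
    have := h2' (-u) (by rw [norm_neg, hu1, inner_neg_left, uu]; linarith)
    rw [inner_neg_left] at this; linarith
  have hsc := sin_sq_add_cos_sq (width K)
  have hcw : 0 ≤ cos (width K) := cos_nonneg_of_neg_pi_div_two_le_of_le (by linarith) hw2
  have hk2 : k ^ 2 ≤ cos (width K) ^ 2 := by nlinarith
  have hk3 : k ^ 2 < 1 := by nlinarith
  have hl : 0 < sqrt (1 - k ^ 2) := sqrt_pos.2 (by linarith)
  have hl2 : sqrt (1 - k ^ 2) ^ 2 = 1 - k ^ 2 := sq_sqrt (by linarith)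
  have hr2 : sqrt (1 - τ ^ 2) ^ 2 = 1 - τ ^ 2 := sq_sqrt (by nlinarith)
  have hr0 : 0 ≤ sqrt (1 - τ ^ 2) := sqrt_nonneg _
  set l := sqrt (1 - k ^ 2)
  set ρ := sqrt (1 - τ ^ 2)
  set b := (-(τ * l) + ρ * k) • u - ρ • v with hb
  have hbn : ‖b‖ = l := by
    have : ‖b‖ ^ 2 = l ^ 2 := by
      rw [← real_inner_self_eq_norm_sq, hb]
      simp only [inner_sub_left, inner_sub_right, real_inner_smul_left, real_inner_smul_right, uu,
        vv, hvu, ← hkdef]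
      have : (-(τ * l) + ρ * k) * ((-(τ * l) + ρ * k) * 1) - ρ * ((-(τ * l) + ρ * k) * k) -
        ((-(τ * l) + ρ * k) * (ρ * k) - ρ * (ρ * 1)) = τ ^ 2 * l ^ 2 + ρ ^ 2 * (1 - k ^ 2) := by
        ring
      rw [← hl2, hr2] at this
      linear_combination this
    exact (sq_eq_sq₀ (norm_nonneg _) hl.le).1 this
  have h6 := h2' b (by
    rw [hbn, hb, inner_sub_left, real_inner_smul_left, real_inner_smul_left, uu, hvu]
    apply le_of_eq; ring)
  rw [hb, inner_sub_left, real_inner_smul_left, real_inner_smul_left, vv, ← hkdef] at h6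
  have h7 : ρ * l ≤ -k * τ := by
    have : l * (ρ * l) ≤ l * (-k * τ) := by
      have : l * (ρ * l) = ρ * (1 - k ^ 2) := by rw [← hl2]; ring
      nlinarith
    exact le_of_mul_le_mul_left this hl
  have h8 := pow_le_pow_left₀ (by positivity) h7 2
  rw [mul_pow, hr2, hl2] at h8
  nlinarith

end Pal

namespace Pal

lemma pad {ι : Type} [Fintype ι] {n : ℕ} (hc : Fintype.card ι ≤ n) (z : ι → E 2) (a : ι → ℝ)
    (ha : ∀ i, 0 ≤ a i) (hs : ∑ i, a i = 1) :
    ∃ (b : Fin n → ℝ) (y : Fin n → E 2), (∀ j, 0 ≤ b j) ∧ ∑ j, b j = 1 ∧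
      (∀ j, y j ∈ Set.range z) ∧ ∑ j, b j • y j = ∑ i, a i • z i := by
  obtain ⟨e⟩ := Function.Embedding.nonempty_of_card_le (β := Fin n) (by simpa using hc)
  have hne : Nonempty ι := by
    by_contra h
    rw [not_nonempty_iff] at h
    simp at hs
  obtain ⟨i0⟩ := hne
  have h0 : ∀ j, j ∉ Set.range e → Function.extend e a 0 j = 0 := by
    intro j hj
    rw [Function.extend_apply' _ _ _ (by simpa using hj)]; rfl
  refine ⟨Function.extend e a 0, Function.extend e z (fun _ => z i0), ?_, ?_, ?_, ?_⟩
  · intro j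
    by_cases hj : j ∈ Set.range e
    · obtain ⟨i, rfl⟩ := hj
      rw [e.injective.extend_apply]; exact ha i
    · rw [h0 j hj]
  · rw [← hs]; symm
    apply Fintype.sum_of_injective e e.injective
    · exact h0
    · intro i; rw [e.injective.extend_apply]
  · intro j
    by_cases hj : j ∈ Set.range e
    · obtain ⟨i, rfl⟩ := hj
      rw [e.injective.extend_apply]; exact ⟨i, rfl⟩
    · rw [Function.extend_apply' _ _ _ (by simpa using hj)]; exact ⟨i0, rfl⟩
  · symm
    apply Fintype.sum_of_injective e e.injective
    · intro j hj; rw [h0 j hj, zero_smul]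
    · intro i; rw [e.injective.extend_apply, e.injective.extend_apply]

lemma hull_compact {s : Set (E 2)} (hs : IsCompact s) : IsCompact (convexHull ℝ s) := by
  have h : convexHull ℝ s = (fun q : (Fin 4 → ℝ) × (Fin 4 → E 2) => ∑ i, q.1 i • q.2 i) ''
      (stdSimplex ℝ (Fin 4) ×ˢ Set.pi Set.univ fun _ => s) := by
    ext x; constructor
    · intro hx
      obtain ⟨ι, hι, z, a, h1, h2, h3, h4, h5⟩ := eq_pos_convex_span_of_mem_convexHull hx
      have hcard : Fintype.card ι ≤ 4 := by
        have := h2.card_le_finrank_succ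
        have h6 := Submodule.finrank_le (vectorSpan ℝ (Set.range z))
        rw [finrank_euclideanSpace, Fintype.card_fin] at h6
        omega
      obtain ⟨b, y, b1, b2, b3, b4⟩ := pad hcard z a (fun i => (h3 i).le) h4
      refine ⟨(b, y), ⟨⟨b1, b2⟩, fun j _ => h1 (b3 j)⟩, ?_⟩
      simp only; rw [b4, h5]
    · rintro ⟨⟨b, y⟩, ⟨⟨b1, b2⟩, hy⟩, rfl⟩
      simp only at b1 b2 hy ⊢
      refine (convex_convexHull ℝ s).sum_mem (fun i _ => b1 i) b2 fun i _ => ?_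
      exact subset_convexHull ℝ s (hy i (Set.mem_univ i))
  rw [h]
  apply ((isCompact_stdSimplex ℝ (Fin 4)).prod (isCompact_univ_pi fun _ => hs)).image
  fun_prop

structure Core (K : Set (E 2)) (w : ℝ) (o : E 2) (r : ℝ) (e : Fin 3 → E 2) (a : Fin 3 → ℝ)
    (p : Fin 3 → E 2) : Prop where
  on : ‖o‖ = 1
  rpos : 0 < r
  rle : r ≤ w / 2
  capK : cap o r ⊆ K
  en : ∀ i, ‖e i‖ = 1
  oe : ∀ i, ⟪o, e i⟫ = 0
  sup : ∀ i, ∀ x ∈ K, cos r * ⟪x, e i⟫ ≤ sin r * ⟪x, o⟫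
  an : ∀ i, 0 ≤ a i
  asum : ∑ i, a i = 1
  ae : ∑ i, a i • e i = 0
  pK : ∀ i, p i ∈ K
  far : ∀ i, cos r * ⟪p i, e i⟫ ≤ sin r * ⟪p i, o⟫ - sin w

lemma arccos_add {x y z : E 2} (hx : ‖x‖ = 1) (hy : ‖y‖ = 1) (hz : ‖z‖ = 1) :
    arccos ⟪x, z⟫ ≤ arccos ⟪x, y⟫ + arccos ⟪y, z⟫ := by
  have := InnerProductGeometry.angle_le_angle_add_angle x y z
  rwa [← gdist_eq_angle hx hy, ← gdist_eq_angle hy hz, ← gdist_eq_angle hx hz] at this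

lemma exists_core {K : Set (E 2)} (hK : IsConvexBody K) (hw2 : width K ≤ π / 2)
    (hw0 : 0 < width K) : ∃ o r e a p, Core K (width K) o r e a p := by
  obtain ⟨x0, hx0⟩ := hK.2.2
  have hx0n := mem_unit.1 (hK.1.1 hx0.1)
  have hne : (polar K).Nonempty := by
    obtain ⟨h, h1, h2⟩ := hK.1.2.1
    refine ⟨-h, mem_polar.2 ⟨by rw [norm_neg]; exact mem_unit.1 h1, fun a ha => ?_⟩⟩
    rw [inner_neg_right, real_inner_comm]; linarith [h2 a ha]
  have hC := hull_compact (polar_compact K)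
  obtain ⟨q, hq, hqmin⟩ := exists_norm_eq_iInf_of_complete_convex
    (convexHull_nonempty_iff.2 hne) hC.isComplete (convex_convexHull ℝ _) (0 : E 2)
  rw [norm_eq_iInf_iff_real_inner_le_zero (convex_convexHull ℝ _) hq] at hqmin
  obtain ⟨ι, hι, z, a, h1, h2, h3, h4, h5⟩ := eq_pos_convex_span_of_mem_convexHull hq
  have zP : ∀ i, z i ∈ polar K := fun i => h1 ⟨i, rfl⟩
  have hιne : Nonempty ι := by
    by_contra h
    rw [not_nonempty_iff] at h
    simp at h4
  have hq0 : q ≠ 0 := by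
    intro h0
    have h6 : ⟪x0, q⟫ < 0 := by
      rw [← h5, inner_sum]
      apply Finset.sum_neg
      · intro i _
        rw [real_inner_smul_right]
        exact mul_neg_of_pos_of_neg (h3 i) (interior_neg hK.1.1 hx0 (zP i))
      · exact Finset.univ_nonempty
    rw [h0, inner_zero_right] at h6
    exact lt_irrefl _ h6
  set s := ‖q‖ with hs
  have hs0 : 0 < s := norm_pos_iff.2 hq0
  have qq : ⟪q, q⟫ = s ^ 2 := real_inner_self_eq_norm_sq q
  have hqu : ∀ u ∈ polar K, s ^ 2 ≤ ⟪q, u⟫ := by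
    intro u hu
    have := hqmin u (subset_convexHull ℝ _ hu)
    rw [zero_sub, inner_neg_left, inner_sub_right, qq] at this
    linarith
  have hzq : ∀ i, ⟪q, z i⟫ = s ^ 2 := by
    by_contra! hcon
    obtain ⟨i, hi⟩ := hcon
    have h6 : ∑ j, a j * s ^ 2 < ∑ j, a j * ⟪q, z j⟫ := by
      apply Finset.sum_lt_sum
      · intro j _
        exact mul_le_mul_of_nonneg_left (hqu _ (zP j)) (h3 j).le
      · exact ⟨i, Finset.mem_univ i, mul_lt_mul_of_pos_left
          (lt_of_le_of_ne (hqu _ (zP i)) (Ne.symm hi)) (h3 i)⟩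
    rw [← Finset.sum_mul, h4, one_mul, ← qq] at h6
    nth_rewrite 2 [← h5] at h6
    rw [inner_sum] at h6
    simp only [real_inner_smul_right] at h6
    exact lt_irrefl _ h6
  have hli : LinearIndependent ℝ z := by
    rw [linearIndependent_iff']
    intro t g hg i hi
    rw [affineIndependent_iff] at h2
    refine h2 t g ?_ hg i hi
    have h6 : ⟪q, ∑ j ∈ t, g j • z j⟫ = 0 := by rw [hg, inner_zero_right]
    rw [inner_sum] at h6
    simp only [real_inner_smul_right, hzq] at h6
    rw [← Finset.sum_mul] at h6
    exact (mul_eq_zero.1 h6).resolve_right (by positivity)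
  have hcard : Fintype.card ι ≤ 3 := by
    have := hli.fintype_card_le_finrank
    rwa [finrank_euclideanSpace, Fintype.card_fin] at this
  obtain ⟨b, y, b1, b2, b3, b4⟩ := pad hcard z a (fun i => (h3 i).le) h4
  rw [h5] at b4
  have yP : ∀ j, y j ∈ polar K := by
    intro j; obtain ⟨i, hi⟩ := b3 j; rw [← hi]; exact zP i
  have yq : ∀ j, ⟪q, y j⟫ = s ^ 2 := by
    intro j; obtain ⟨i, hi⟩ := b3 j; rw [← hi]; exact hzq i
  have yn : ∀ j, ‖y j‖ = 1 := fun j => (mem_polar.1 (yP j)).1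
  clear h1 h2 h3 h4 h5 hli hcard hzq zP b3 hqmin
  -- the centre
  set o := -(s⁻¹ • q) with ho
  have on : ‖o‖ = 1 := by
    rw [ho, norm_neg, norm_smul, norm_inv, norm_norm, inv_mul_cancel₀ hs0.ne']
  have hqo : q = -(s • o) := by
    rw [ho, smul_neg, neg_neg, smul_smul, mul_inv_cancel₀ hs0.ne', one_smul]
  have oinner : ∀ x : E 2, ⟪o, x⟫ = -(s⁻¹ * ⟪q, x⟫) := by
    intro x; rw [ho, inner_neg_left, real_inner_smul_left]
  have hou : ∀ u ∈ polar K, ⟪o, u⟫ ≤ -s := by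
    intro u hu
    rw [oinner, neg_le_neg_iff]
    have := hqu u hu
    rw [← div_eq_inv_mul, le_div_iff₀ hs0]; linarith
  have hoy : ∀ j, ⟪o, y j⟫ = -s := by
    intro j; rw [oinner, yq]; field_simp
  have hs1 : s ≤ 1 := by
    obtain ⟨u, hu⟩ := hne
    have h6 := hou u hu
    have h7 := abs_real_inner_le_norm o u
    rw [on, (mem_polar.1 hu).1, one_mul] at h7
    linarith [(abs_le.1 h7).1]
  set r := arcsin s with hr
  have hsr : sin r = s := sin_arcsin (by linarith) hs1
  have hr0 : 0 < r := arcsin_pos.2 hs0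
  have hang : ∀ u ∈ polar K, π / 2 + r ≤ arccos ⟪o, u⟫ := by
    intro u hu
    have h8 : arccos (-s) ≤ arccos ⟪o, u⟫ := arccos_le_arccos (hou u hu)
    rw [arccos_neg, arccos_eq_pi_div_two_sub_arcsin, ← hr] at h8
    linarith
  have hrw : r ≤ width K / 2 := by
    have : 2 * r ≤ width K := by
      apply le_width hw0
      intro u v huv
      have hu : u ∈ polar K := ⟨huv.1, fun a ha => (huv.2.2.2.2.1 ha).2.1⟩
      have hv : v ∈ polar K := ⟨huv.2.1, fun a ha => (huv.2.2.2.2.1 ha).2.2⟩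
      have hu1 := (mem_polar.1 hu).1
      have hv1 := (mem_polar.1 hv).1
      have h9 := arccos_add (x := u) (y := -o) (z := v) hu1 (by rw [norm_neg, on]) hv1
      rw [inner_neg_left, inner_neg_right, arccos_neg, arccos_neg, real_inner_comm o u] at h9
      rw [arccos_neg]
      linarith [hang u hu, hang v hv]
    linarith
  have hcr : 0 < cos r := cos_pos_of_mem_Ioo ⟨by linarith, by linarith [pi_pos]⟩
  have hcs : cos r ^ 2 = 1 - s ^ 2 := by rw [← hsr]; linarith [sin_sq_add_cos_sq r]
  have hcap : cap o r ⊆ K := by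
    rintro x ⟨hx, hxo⟩
    have hx1 := mem_unit.1 hx
    apply bipolar hK hx1
    intro u hu
    have h9 := arccos_add (x := o) (y := x) (z := u) on hx1 (mem_polar.1 hu).1
    have h10 : arccos ⟪o, x⟫ ≤ r := by
      rw [← arccos_cos hr0.le (by linarith [pi_pos]), real_inner_comm]
      exact arccos_le_arccos hxo
    have h11 := hang u hu
    by_contra hcon
    push Not at hcon
    have := arccos_lt_pi_div_two.2 hcon
    linarith
  choose p hpK hpf using fun j => far_point hK hw2 hw0 (yP j)
  have hoo := sq_of_norm_one on
  have hye : ∀ j, cos r • ((cos r)⁻¹ • (y j + s • o)) = y j + s • o := by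
    intro j; rw [smul_smul, mul_inv_cancel₀ hcr.ne', one_smul]
  refine ⟨o, r, fun j => (cos r)⁻¹ • (y j + s • o), b, p, on, hr0, hrw, hcap, ?_, ?_, ?_, b1, b2,
    ?_, hpK, ?_⟩
  · intro j
    have h6 : ‖y j + s • o‖ = cos r := by
      refine (sq_eq_sq₀ (norm_nonneg _) hcr.le).1 ?_
      rw [hcs, ← real_inner_self_eq_norm_sq]
      simp only [inner_add_left, inner_add_right, real_inner_smul_left, real_inner_smul_right, hoo,
        sq_of_norm_one (yn j), hoy, real_inner_comm o (y j)]
      ring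
    rw [norm_smul, h6, norm_inv, norm_of_nonneg hcr.le, inv_mul_cancel₀ hcr.ne']
  · intro j
    rw [real_inner_smul_right, inner_add_right, real_inner_smul_right, hoo, hoy]; simp
  · intro j x hx
    rw [← real_inner_smul_right, hye, hsr, inner_add_right, real_inner_smul_right]
    linarith [(mem_polar.1 (yP j)).2 x hx]
  · simp only [smul_comm _ (cos r)⁻¹]
    rw [← Finset.smul_sum]
    simp only [smul_add]
    rw [Finset.sum_add_distrib, b4, ← Finset.sum_smul, b2, one_smul, hqo]
    simp
  · intro j
    rw [← real_inner_smul_right, hye, hsr, inner_add_right, real_inner_smul_right]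
    linarith [hpf j]

end Pal

namespace Pal

/-- one-sided information on `f` relative to its own normal `e1` -/
lemma sep_one {a1 a2 a3 g t x C : ℝ} (h1 : 0 < a1) (h2 : 0 < a2) (h3 : 0 < a3)
    (hs : a1 + a2 + a3 = 1) (b1 : a1 < 1 / 2) (b2 : a2 < 1 / 2) (hC : 0 ≤ C)
    (htC : t ≤ C) (htg : t ≤ g) (hxg : x ≤ g)
    (h0 : a1 * (-g) + a2 * t + a3 * x = 0) : -C ≤ x ∧ |x| ≤ g := by
  have hg : 0 ≤ g := by
    have : 0 ≤ (1 - 2 * a1) * g := by nlinarith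
    by_contra hcon
    push Not at hcon
    nlinarith
  constructor
  · by_contra hcon
    push Not at hcon
    rcases le_or_gt a2 a1 with h | h
    · have : 0 ≤ a3 * x := by nlinarith
      nlinarith
    · have e1 : -((a2 - a1) * C) ≤ a3 * x := by nlinarith
      have e2 : (a2 - a1) * C ≤ a3 * C := by nlinarith
      nlinarith
  · rw [abs_le]
    refine ⟨?_, hxg⟩
    by_contra hcon
    push Not at hcon
    have e1 : (a1 - a2) * g ≤ a3 * x := by nlinarith
    have e2 : a3 * x < a3 * (-g) := mul_lt_mul_of_pos_left hcon h3
    nlinarith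

lemma sq_eq_one_iff_of_side (k : ℝ) (h : k ^ 2 = 1) : k = 1 ∨ k = -1 := by
  have : (k - 1) * (k + 1) = 0 := by linarith
  rcases mul_eq_zero.1 this with h | h
  · left; linarith
  · right; linarith

lemma sep_real {a1 a2 a3 k1 l1 k2 l2 x1 y1 x2 y2 C : ℝ} (h1 : 0 < a1) (h2 : 0 < a2) (h3 : 0 < a3)
    (hs : a1 + a2 + a3 = 1) (b1 : a1 < 1 / 2) (b2 : a2 < 1 / 2) (b3 : a3 < 1 / 2) (hC : 0 ≤ C)
    (n1 : k1 ^ 2 + l1 ^ 2 = 1) (n2 : k2 ^ 2 + l2 ^ 2 = 1)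
    (hk : a1 * k1 + a2 * k2 + a3 = 0) (hl : a1 * l1 + a2 * l2 = 0)
    (m1 : x1 ^ 2 + y1 ^ 2 = 1) (m2 : x2 ^ 2 + y2 ^ 2 = 1) (c1 : x1 ≤ C) (c2 : x2 ≤ C)
    (c3 : k2 * x1 + l2 * y1 ≤ C) (c4 : k1 * x2 + l1 * y2 ≤ C)
    (d1 : (k1 * x1 + l1 * y1) + (k2 * x1 + l2 * y1) ≤ 0) (d2 : (k1 * x1 + l1 * y1) + x1 ≤ 0)
    (d3 : (k2 * x2 + l2 * y2) + (k1 * x2 + l1 * y2) ≤ 0) (d4 : (k2 * x2 + l2 * y2) + x2 ≤ 0) :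
    x1 * x2 + y1 * y2 ≤ 2 * C ^ 2 - 1 := by
  obtain ⟨p1, p2⟩ := sep_one (g := -(k1 * x1 + l1 * y1)) (t := k2 * x1 + l2 * y1) (x := x1)
    h1 h2 h3 hs b1 b2 hC c3 (by linarith) (by linarith)
    (by linear_combination x1 * hk + y1 * hl)
  obtain ⟨q1, q2⟩ := sep_one (g := -(k2 * x2 + l2 * y2)) (t := k1 * x2 + l1 * y2) (x := x2)
    h2 h1 h3 (by linarith) b2 b1 hC c4 (by linarith) (by linarith)
    (by linear_combination x2 * hk + y2 * hl)
  have kx : ∀ k l x : ℝ, k ^ 2 + l ^ 2 = 1 → -|x| ≤ k * x := by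
    intro k l x h
    have : |k| ≤ 1 := by rw [← sq_le_one_iff_abs_le_one]; nlinarith
    have : |k * x| ≤ 1 * |x| := by rw [abs_mul]; gcongr
    linarith [neg_abs_le (k * x)]
  have e1 : l1 * y1 ≤ 0 := by linarith [kx k1 l1 x1 n1]
  have e2 : l2 * y2 ≤ 0 := by linarith [kx k2 l2 x2 n2]
  have hl2 : l2 ≠ 0 := by
    intro h0
    have hl1 : l1 = 0 := by
      rw [h0] at hl
      have : a1 * l1 = 0 := by linarith
      exact (mul_eq_zero.1 this).resolve_left h1.ne'
    have i1 : k1 = 1 ∨ k1 = -1 := sq_eq_one_iff_of_side k1 (by rw [hl1] at n1; linarith)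
    have i2 : k2 = 1 ∨ k2 = -1 := sq_eq_one_iff_of_side k2 (by rw [h0] at n2; linarith)
    rcases i1 with i | i <;> rcases i2 with j | j <;> rw [i, j] at hk <;> linarith
  have e3 : y1 * y2 ≤ 0 := by
    have f1 : 0 ≤ (l1 * y1) * (l2 * y2) := mul_nonneg_of_nonpos_of_nonpos e1 e2
    have f2 : a1 * ((l1 * y1) * (l2 * y2)) = -(a2 * l2 ^ 2) * (y1 * y2) := by
      have : a1 * l1 = -(a2 * l2) := by linarith
      linear_combination (y1 * l2 * y2) * this
    have f3 : 0 < a2 * l2 ^ 2 := by positivity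
    by_contra hcon
    push Not at hcon
    have := mul_pos f3 hcon
    nlinarith [mul_nonneg h1.le f1]
  have g1 : x1 ^ 2 ≤ C ^ 2 := sq_le_sq' p1 c1
  have g2 : x2 ^ 2 ≤ C ^ 2 := sq_le_sq' q1 c2
  have g3 : x1 * x2 ≤ C ^ 2 := by nlinarith [sq_nonneg (x1 - x2)]
  have g4 : 1 - C ^ 2 ≤ -(y1 * y2) := by
    rcases le_or_gt (1 - C ^ 2) 0 with h | h
    · linarith
    · refine (sq_le_sq₀ h.le (by linarith)).1 ?_
      have f1 : 1 - C ^ 2 ≤ y1 ^ 2 := by linarith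
      have f2 : 1 - C ^ 2 ≤ y2 ^ 2 := by linarith
      calc (1 - C ^ 2) ^ 2 = (1 - C ^ 2) * (1 - C ^ 2) := by ring
        _ ≤ y1 ^ 2 * y2 ^ 2 := mul_le_mul f1 f2 h.le (sq_nonneg _)
        _ = _ := by ring
  linarith


lemma sep_vec {o e1 e2 e3 f1 f2 : E 2} {a1 a2 a3 C : ℝ} (ho : ‖o‖ = 1) (he1 : ‖e1‖ = 1)
    (he2 : ‖e2‖ = 1) (he3 : ‖e3‖ = 1) (hf1 : ‖f1‖ = 1) (hf2 : ‖f2‖ = 1) (o1 : ⟪o, e1⟫ = 0)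
    (o2 : ⟪o, e2⟫ = 0) (o3 : ⟪o, e3⟫ = 0) (of1 : ⟪o, f1⟫ = 0) (of2 : ⟪o, f2⟫ = 0)
    (hs : a1 + a2 + a3 = 1) (b1 : a1 < 1 / 2) (b2 : a2 < 1 / 2) (b3 : a3 < 1 / 2) (hC : 0 ≤ C)
    (h0 : a1 • e1 + a2 • e2 + a3 • e3 = 0)
    (c1 : ⟪f1, e3⟫ ≤ C) (c2 : ⟪f2, e3⟫ ≤ C) (c3 : ⟪f1, e2⟫ ≤ C) (c4 : ⟪f2, e1⟫ ≤ C)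
    (d1 : ⟪f1, e1⟫ + ⟪f1, e2⟫ ≤ 0) (d2 : ⟪f1, e1⟫ + ⟪f1, e3⟫ ≤ 0)
    (d3 : ⟪f2, e2⟫ + ⟪f2, e1⟫ ≤ 0) (d4 : ⟪f2, e2⟫ + ⟪f2, e3⟫ ≤ 0) :
    ⟪f1, f2⟫ ≤ 2 * C ^ 2 - 1 := by
  obtain ⟨n, F⟩ := exists_Frame ho he3 o3
  have flip : ∀ x, ⟪o, x⟫ = 0 → ⟪x, o⟫ = 0 := fun x h => by rw [real_inner_comm]; exact h
  have ip : ∀ x y : E 2, ⟪o, x⟫ = 0 → ⟪x, y⟫ = ⟪y, e3⟫ * ⟪x, e3⟫ + ⟪y, n⟫ * ⟪x, n⟫ := by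
    intro x y hx
    conv_lhs => rw [F.rep y]
    simp only [inner_add_right, real_inner_smul_right, flip x hx]; ring
  have nn : ∀ x : E 2, ‖x‖ = 1 → ⟪o, x⟫ = 0 → ⟪x, e3⟫ ^ 2 + ⟪x, n⟫ ^ 2 = 1 := by
    intro x hx hx2
    rw [← sq_of_norm_one hx, ip x x hx2]; ring
  have k1 : a1 * ⟪e1, e3⟫ + a2 * ⟪e2, e3⟫ + a3 = 0 := by
    have : ⟪a1 • e1 + a2 • e2 + a3 • e3, e3⟫ = 0 := by rw [h0, inner_zero_left]
    simp only [inner_add_left, real_inner_smul_left, F.ff] at this; linarith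
  have k2 : a1 * ⟪e1, n⟫ + a2 * ⟪e2, n⟫ = 0 := by
    have : ⟪a1 • e1 + a2 • e2 + a3 • e3, n⟫ = 0 := by rw [h0, inner_zero_left]
    simp only [inner_add_left, real_inner_smul_left, F.fg] at this; linarith
  rw [ip f1 e1 of1] at d1 d2
  rw [ip f1 e2 of1] at d1 c3
  rw [ip f2 e1 of2] at d3 c4
  rw [ip f2 e2 of2] at d3 d4
  rw [ip f1 f2 of1]
  have := sep_real (by linarith) (by linarith) (by linarith) hs b1 b2 b3 hC (nn e1 he1 o1)
    (nn e2 he2 o2) k1 k2 (nn f1 hf1 of1) (nn f2 hf2 of2) c1 c2 c3 c4 d1 d2 d3 d4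
  linarith

lemma h_upper {c s S C g h : ℝ} (hc : 0 < c) (hs : 0 < s) (hS : 0 < S)
    (n2 : S ^ 2 + C ^ 2 = 1) (hw : s * S ≤ c * C) (hsw : s < c * S + s * C)
    (hgh : g ^ 2 + h ^ 2 ≤ 1) (hfar : c * S + s * C ≤ c * g + s * h) : h ≤ C := by
  have h1 : h ≤ 1 := by nlinarith
  have hg : 0 < g := by
    have : 0 < c * g := by nlinarith
    exact (mul_pos_iff_of_pos_left hc).1 this
  by_contra hcon
  push Not at hcon
  have e1 : c * (S - g) ≤ s * (h - C) := by linarith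
  have e2 : (h - C) * (h + C) ≤ (S - g) * (S + g) := by nlinarith
  have e3 : c * (S - g) * (S + g) ≤ s * (h - C) * (S + g) :=
    mul_le_mul_of_nonneg_right e1 (by linarith)
  have e4 : c * ((h - C) * (h + C)) ≤ c * ((S - g) * (S + g)) := mul_le_mul_of_nonneg_left e2 hc.le
  have e5 : (h - C) * (c * (h + C)) ≤ (h - C) * (s * (S + g)) := by linarith
  have e6 := le_of_mul_le_mul_left e5 (by linarith)
  have e7 : g < S := by
    have : c * (h + C) ≤ s * (S + g) := e6
    have hC0 : 0 < C := by
      by_contra hx; push Not at hx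
      nlinarith [mul_pos hs hS, mul_nonneg hc.le (neg_nonneg.2 hx)]
    have : g ^ 2 < S ^ 2 := by nlinarith
    exact lt_of_pow_lt_pow_left₀ 2 hS.le this
  nlinarith [mul_lt_mul_of_pos_left e7 hs, mul_lt_mul_of_pos_left hcon hc]

section
variable {K : Set (E 2)} {w r : ℝ} {o : E 2} {e p : Fin 3 → E 2} {a : Fin 3 → ℝ}

lemma bessel2 {o e x : E 2} (ho : ‖o‖ = 1) (he : ‖e‖ = 1) (h : ⟪o, e⟫ = 0) :
    ⟪x, e⟫ ^ 2 + ⟪x, o⟫ ^ 2 ≤ ⟪x, x⟫ := by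
  obtain ⟨n, F⟩ := exists_Frame ho he h
  rw [F.nsq]; nlinarith [sq_nonneg ⟪x, n⟫]

lemma Core.trig (H : Core K w o r e a p) (hw0 : 0 < w) (hw : w ≤ π / 2) :
    0 < sin r ∧ 0 < cos r ∧ 0 < sin (w - r) ∧ 0 < cos (w - r) ∧ 0 < sin w ∧ 0 ≤ cos w ∧
    sin w = cos r * sin (w - r) + sin r * cos (w - r) ∧
    cos w = cos r * cos (w - r) - sin r * sin (w - r) ∧
    sin r * cos (w - r) ≤ cos r * sin (w - r) ∧ sin r < sin w := by
  have h1 := H.rpos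
  have h2 := H.rle
  have := pi_pos
  refine ⟨sin_pos_of_pos_of_lt_pi h1 (by linarith), cos_pos_of_mem_Ioo ⟨by linarith, by linarith⟩,
    sin_pos_of_pos_of_lt_pi (by linarith) (by linarith),
    cos_pos_of_mem_Ioo ⟨by linarith, by linarith⟩, sin_pos_of_pos_of_lt_pi hw0 (by linarith),
    cos_nonneg_of_neg_pi_div_two_le_of_le (by linarith) hw, ?_, ?_, ?_, ?_⟩
  · have := sin_add r (w - r)
    rw [add_sub_cancel] at this; linarith
  · have := cos_add r (w - r)
    rw [add_sub_cancel] at this; linarith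
  · have : 0 ≤ sin ((w - r) - r) := sin_nonneg_of_nonneg_of_le_pi (by linarith) (by linarith)
    rw [sin_sub (w - r) r] at this; linarith
  · exact sin_lt_sin_of_lt_of_le_pi_div_two (by linarith) hw (by linarith)

lemma Core.zero (H : Core K w o r e a p) (x : E 2) :
    a 0 * ⟪x, e 0⟫ + a 1 * ⟪x, e 1⟫ + a 2 * ⟪x, e 2⟫ = 0 := by
  have : ⟪x, ∑ i, a i • e i⟫ = 0 := by rw [H.ae, inner_zero_right]
  rw [inner_sum, Fin.sum_univ_three] at this
  simpa only [real_inner_smul_right] using this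

lemma Core.asum3 (H : Core K w o r e a p) : a 0 + a 1 + a 2 = 1 := by
  have := H.asum
  rwa [Fin.sum_univ_three] at this

lemma Core.pn (H : Core K w o r e a p) (hK : SConvex K) (i : Fin 3) : ‖p i‖ = 1 :=
  mem_unit.1 (hK.1 (H.pK i))

lemma Core.h_lower (H : Core K w o r e a p) (i : Fin 3) :
    a i * sin w ≤ sin r * ⟪p i, o⟫ := by
  have z := H.zero (p i)
  have s0 := mul_le_mul_of_nonneg_left (H.sup 0 _ (H.pK i)) (H.an 0)
  have s1 := mul_le_mul_of_nonneg_left (H.sup 1 _ (H.pK i)) (H.an 1)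
  have s2 := mul_le_mul_of_nonneg_left (H.sup 2 _ (H.pK i)) (H.an 2)
  have t := mul_le_mul_of_nonneg_left (H.far i) (H.an i)
  have u := H.asum3
  have key : cos r * (a 0 * ⟪p i, e 0⟫ + a 1 * ⟪p i, e 1⟫ + a 2 * ⟪p i, e 2⟫) ≤
      (a 0 + a 1 + a 2) * (sin r * ⟪p i, o⟫) - a i * sin w := by
    fin_cases i <;> simp only [Fin.zero_eta, Fin.mk_one, Fin.reduceFinMk] at * <;> linarith
  rw [z, u] at key; linarith

lemma Core.h_up (H : Core K w o r e a p) (hK : SConvex K) (hw0 : 0 < w) (hw : w ≤ π / 2)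
    (i : Fin 3) : ⟪p i, o⟫ ≤ cos (w - r) := by
  obtain ⟨t1, t2, t3, t4, t5, t6, t7, t8, t9, t10⟩ := H.trig hw0 hw
  have hb := bessel2 (x := p i) H.on (H.en i) (H.oe i)
  rw [sq_of_norm_one (H.pn hK i)] at hb
  apply h_upper (g := -⟪p i, e i⟫) t2 t1 t3 (sin_sq_add_cos_sq _) (by linarith) (by linarith)
    (by linarith)
  have := H.far i
  linarith

lemma Core.a_up (H : Core K w o r e a p) (hK : SConvex K) (hw0 : 0 < w) (hw : w ≤ π / 2)
    (i : Fin 3) : a i * sin w ≤ sin r * cos (w - r) :=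
  (H.h_lower i).trans (mul_le_mul_of_nonneg_left (H.h_up hK hw0 hw i) (H.trig hw0 hw).1.le)

end

end Pal

namespace Pal

section
variable {K : Set (E 2)} {w r : ℝ} {o : E 2} {e p : Fin 3 → E 2} {a : Fin 3 → ℝ}

lemma Core.oK (H : Core K w o r e a p) : o ∈ K := by
  apply H.capK
  refine ⟨mem_unit.2 H.on, ?_⟩
  rw [sq_of_norm_one H.on]; exact cos_le_one _

lemma Core.dir (H : Core K w o r e a p) (hK : SConvex K) (hw0 : 0 < w) (hw : w ≤ π / 2)
    (i : Fin 3) : ∃ f : E 2, ‖f‖ = 1 ∧ ⟪o, f⟫ = 0 ∧ cos (w - r) • o + sin (w - r) • f ∈ K ∧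
      ∀ j, j ≠ i → ⟪f, e i⟫ + ⟪f, e j⟫ ≤ 0 := by
  obtain ⟨t1, t2, t3, t4, t5, t6, t7, t8, t9, t10⟩ := H.trig hw0 hw
  have hu := H.h_up hK hw0 hw i
  have hl := H.h_lower i
  have hh0 : 0 ≤ ⟪p i, o⟫ := by
    have := mul_nonneg (H.an i) t5.le
    exact nonneg_of_mul_nonneg_right (this.trans hl) t1
  have pn := sq_of_norm_one (H.pn hK i)
  have oo := sq_of_norm_one H.on
  set h := ⟪p i, o⟫ with hh
  have hoh : ⟪o, p i⟫ = h := real_inner_comm _ _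
  set q := p i - h • o with hq
  have qn2 : ‖q‖ ^ 2 = 1 - h ^ 2 := by
    rw [← real_inner_self_eq_norm_sq, hq]
    simp only [inner_sub_left, inner_sub_right, real_inner_smul_left, real_inner_smul_right, pn,
      oo, hoh, ← hh]; ring
  have hSC := sin_sq_add_cos_sq (w - r)
  have hqS : sin (w - r) ≤ ‖q‖ := by
    refine (sq_le_sq₀ t3.le (norm_nonneg _)).1 ?_
    rw [qn2]; nlinarith
  have hq0 : 0 < ‖q‖ := t3.trans_le hqS
  have hfn : ‖‖q‖⁻¹ • q‖ = 1 := by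
    rw [norm_smul, norm_inv, norm_norm, inv_mul_cancel₀ hq0.ne']
  have hof : ⟪o, ‖q‖⁻¹ • q⟫ = 0 := by
    rw [real_inner_smul_right, hq, inner_sub_right, real_inner_smul_right, oo, hoh]; ring
  refine ⟨‖q‖⁻¹ • q, hfn, hof, ?_, ?_⟩
  · have hb1 : sin (w - r) * ‖q‖⁻¹ ≤ 1 := by
      rw [← div_eq_mul_inv, div_le_one hq0]; exact hqS
    have hb0 : 0 ≤ sin (w - r) * ‖q‖⁻¹ := by positivity
    have eq : cos (w - r) • o + sin (w - r) • ‖q‖⁻¹ • q =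
        (cos (w - r) - (sin (w - r) * ‖q‖⁻¹) * h) • o + (sin (w - r) * ‖q‖⁻¹) • p i := by
      rw [hq]; module
    have hn : ‖cos (w - r) • o + sin (w - r) • ‖q‖⁻¹ • q‖ = 1 := by
      apply norm_one_of_sq
      have h2 := sq_of_norm_one hfn
      set f := ‖q‖⁻¹ • q
      have h3 : ⟪f, o⟫ = 0 := by rw [real_inner_comm]; exact hof
      simp only [inner_add_left, inner_add_right, real_inner_smul_left, real_inner_smul_right, oo,
        hof, h2, h3]
      linarith
    rw [eq] at hn ⊢
    refine pos2 hK H.oK (H.pK i) ?_ hb0 hn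
    nlinarith
  · intro j hj
    rw [real_inner_smul_left, real_inner_smul_left, ← mul_add]
    apply mul_nonpos_of_nonneg_of_nonpos (by positivity)
    rw [hq, inner_sub_left, inner_sub_left, real_inner_smul_left, real_inner_smul_left, H.oe, H.oe]
    have a1 := H.far i
    have a2 := H.sup j _ (H.pK i)
    have a3 := mul_le_mul_of_nonneg_left hu t1.le
    have : cos r * (⟪p i, e i⟫ + ⟪p i, e j⟫) ≤ 0 := by nlinarith
    have := nonpos_of_mul_nonpos_right this t2
    linarith

lemma Core.area (H : Core K w o r e a p) (hK : SConvex K) (hw0 : 0 < w) (hw : w ≤ π / 2) :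
    ∃ φ, 0 ≤ φ ∧ φ ≤ π / 3 ∧ sin r * cos (w - r) = cos r * sin (w - r) * cos φ ∧
    M * (6 * arccos (cos r * sin φ) - π - (2*π - 6*φ) * cos r) ≤ sm.real K := by
  obtain ⟨t1, t2, t3, t4, t5, t6, t7, t8, t9, t10⟩ := H.trig hw0 hw
  have hcS : 0 < cos r * sin (w - r) := mul_pos t2 t3
  set C := sin r * cos (w - r) / (cos r * sin (w - r)) with hC
  have hC0 : 0 < C := by positivity
  have hC1 : C ≤ 1 := by rw [hC, div_le_one hcS]; exact t9
  have hrel : sin r * cos (w - r) = cos r * sin (w - r) * C := by rw [hC]; field_simp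
  have hcos : cos (arccos C) = C := cos_arccos (by linarith) hC1
  have a0 := H.a_up hK hw0 hw 0
  have a1 := H.a_up hK hw0 hw 1
  have a2 := H.a_up hK hw0 hw 2
  have as := H.asum3
  have hCh : 1 / 2 ≤ C := by
    have h1 : (a 0 + a 1 + a 2) * sin w ≤ 3 * (sin r * cos (w - r)) := by linarith
    rw [as, one_mul, t7, hrel] at h1
    have h2 : (cos r * sin (w - r)) * (1 / 2) ≤ cos r * sin (w - r) * C := by linarith
    exact le_of_mul_le_mul_left h2 hcS
  have hφ : arccos C ≤ π / 3 := by
    rw [← arccos_cos (x := π / 3) (by positivity) (by linarith [pi_pos])]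
    apply arccos_le_arccos
    rw [cos_pi_div_three]; exact hCh
  refine ⟨arccos C, arccos_nonneg _, hφ, by rw [hcos]; exact hrel, ?_⟩
  choose f f1 f2 f3 f4 using fun i => H.dir hK hw0 hw i
  have fe : ∀ i j, ⟪f i, e j⟫ ≤ C := by
    intro i j
    have := H.sup j _ (f3 i)
    rw [inner_add_left, inner_add_left, real_inner_smul_left, real_inner_smul_left,
      real_inner_smul_left, real_inner_smul_left, sq_of_norm_one H.on, H.oe,
      real_inner_comm o (f i), f2] at this
    have h2 : (cos r * sin (w - r)) * ⟪f i, e j⟫ ≤ (cos r * sin (w - r)) * C := by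
      rw [← hrel]; linarith
    exact le_of_mul_le_mul_left h2 hcS
  have hsep : ∀ i j k : Fin 3, i ≠ j → i ≠ k → j ≠ k → a i + a j + a k = 1 →
      a i • e i + a j • e j + a k • e k = 0 → ⟪f i, f j⟫ ≤ cos (2 * arccos C) := by
    intro i j k hij hik hjk hsum h0
    rw [cos_two_mul, hcos]
    rcases hC1.eq_or_lt with h1 | h1
    · rw [h1]
      have := real_inner_le_norm (f i) (f j)
      rw [f1, f1] at this; linarith
    · have ah : ∀ i, a i < 1 / 2 := by
        intro i
        have h2 := H.a_up hK hw0 hw i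
        have h3 : sin r * cos (w - r) < cos r * sin (w - r) := by
          rw [hrel]; nlinarith
        by_contra hcon
        push Not at hcon
        nlinarith
      exact sep_vec H.on (H.en i) (H.en j) (H.en k) (f1 i) (f1 j) (H.oe i) (H.oe j) (H.oe k)
        (f2 i) (f2 j) hsum (ah i) (ah j) (ah k) hC0.le h0 (fe i k) (fe j k) (fe i j) (fe j i)
        (f4 i j hij.symm) (f4 i k hik.symm) (f4 j i hij) (f4 j k hjk.symm)
  have e0 : a 0 • e 0 + a 1 • e 1 + a 2 • e 2 = 0 := by
    have := H.ae
    rwa [Fin.sum_univ_three] at this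
  exact area_lower (posClosed hK) H.on (f1 0) (f1 1) (f1 2) (f2 0) (f2 1) (f2 2) H.rpos
    (by linarith [H.rle, pi_pos]) t3 (arccos_nonneg _) hφ (by rw [hcos]; exact hrel) H.capK
    (f3 0) (f3 1) (f3 2) (hsep 0 1 2 (by decide) (by decide) (by decide) as e0)
    (hsep 0 2 1 (by decide) (by decide) (by decide) (by linarith) (by rw [← e0]; abel))
    (hsep 1 2 0 (by decide) (by decide) (by decide) (by linarith) (by rw [← e0]; abel))

end
end Pal

namespace Pal

def kk (φ : ℝ) : ℝ := (1 - cos φ) / (1 + cos φ)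
def DD (w φ : ℝ) : ℝ := arcsin (sin w * kk φ)
def rr (w φ : ℝ) : ℝ := (w - DD w φ) / 2
def FF (w φ : ℝ) : ℝ := 6 * arccos (cos (rr w φ) * sin φ) - π - (2*π - 6*φ) * cos (rr w φ)

lemma cos_half {φ : ℝ} (h0 : 0 ≤ φ) (h1 : φ ≤ π / 3) : 1 / 2 ≤ cos φ := by
  rw [← cos_pi_div_three]
  exact cos_le_cos_of_nonneg_of_le_pi h0 (by linarith [pi_pos]) h1

lemma kk_bd {φ : ℝ} (h0 : 0 ≤ φ) (h1 : φ ≤ π / 3) : 0 ≤ kk φ ∧ kk φ ≤ 1 / 3 := by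
  have := cos_half h0 h1
  have := cos_le_one φ
  unfold kk
  constructor
  · exact div_nonneg (by linarith) (by linarith)
  · rw [div_le_iff₀ (by linarith)]; linarith

lemma DD_sin {w φ : ℝ} (hw0 : 0 < w) (hw : w ≤ π / 2) (h0 : 0 ≤ φ) (h1 : φ ≤ π / 3) :
    sin (DD w φ) = sin w * kk φ ∧ 0 ≤ DD w φ ∧ DD w φ < w ∧
    cos (DD w φ) = sqrt (1 - (sin w * kk φ) ^ 2) ∧ 1 / 2 ≤ cos (DD w φ) := by
  obtain ⟨k0, k1⟩ := kk_bd h0 h1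
  have sw : 0 < sin w := sin_pos_of_pos_of_lt_pi hw0 (by linarith [pi_pos])
  have sw1 := sin_le_one w
  have b0 : 0 ≤ sin w * kk φ := by positivity
  have b1 : sin w * kk φ ≤ 1 / 3 := by nlinarith
  refine ⟨sin_arcsin (by linarith) (by linarith), arcsin_nonneg.2 b0, ?_, cos_arcsin _, ?_⟩
  · have : arcsin (sin w * kk φ) < arcsin (sin w) := by
      apply strictMonoOn_arcsin ⟨by linarith, by linarith⟩ ⟨by linarith, by linarith⟩
      nlinarith
    rwa [arcsin_sin (by linarith [pi_pos]) hw] at this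
  · unfold DD
    rw [cos_arcsin]
    apply le_sqrt_of_sq_le
    nlinarith

lemma DD_deriv {w φ : ℝ} (hw0 : 0 < w) (hw : w ≤ π / 2) (h0 : 0 ≤ φ) (h1 : φ ≤ π / 3) :
    HasDerivAt (DD w) (sin w * (2 * sin φ / (1 + cos φ) ^ 2) / cos (DD w φ)) φ := by
  obtain ⟨k0, k1⟩ := kk_bd h0 h1
  have ch := cos_half h0 h1
  have sw : 0 < sin w := sin_pos_of_pos_of_lt_pi hw0 (by linarith [pi_pos])
  have sw1 := sin_le_one w
  have b0 : 0 ≤ sin w * kk φ := by positivity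
  have b1 : sin w * kk φ ≤ 1 / 3 := by nlinarith
  have hk : HasDerivAt kk (2 * sin φ / (1 + cos φ) ^ 2) φ := by
    have := ((hasDerivAt_cos φ).const_sub 1).div ((hasDerivAt_cos φ).const_add 1)
      (by linarith : (1 + cos φ) ≠ 0)
    convert! this using 1
    congr 1; ring
  have := (hasDerivAt_arcsin (x := sin w * kk φ) (by linarith) (by linarith)).comp φ
    (hk.const_mul (sin w))
  rw [(DD_sin hw0 hw h0 h1).2.2.2.1]
  convert! this using 1
  field_simp

lemma rr_deriv {w φ : ℝ} (hw0 : 0 < w) (hw : w ≤ π / 2) (h0 : 0 ≤ φ) (h1 : φ ≤ π / 3) :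
    HasDerivAt (rr w) (-(sin w * (sin φ / (1 + cos φ) ^ 2) / cos (DD w φ))) φ := by
  have := ((DD_deriv hw0 hw h0 h1).const_sub w).div_const 2
  convert! this using 1
  ring

lemma rr_bd {w φ : ℝ} (hw0 : 0 < w) (hw : w ≤ π / 2) (h0 : 0 ≤ φ) (h1 : φ ≤ π / 3) :
    0 < rr w φ ∧ rr w φ ≤ w / 2 ∧ w - rr w φ = rr w φ + DD w φ := by
  obtain ⟨d1, d2, d3, -⟩ := DD_sin hw0 hw h0 h1
  unfold rr
  refine ⟨by linarith, by linarith, by ring⟩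

lemma rel_iff {w r φ : ℝ} (hc : 0 < 1 + cos φ) :
    sin r * cos (w - r) = cos r * sin (w - r) * cos φ ↔ sin (w - 2 * r) = sin w * kk φ := by
  have e1 : sin w = sin (w - r) * cos r + cos (w - r) * sin r := by
    rw [← sin_add]; congr 1; ring
  have e2 : sin (w - 2 * r) = sin (w - r) * cos r - cos (w - r) * sin r := by
    rw [← sin_sub]; congr 1; ring
  unfold kk
  rw [e2, mul_div_assoc', eq_div_iff hc.ne', e1]
  constructor <;> intro h <;> linarith

lemma rr_rel {w φ : ℝ} (hw0 : 0 < w) (hw : w ≤ π / 2) (h0 : 0 ≤ φ) (h1 : φ ≤ π / 3) :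
    sin (rr w φ) * cos (w - rr w φ) = cos (rr w φ) * sin (w - rr w φ) * cos φ := by
  rw [rel_iff (by linarith [cos_half h0 h1]), ← (DD_sin hw0 hw h0 h1).1]
  congr 1; unfold rr; ring

lemma eq_rr {w r φ : ℝ} (hw0 : 0 < w) (hw : w ≤ π / 2) (h0 : 0 ≤ φ) (h1 : φ ≤ π / 3)
    (hr0 : 0 < r) (hr1 : r ≤ w / 2)
    (h : sin r * cos (w - r) = cos r * sin (w - r) * cos φ) : r = rr w φ := by
  rw [rel_iff (by linarith [cos_half h0 h1])] at h
  unfold rr DD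
  rw [← h, arcsin_sin (by linarith) (by linarith)]; ring

lemma FF_deriv {w φ : ℝ} (hw0 : 0 < w) (hw : w ≤ π / 2) (h0 : 0 ≤ φ) (h1 : φ ≤ π / 3) :
    ∃ F', HasDerivAt (FF w) F' φ ∧ F' ≤ -3 * (1 / cos (DD w φ) - 1) := by
  have hpi := pi_pos
  obtain ⟨d1, d2, d3, -, d5⟩ := DD_sin hw0 hw h0 h1
  obtain ⟨r1, r2, r3⟩ := rr_bd hw0 hw h0 h1
  have rel := rr_rel hw0 hw h0 h1
  have hr := rr_deriv hw0 hw h0 h1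
  have ch := cos_half h0 h1
  have sφ : 0 ≤ sin φ := sin_nonneg_of_nonneg_of_le_pi h0 (by linarith)
  have sw : 0 < sin w := sin_pos_of_pos_of_lt_pi hw0 (by linarith)
  set r := rr w φ with hrdef
  set D := DD w φ with hDdef
  have sr : 0 < sin r := sin_pos_of_pos_of_lt_pi r1 (by linarith)
  have cr : 1 / 2 ≤ cos r := cos_half r1.le (by linarith)
  have sR : 0 < sin (w - r) := sin_pos_of_pos_of_lt_pi (by linarith) (by linarith)
  have scr := sin_sq_add_cos_sq r
  have scR := sin_sq_add_cos_sq (w - r)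
  have scφ := sin_sq_add_cos_sq φ
  have hcosr : cos r = cos (w - r) * cos D + sin (w - r) * sin D := by
    rw [← cos_sub]; congr 1; linarith
  set R := w - r with hR
  set r' := -(sin w * (sin φ / (1 + cos φ) ^ 2) / cos D) with hr'
  have hr'0 : r' ≤ 0 := by rw [hr', neg_nonpos]; positivity
  have hβ : sqrt (1 - (cos r * sin φ) ^ 2) = sin r / sin R := by
    have : 1 - (cos r * sin φ) ^ 2 = (sin r / sin R) ^ 2 := by
      field_simp
      have h2 : (cos r * sin R * cos φ) ^ 2 = (sin r * cos R) ^ 2 := by rw [rel]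
      have h3 : cos φ ^ 2 = 1 - sin φ ^ 2 := by linarith
      have h4 : cos R ^ 2 = 1 - sin R ^ 2 := by linarith
      have h5 : cos r ^ 2 = 1 - sin r ^ 2 := by linarith
      rw [mul_pow, mul_pow, mul_pow, h3, h4] at h2
      rw [h5] at h2
      rw [h5]
      linarith
    rw [this, sqrt_sq (by positivity)]
  have hlt : (cos r * sin φ) ^ 2 < 1 := by
    have : 0 < sqrt (1 - (cos r * sin φ) ^ 2) := by rw [hβ]; positivity
    rw [sqrt_pos] at this; linarith
  obtain ⟨l1, l2⟩ := abs_lt.1 (sq_lt_one_iff_abs_lt_one _ |>.1 hlt)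
  have hd1 : HasDerivAt (fun x => cos (rr w x) * sin x) (-sin r * r' * sin φ + cos r * cos φ) φ :=
    hr.cos.mul (hasDerivAt_sin φ)
  have hd2 : HasDerivAt (fun x => arccos (cos (rr w x) * sin x))
      (-(1 / sqrt (1 - (cos r * sin φ) ^ 2)) * (-sin r * r' * sin φ + cos r * cos φ)) φ :=
    HasDerivAt.comp (h := fun x => cos (rr w x) * sin x) (h₂ := arccos) φ
      (hasDerivAt_arccos (x := cos r * sin φ) (by linarith) (by linarith)) hd1
  have hd3 : HasDerivAt (fun x => (2*π - 6*x) * cos (rr w x))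
      (-(6 * 1) * cos r + (2*π - 6*φ) * (-sin r * r')) φ :=
    (((hasDerivAt_id φ).const_mul 6).const_sub (2*π)).mul hr.cos
  have hd := ((hd2.const_mul 6).sub_const π).sub hd3
  refine ⟨_, hd, ?_⟩
  rw [hβ]
  have hA : 1 / (sin r / sin R) * (cos r * cos φ) = cos R := by
    field_simp; linarith
  have hB : 1 / (sin r / sin R) * (sin r * r' * sin φ) = -(sin R * sin D / cos D) := by
    rw [hr', d1]
    unfold kk
    have : (0:ℝ) < 1 + cos φ := by linarith
    field_simp
    linear_combination -scφ
  have hC : cos r - cos R - sin R * sin D / cos D = -(cos r * (1 / cos D - 1)) := by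
    have : cos r / cos D = cos R + sin R * sin D / cos D := by
      rw [hcosr]; field_simp
    rw [mul_sub, mul_one_div, this]; ring
  have hD : 0 ≤ 1 / cos D - 1 := by
    rw [sub_nonneg, le_div_iff₀ (by linarith), one_mul]; exact cos_le_one _
  have hE : (2*π - 6*φ) * (sin r * r') ≤ 0 :=
    mul_nonpos_of_nonneg_of_nonpos (by linarith)
      (mul_nonpos_of_nonneg_of_nonpos sr.le hr'0)
  have hG : 6 * (cos r - cos R - sin R * sin D / cos D) ≤ -3 * (1 / cos D - 1) := by
    rw [hC]; nlinarith
  have : 6 * (-(1 / (sin r / sin R)) * (-sin r * r' * sin φ + cos r * cos φ)) -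
      (-(6 * 1) * cos r + (2*π - 6*φ) * (-sin r * r')) =
      6 * (1 / (sin r / sin R) * (sin r * r' * sin φ)) - 6 * (1 / (sin r / sin R) * (cos r * cos φ))
      + 6 * cos r + (2*π - 6*φ) * (sin r * r') := by ring
  rw [this, hA, hB]
  linarith

lemma kk_mono {x y : ℝ} (h0 : 0 ≤ x) (h : x ≤ y) (h1 : y ≤ π / 3) : kk x ≤ kk y := by
  have c1 := cos_half h0 (h.trans h1)
  have c2 := cos_half (h0.trans h) h1
  have := cos_le_cos_of_nonneg_of_le_pi h0 (by linarith [pi_pos]) h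
  unfold kk
  rw [div_le_div_iff₀ (by linarith) (by linarith)]
  nlinarith

lemma FF_bound {w : ℝ} (hw0 : 0 < w) (hw : w ≤ π / 2) :
    ∃ c > 0, ∀ φ, 0 ≤ φ → φ ≤ π / 3 → FF w (π / 3) + c * (π / 3 - φ) ≤ FF w φ := by
  have hpi := pi_pos
  have sw : 0 < sin w := sin_pos_of_pos_of_lt_pi hw0 (by linarith)
  have hcont : ∀ a b, 0 ≤ a → b ≤ π / 3 → ContinuousOn (FF w) (Set.Icc a b) := by
    intro a b ha hb x hx
    obtain ⟨F', h, -⟩ := FF_deriv hw0 hw (ha.trans hx.1) (hx.2.trans hb)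
    exact h.continuousAt.continuousWithinAt
  have hmono : AntitoneOn (FF w) (Set.Icc 0 (π / 3)) := by
    apply antitoneOn_of_deriv_nonpos (convex_Icc _ _) (hcont _ _ le_rfl le_rfl)
    · intro x hx
      rw [interior_Icc] at hx
      obtain ⟨F', h, -⟩ := FF_deriv hw0 hw hx.1.le hx.2.le
      exact h.differentiableAt.differentiableWithinAt
    · intro x hx
      rw [interior_Icc] at hx
      obtain ⟨F', h, h2⟩ := FF_deriv hw0 hw hx.1.le hx.2.le
      rw [h.deriv]
      have d := (DD_sin hw0 hw hx.1.le hx.2.le).2.2.2.2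
      have : 0 ≤ 1 / cos (DD w x) - 1 := by
        rw [sub_nonneg, le_div_iff₀ (by linarith), one_mul]; exact cos_le_one _
      linarith
  obtain ⟨d1, d2, d3, -, d5⟩ := DD_sin hw0 hw (φ := π / 6) (by linarith) (by linarith)
  have hk : 0 < kk (π / 6) := by
    unfold kk
    have : cos (π / 6) < cos 0 := cos_lt_cos_of_nonneg_of_le_pi le_rfl (by linarith) (by linarith)
    rw [cos_zero] at this
    have := cos_half (φ := π / 6) (by linarith) (by linarith)
    apply div_pos <;> linarith
  have hD1 : 0 < DD w (π / 6) := by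
    unfold DD; rw [arcsin_pos]; positivity
  have hcD : cos (DD w (π / 6)) < 1 := by
    rw [← cos_zero]
    exact cos_lt_cos_of_nonneg_of_le_pi le_rfl (by linarith) hD1
  set c1 := 3 * (1 / cos (DD w (π / 6)) - 1) with hc1
  have hc1p : 0 < c1 := by
    have : 1 < 1 / cos (DD w (π / 6)) := by rw [lt_div_iff₀ (by linarith)]; linarith
    linarith
  have hmono2 : AntitoneOn (fun x => FF w x + c1 * x) (Set.Icc (π / 6) (π / 3)) := by
    have hder : ∀ x ∈ Set.Icc (π / 6) (π / 3), ∃ F', HasDerivAt (fun x => FF w x + c1 * x) F' x ∧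
        F' ≤ 0 := by
      intro x hx
      obtain ⟨F', h, h2⟩ := FF_deriv hw0 hw (by linarith [hx.1]) hx.2
      refine ⟨_, h.add ((hasDerivAt_id x).const_mul c1), ?_⟩
      have x0 : 0 ≤ x := by linarith [hx.1]
      have d := DD_sin hw0 hw x0 hx.2
      have hle : DD w (π / 6) ≤ DD w x := by
        unfold DD
        apply monotone_arcsin
        exact mul_le_mul_of_nonneg_left (kk_mono (by linarith) hx.1 hx.2) sw.le
      have : cos (DD w x) ≤ cos (DD w (π / 6)) :=
        cos_le_cos_of_nonneg_of_le_pi d2 (by linarith [d.2.2.1]) hle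
      have : 1 / cos (DD w (π / 6)) ≤ 1 / cos (DD w x) :=
        one_div_le_one_div_of_le (by linarith [d.2.2.2.2]) this
      linarith
    apply antitoneOn_of_deriv_nonpos (convex_Icc _ _)
    · intro x hx
      obtain ⟨F', h, -⟩ := hder x hx
      exact h.continuousAt.continuousWithinAt
    · intro x hx
      obtain ⟨F', h, -⟩ := hder x (interior_subset hx)
      exact h.differentiableAt.differentiableWithinAt
    · intro x hx
      obtain ⟨F', h, h2⟩ := hder x (interior_subset hx)
      rw [h.deriv]; exact h2
  refine ⟨c1 / 2, by positivity, fun φ h0 h1 => ?_⟩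
  rcases le_total (π / 6) φ with h | h
  · have := hmono2 ⟨h, h1⟩ ⟨by linarith, le_rfl⟩ h1
    simp only at this
    nlinarith
  · have a1 := hmono ⟨h0, h1⟩ ⟨by linarith, by linarith⟩ h
    have a2 := hmono2 (Set.left_mem_Icc.2 (by linarith)) (Set.right_mem_Icc.2 (by linarith))
      (by linarith : π / 6 ≤ π / 3)
    simp only at a2
    nlinarith

lemma rr_lip {w φ : ℝ} (hw0 : 0 < w) (hw : w ≤ π / 2) (h0 : 0 ≤ φ) (h1 : φ ≤ π / 3) :
    |rr w φ - rr w (π / 3)| ≤ 2 * (π / 3 - φ) := by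
  have := (convex_Icc (0:ℝ) (π / 3)).norm_image_sub_le_of_norm_hasDerivWithin_le (f := rr w)
    (f' := fun φ => (-(sin w * (sin φ / (1 + cos φ) ^ 2) / cos (DD w φ)))) (C := 2)
    (fun x hx => (rr_deriv hw0 hw hx.1 hx.2).hasDerivWithinAt) (by
      intro x hx
      obtain ⟨d1, d2, d3, -, d5⟩ := DD_sin hw0 hw hx.1 hx.2
      have ch := cos_half hx.1 hx.2
      have s1 := sin_le_one x
      have s0 : 0 ≤ sin x := sin_nonneg_of_nonneg_of_le_pi hx.1 (by linarith [hx.2, pi_pos])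
      have sw : 0 < sin w := sin_pos_of_pos_of_lt_pi hw0 (by linarith [pi_pos])
      have sw1 := sin_le_one w
      rw [norm_neg, norm_of_nonneg (by positivity), div_le_iff₀ (by linarith)]
      have : sin x / (1 + cos x) ^ 2 ≤ 1 := by
        rw [div_le_one (by positivity)]; nlinarith
      nlinarith)
    (Set.right_mem_Icc.2 (by linarith [pi_pos])) (Set.mem_Icc.2 ⟨h0, h1⟩)
  rw [norm_eq_abs, norm_eq_abs, abs_sub_comm φ, abs_of_nonneg (by linarith : 0 ≤ π / 3 - φ)] at this
  exact this

end Pal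

namespace Pal

/-- A set cut out by half-spaces and in an open hemisphere is spherically convex. -/
lemma sconvex_of {X : Set (E 2)} {o : E 2} {n : Fin 3 → E 2} (ho : ‖o‖ = 1)
    (hX : X = {x | ‖x‖ = 1 ∧ ∀ i, ⟪x, n i⟫ ≤ 0}) (hpos : ∀ x ∈ X, 0 < ⟪o, x⟫) : SConvex X := by
  subst hX
  refine ⟨fun x hx => mem_unit.2 hx.1, ⟨o, mem_unit.2 ho, hpos⟩, ?_⟩
  intro x hx y hy z hz
  have hz1 := mem_unit.1 hz.1
  refine ⟨hz1, ?_⟩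
  have h := hz.2
  rw [gdist_eq_angle hx.1 hz1, gdist_eq_angle hz1 hy.1, gdist_eq_angle hx.1 hy.1] at h
  have h := (InnerProductGeometry.angle_eq_angle_add_angle_iff (by
    intro h0; rw [h0] at hz1; simp at hz1)).1 h.symm
  rcases h with h | h
  · exfalso
    rw [InnerProductGeometry.angle_eq_pi_iff] at h
    obtain ⟨-, t, ht, rfl⟩ := h
    have h1 := hpos _ hx
    have h2 := hpos _ hy
    rw [real_inner_smul_right] at h2
    nlinarith
  · rw [Submodule.mem_span_pair] at h
    obtain ⟨a, b, rfl⟩ := h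
    intro i
    have h1 := hx.2 i
    have h2 := hy.2 i
    have : (a • x + b • y : E 2) = (a : ℝ) • x + (b : ℝ) • y := rfl
    rw [this, inner_add_left, real_inner_smul_left, real_inner_smul_left]
    have := mul_nonneg a.2 (neg_nonneg.2 h1)
    have := mul_nonneg b.2 (neg_nonneg.2 h2)
    simp only [NNReal.val_eq_coe] at *
    linarith

structure Reg (o : E 2) (e : Fin 3 → E 2) (r R : ℝ) : Prop where
  on : ‖o‖ = 1
  en : ∀ i, ‖e i‖ = 1
  oe : ∀ i, ⟪o, e i⟫ = 0
  es : e 0 + e 1 + e 2 = 0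
  r0 : 0 < r
  r1 : r < π / 2
  R0 : 0 < R
  R1 : R < π / 2
  rel : 2 * (sin r * cos R) = cos r * sin R

def vv (o : E 2) (e : Fin 3 → E 2) (R : ℝ) (i : Fin 3) : E 2 := cos R • o - sin R • e i
def uu (o : E 2) (e : Fin 3 → E 2) (r : ℝ) (i : Fin 3) : E 2 := cos r • e i - sin r • o

variable {o : E 2} {e : Fin 3 → E 2} {r R : ℝ}

lemma Reg.pos (H : Reg o e r R) : 0 < sin r ∧ 0 < cos r ∧ 0 < sin R ∧ 0 < cos R ∧
    0 < sin (R + r) ∧ sin (R + r) = 3 * (sin r * cos R) := by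
  have := H.r0; have := H.r1; have := H.R0; have := H.R1
  refine ⟨sin_pos_of_pos_of_lt_pi (by linarith) (by linarith),
    cos_pos_of_mem_Ioo ⟨by linarith, by linarith⟩, sin_pos_of_pos_of_lt_pi (by linarith)
    (by linarith), cos_pos_of_mem_Ioo ⟨by linarith, by linarith⟩,
    sin_pos_of_pos_of_lt_pi (by linarith) (by linarith), ?_⟩
  rw [sin_add]; linarith [H.rel]

lemma Reg.ee (H : Reg o e r R) : (∀ i, ⟪e i, e i⟫ = 1) ∧ ⟪e 0, e 1⟫ = -(1/2) ∧
    ⟪e 0, e 2⟫ = -(1/2) ∧ ⟪e 1, e 2⟫ = -(1/2) ∧ ⟪e 1, e 0⟫ = -(1/2) ∧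
    ⟪e 2, e 0⟫ = -(1/2) ∧ ⟪e 2, e 1⟫ = -(1/2) := by
  have h : ∀ i, ⟪e i, e i⟫ = 1 := fun i => sq_of_norm_one (H.en i)
  have z : ∀ x : E 2, ⟪x, e 0⟫ + ⟪x, e 1⟫ + ⟪x, e 2⟫ = 0 := by
    intro x; rw [← inner_add_right, ← inner_add_right, H.es, inner_zero_right]
  have z0 := z (e 0)
  have z1 := z (e 1)
  have z2 := z (e 2)
  rw [h] at z0 z1 z2
  have c1 := real_inner_comm (e 0) (e 1)
  have c2 := real_inner_comm (e 0) (e 2)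
  have c3 := real_inner_comm (e 1) (e 2)
  refine ⟨h, ?_, ?_, ?_, ?_, ?_, ?_⟩ <;> linarith

lemma Reg.eo (H : Reg o e r R) (i : Fin 3) : ⟪e i, o⟫ = 0 := by rw [real_inner_comm, H.oe]

lemma Reg.rep (H : Reg o e r R) (x : E 2) :
    x = ⟪x, o⟫ • o + (2/3 : ℝ) • (⟪x, e 0⟫ • e 0 + ⟪x, e 1⟫ • e 1 + ⟪x, e 2⟫ • e 2) := by
  obtain ⟨g, F⟩ := exists_Frame H.on (H.en 0) (H.oe 0)
  obtain ⟨h, h01, h02, h12, h10, h20, h21⟩ := H.ee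
  have z : ∀ x : E 2, ⟪x, e 0⟫ + ⟪x, e 1⟫ + ⟪x, e 2⟫ = 0 := by
    intro x; rw [← inner_add_right, ← inner_add_right, H.es, inner_zero_right]
  have he1 := F.rep (e 1)
  have hs := F.nsq (e 1)
  rw [h, H.eo, h10] at hs
  rw [H.eo, h10] at he1
  set t := ⟪e 1, g⟫
  have he2 : e 2 = -(e 0) - e 1 := by rw [eq_sub_iff_add_eq, eq_neg_iff_add_eq_zero, ← H.es]; abel
  have hx1 : ⟪x, e 1⟫ = -(1/2) * ⟪x, e 0⟫ + t * ⟪x, g⟫ := by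
    rw [he1, inner_add_right, inner_add_right, real_inner_smul_right, real_inner_smul_right,
      real_inner_smul_right]; ring
  have hx2 : ⟪x, e 2⟫ = -⟪x, e 0⟫ - ⟪x, e 1⟫ := by linarith [z x]
  rw [hx2, hx1, he2, he1]
  have ht : t ^ 2 = 3/4 := by linarith
  conv_lhs => rw [F.rep x]
  have : ⟪x, g⟫ = (4/3 * t^2) * ⟪x, g⟫ := by rw [ht]; ring
  nth_rw 1 [this]
  module

lemma Reg.vn (H : Reg o e r R) (i : Fin 3) : ‖vv o e R i‖ = 1 := by
  apply norm_one_of_sq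
  unfold vv
  simp only [inner_sub_left, inner_sub_right, real_inner_smul_left, real_inner_smul_right,
    H.oe, H.eo, H.ee.1, sq_of_norm_one H.on]
  linear_combination sin_sq_add_cos_sq R

lemma Reg.un (H : Reg o e r R) (i : Fin 3) : ‖uu o e r i‖ = 1 := by
  apply norm_one_of_sq
  unfold uu
  simp only [inner_sub_left, inner_sub_right, real_inner_smul_left, real_inner_smul_right,
    H.oe, H.eo, H.ee.1, sq_of_norm_one H.on]
  linear_combination sin_sq_add_cos_sq r

lemma Reg.vu_self (H : Reg o e r R) (i : Fin 3) : ⟪vv o e R i, uu o e r i⟫ = -sin (R + r) := by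
  unfold vv uu
  simp only [inner_sub_left, inner_sub_right, real_inner_smul_left, real_inner_smul_right,
    H.oe, H.eo, H.ee.1, sq_of_norm_one H.on]
  rw [sin_add]; ring

lemma Reg.vu (H : Reg o e r R) {i j : Fin 3} (h : i ≠ j) : ⟪vv o e R i, uu o e r j⟫ = 0 := by
  obtain ⟨-, h01, h02, h12, h10, h20, h21⟩ := H.ee
  have hij : ⟪e i, e j⟫ = -(1/2) := by
    fin_cases i <;> fin_cases j <;> simp_all
  unfold vv uu
  simp only [inner_sub_left, inner_sub_right, real_inner_smul_left, real_inner_smul_right,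
    H.oe, H.eo, hij, sq_of_norm_one H.on]
  linear_combination (-1/2) * H.rel

lemma Reg.uu_ne (H : Reg o e r R) {i j : Fin 3} (h : i ≠ j) :
    ⟪uu o e r i, uu o e r j⟫ = -(3/2 * cos r ^ 2 - 1) := by
  obtain ⟨-, h01, h02, h12, h10, h20, h21⟩ := H.ee
  have hij : ⟪e i, e j⟫ = -(1/2) := by
    fin_cases i <;> fin_cases j <;> simp_all
  unfold uu
  simp only [inner_sub_left, inner_sub_right, real_inner_smul_left, real_inner_smul_right,
    H.oe, H.eo, hij, sq_of_norm_one H.on]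
  linear_combination sin_sq_add_cos_sq r

lemma Reg.repv (H : Reg o e r R) (x : E 2) : sin (R + r) • x = (-⟪x, uu o e r 0⟫) • vv o e R 0 +
    (-⟪x, uu o e r 1⟫) • vv o e R 1 + (-⟪x, uu o e r 2⟫) • vv o e R 2 := by
  have z : ⟪x, e 0⟫ + ⟪x, e 1⟫ + ⟪x, e 2⟫ = 0 := by
    rw [← inner_add_right, ← inner_add_right, H.es, inner_zero_right]
  have hS : sin (R + r) = 3 * (sin r * cos R) := H.pos.2.2.2.2.2
  have he2 : e 2 = -(e 0) - e 1 := by rw [eq_sub_iff_add_eq, eq_neg_iff_add_eq_zero, ← H.es]; abel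
  have hx2 : ⟪x, e 2⟫ = -⟪x, e 0⟫ - ⟪x, e 1⟫ := by linarith
  have rel := H.rel
  conv_lhs => rw [H.rep x]
  unfold uu vv
  simp only [inner_sub_right, real_inner_smul_right, hx2, hS]
  rw [he2]
  have h3 : sin r * cos R = cos r * sin R / 2 := by linarith
  have h4 : ∀ A B : E 2, (3 * (sin r * cos R)) • (A + (2/3:ℝ) • B) =
      (3 * (sin r * cos R)) • A + (cos r * sin R) • B := by
    intro A B; rw [← rel]; module
  rw [h4]
  module

lemma Reg.repu (H : Reg o e r R) (x : E 2) : sin (R + r) • x = (-⟪x, vv o e R 0⟫) • uu o e r 0 +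
    (-⟪x, vv o e R 1⟫) • uu o e r 1 + (-⟪x, vv o e R 2⟫) • uu o e r 2 := by
  have z : ⟪x, e 0⟫ + ⟪x, e 1⟫ + ⟪x, e 2⟫ = 0 := by
    rw [← inner_add_right, ← inner_add_right, H.es, inner_zero_right]
  have hS : sin (R + r) = 3 * (sin r * cos R) := H.pos.2.2.2.2.2
  have he2 : e 2 = -(e 0) - e 1 := by rw [eq_sub_iff_add_eq, eq_neg_iff_add_eq_zero, ← H.es]; abel
  have hx2 : ⟪x, e 2⟫ = -⟪x, e 0⟫ - ⟪x, e 1⟫ := by linarith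
  have rel := H.rel
  conv_lhs => rw [H.rep x]
  unfold uu vv
  simp only [inner_sub_right, real_inner_smul_right, hx2, hS]
  rw [he2]
  have h4 : ∀ A B : E 2, (3 * (sin r * cos R)) • (A + (2/3:ℝ) • B) =
      (3 * (sin r * cos R)) • A + (cos r * sin R) • B := by
    intro A B; rw [← rel]; module
  rw [h4]
  module

def tri (o : E 2) (e : Fin 3 → E 2) (r : ℝ) : Set (E 2) := {x | ‖x‖ = 1 ∧ ∀ i, ⟪x, uu o e r i⟫ ≤ 0}

lemma Reg.vmem (H : Reg o e r R) (i : Fin 3) : vv o e R i ∈ tri o e r := by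
  refine ⟨H.vn i, fun j => ?_⟩
  by_cases h : i = j
  · subst h; rw [H.vu_self]; linarith [H.pos.2.2.2.2.1]
  · rw [H.vu h]

lemma Reg.tri_conv (H : Reg o e r R) : SConvex (tri o e r) := by
  apply sconvex_of H.on rfl
  intro x hx
  obtain ⟨h1, h2, h3, h4, h5, h6⟩ := H.pos
  have h := congrArg (fun y => ⟪o, y⟫) (H.repv x)
  simp only [inner_add_right, real_inner_smul_right] at h
  have hv : ∀ i, ⟪o, vv o e R i⟫ = cos R := by
    intro i; unfold vv
    rw [inner_sub_right, real_inner_smul_right, real_inner_smul_right, H.oe,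
      sq_of_norm_one H.on]; ring
  rw [hv, hv, hv] at h
  have a0 := hx.2 0
  have a1 := hx.2 1
  have a2 := hx.2 2
  by_contra hneg
  push Not at hneg
  have z : ⟪x, uu o e r 0⟫ + ⟪x, uu o e r 1⟫ + ⟪x, uu o e r 2⟫ = 0 := by
    by_contra hne
    have : ⟪x, uu o e r 0⟫ + ⟪x, uu o e r 1⟫ + ⟪x, uu o e r 2⟫ < 0 :=
      lt_of_le_of_ne (by linarith) hne
    nlinarith
  have b0 : ⟪x, uu o e r 0⟫ = 0 := by linarith
  have b1 : ⟪x, uu o e r 1⟫ = 0 := by linarith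
  have b2 : ⟪x, uu o e r 2⟫ = 0 := by linarith
  have hr := H.repv x
  rw [b0, b1, b2] at hr
  simp only [neg_zero, zero_smul, add_zero] at hr
  rcases smul_eq_zero.1 hr with h | h
  · linarith
  · have := hx.1; rw [h] at this; simp at this

lemma Reg.tri_eq (H : Reg o e r R) : sconv {vv o e R 0, vv o e R 1, vv o e R 2} = tri o e r := by
  apply Set.Subset.antisymm
  · apply Set.sInter_subset_of_mem
    refine ⟨H.tri_conv, ?_⟩
    rintro x (rfl | rfl | rfl) <;> exact H.vmem _
  · intro x hx
    rintro C ⟨hC, hv⟩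
    have h5 := H.pos.2.2.2.2.1
    have hr := congrArg (fun y => (sin (R + r))⁻¹ • y) (H.repv x)
    simp only [smul_smul, smul_add] at hr
    rw [inv_mul_cancel₀ h5.ne', one_smul] at hr
    rw [hr]
    have i5 : 0 ≤ (sin (R + r))⁻¹ := by positivity
    refine posClosed hC _ (hv (by simp)) _ (hv (by simp)) _ (hv (by simp)) _ _ _
      (mul_nonneg i5 (neg_nonneg.2 (hx.2 0))) (mul_nonneg i5 (neg_nonneg.2 (hx.2 1)))
      (mul_nonneg i5 (neg_nonneg.2 (hx.2 2))) ?_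
    rw [← hr]; exact hx.1

lemma Reg.isReg (H : Reg o e r R) : IsRegularTriangle (tri o e r) := by
  refine ⟨_, _, _, mem_unit.2 (H.vn 0), mem_unit.2 (H.vn 1), mem_unit.2 (H.vn 2), ?_, ?_, ?_,
    H.tri_eq.symm⟩
  · rw [Fintype.linearIndependent_iff]
    intro g hg
    simp only [Fin.sum_univ_three, Matrix.cons_val_zero, Matrix.cons_val_one,
      Matrix.cons_val] at hg
    have h5 := H.pos.2.2.2.2.1
    have key : ∀ i, g i = 0 := by
      intro i
      have h := congrArg (fun y => ⟪y, uu o e r i⟫) hg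
      simp only [inner_add_left, real_inner_smul_left, inner_zero_left] at h
      fin_cases i
      · simp only [Fin.zero_eta, Fin.isValue] at h ⊢
        rw [H.vu_self, H.vu (by decide), H.vu (by decide)] at h
        have : g 0 * sin (R + r) = 0 := by linarith
        exact (mul_eq_zero.1 this).resolve_right h5.ne'
      · simp only [Fin.mk_one, Fin.isValue] at h ⊢
        rw [H.vu_self, H.vu (by decide), H.vu (by decide)] at h
        have : g 1 * sin (R + r) = 0 := by linarith
        exact (mul_eq_zero.1 this).resolve_right h5.ne'
      · simp only [Fin.reduceFinMk, Fin.isValue] at h ⊢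
        rw [H.vu_self, H.vu (by decide), H.vu (by decide)] at h
        have : g 2 * sin (R + r) = 0 := by linarith
        exact (mul_eq_zero.1 this).resolve_right h5.ne'
    exact key
  all_goals
    obtain ⟨-, h01, h02, h12, h10, h20, h21⟩ := H.ee
    unfold gdist vv
    simp only [inner_sub_left, inner_sub_right, real_inner_smul_left, real_inner_smul_right,
      H.oe, H.eo, sq_of_norm_one H.on, h01, h02, h12]

lemma exists_reg {T : Set (E 2)} (hT : IsRegularTriangle T) :
    ∃ o e r R, Reg o e r R ∧ T = tri o e r := by
  obtain ⟨v₁, v₂, v₃, m1, m2, m3, hli, d1, d2, rfl⟩ := hT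
  have n1 := mem_unit.1 m1
  have n2 := mem_unit.1 m2
  have n3 := mem_unit.1 m3
  have b : ∀ {x y : E 2}, ‖x‖ = 1 → ‖y‖ = 1 → -1 ≤ ⟪x, y⟫ ∧ ⟪x, y⟫ ≤ 1 := by
    intro x y hx hy
    have := abs_real_inner_le_norm x y
    rw [hx, hy, one_mul] at this
    exact abs_le.1 this
  unfold gdist at d1 d2
  have e1 := arccos_injOn (b n1 n2) (b n2 n3) d1
  have e2 := arccos_injOn (b n2 n3) (b n1 n3) d2
  set t := ⟪v₁, v₂⟫ with ht
  have i23 : ⟪v₂, v₃⟫ = t := e1.symm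
  have i13 : ⟪v₁, v₃⟫ = t := by rw [← e2, ← e1]
  have i21 : ⟪v₂, v₁⟫ = t := by rw [real_inner_comm]
  have i32 : ⟪v₃, v₂⟫ = t := by rw [real_inner_comm, i23]
  have i31 : ⟪v₃, v₁⟫ = t := by rw [real_inner_comm, i13]
  have s1 := sq_of_norm_one n1
  have s2 := sq_of_norm_one n2
  have s3 := sq_of_norm_one n3
  have hne : v₁ + v₂ + v₃ ≠ 0 := by
    intro h
    rw [Fintype.linearIndependent_iff] at hli
    have := hli (fun _ => 1) (by simp [Fin.sum_univ_three, h]) 0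
    norm_num at this
  have hne2 : v₁ ≠ v₂ := by
    intro h
    have := hli.injective.ne (by decide : (0 : Fin 3) ≠ 1)
    exact this (by simpa using h)
  have t1 : t < 1 := by
    apply lt_of_le_of_ne (b n1 n2).2
    intro h
    exact hne2 ((inner_eq_one_iff_of_norm_eq_one n1 n2).1 h)
  have hsq : ⟪v₁ + v₂ + v₃, v₁ + v₂ + v₃⟫ = 3 + 6 * t := by
    simp only [inner_add_left, inner_add_right, s1, s2, s3, i23, i13, i21, i32, i31, ← ht]; ring
  have t2 : 0 < 3 + 6 * t := by rw [← hsq]; exact real_inner_self_pos.2 hne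
  set N := sqrt (3 + 6 * t) with hN
  have hNp : 0 < N := sqrt_pos.2 t2
  have hN2 : N ^ 2 = 3 + 6 * t := sq_sqrt t2.le
  have hN3 : N / 3 < 1 := by nlinarith
  obtain ⟨R, hR0, hR1, hcR⟩ : ∃ R, 0 < R ∧ R < π / 2 ∧ cos R = N / 3 := by
    refine ⟨arccos (N / 3), arccos_pos.2 hN3, arccos_lt_pi_div_two.2 (by positivity), ?_⟩
    exact cos_arccos (by linarith) hN3.le
  have sR : 0 < sin R := sin_pos_of_pos_of_lt_pi hR0 (by linarith)
  have cRp : 0 < cos R := by rw [hcR]; positivity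
  have sc := sin_sq_add_cos_sq R
  set o : E 2 := N⁻¹ • (v₁ + v₂ + v₃) with ho
  have oo : ⟪o, o⟫ = 1 := by
    rw [ho, real_inner_smul_left, real_inner_smul_right, hsq, ← hN2]; field_simp
  have on : ‖o‖ = 1 := norm_one_of_sq oo
  have hN4 : N⁻¹ * (1 + 2 * t) = cos R := by rw [hcR]; field_simp; linarith
  have ov1 : ⟪o, v₁⟫ = cos R := by
    rw [ho, real_inner_smul_left, inner_add_left, inner_add_left, s1, i21, i31, ← hN4]; ring
  have ov2 : ⟪o, v₂⟫ = cos R := by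
    rw [ho, real_inner_smul_left, inner_add_left, inner_add_left, s2, i32, ← hN4, ← ht]; ring
  have ov3 : ⟪o, v₃⟫ = cos R := by
    rw [ho, real_inner_smul_left, inner_add_left, inner_add_left, s3, i13, i23, ← hN4]; ring
  have prop : ∀ v : E 2, ⟪v, v⟫ = 1 → ⟪o, v⟫ = cos R →
      ‖(sin R)⁻¹ • (cos R • o - v)‖ = 1 ∧ ⟪o, (sin R)⁻¹ • (cos R • o - v)⟫ = 0 ∧
      cos R • o - sin R • ((sin R)⁻¹ • (cos R • o - v)) = v := by
    intro v hv hov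
    have hvo : ⟪v, o⟫ = cos R := by rw [real_inner_comm, hov]
    refine ⟨?_, ?_, ?_⟩
    · apply norm_one_of_sq
      simp only [inner_sub_left, inner_sub_right, real_inner_smul_left, real_inner_smul_right,
        oo, hov, hvo, hv]
      have : cos R * (cos R * 1) - cos R * cos R - (cos R * cos R - 1) = sin R ^ 2 := by linarith
      field_simp
      linarith
    · simp only [inner_sub_right, real_inner_smul_right, oo, hov]; ring
    · rw [smul_inv_smul₀ sR.ne', sub_sub_cancel]
  obtain ⟨f1, g1, k1⟩ := prop v₁ s1 ov1
  obtain ⟨f2, g2, k2⟩ := prop v₂ s2 ov2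
  obtain ⟨f3, g3, k3⟩ := prop v₃ s3 ov3
  set e : Fin 3 → E 2 := ![(sin R)⁻¹ • (cos R • o - v₁), (sin R)⁻¹ • (cos R • o - v₂),
    (sin R)⁻¹ • (cos R • o - v₃)] with he
  set r := arctan (tan R / 2) with hr
  have tp : 0 < tan R := tan_pos_of_pos_of_lt_pi_div_two hR0 hR1
  have hr1 : r < π / 2 := arctan_lt_pi_div_two _
  have hr0 : 0 < r := arctan_pos.2 (by positivity)
  have hrel : 2 * (sin r * cos R) = cos r * sin R := by
    have cr : 0 < cos r := cos_arctan_pos _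
    have h : tan r = tan R / 2 := tan_arctan _
    rw [tan_eq_sin_div_cos, tan_eq_sin_div_cos] at h
    field_simp at h
    linarith
  have H : Reg o e r R := by
    refine ⟨on, ?_, ?_, ?_, hr0, hr1, hR0, hR1, hrel⟩
    · intro i; fin_cases i <;> simpa [he]
    · intro i; fin_cases i <;> simpa [he]
    · have h3 : (3 * cos R) • o = v₁ + v₂ + v₃ := by
        rw [hcR, ho, smul_smul]
        have : 3 * (N / 3) * N⁻¹ = 1 := by field_simp
        rw [this, one_smul]
      have : e 0 + e 1 + e 2 = (sin R)⁻¹ • ((3 * cos R) • o - (v₁ + v₂ + v₃)) := by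
        simp only [he, Matrix.cons_val_zero, Matrix.cons_val_one, Matrix.cons_val]
        module
      rw [this, h3, sub_self, smul_zero]
  refine ⟨o, e, r, R, H, ?_⟩
  rw [← H.tri_eq]
  have a1 : vv o e R 0 = v₁ := k1
  have a2 : vv o e R 1 = v₂ := k2
  have a3 : vv o e R 2 = v₃ := k3
  rw [a1, a2, a3]

end Pal

namespace Pal

lemma algA' {g a1 a2 b1 b2 : ℝ} (g0 : 0 ≤ g) (g1 : g ≤ 1) (ha1 : 0 ≤ a1) (ha2 : 0 ≤ a2)
    (hb1 : 0 ≤ b1) (hb2 : 0 ≤ b2) (hU : a1^2 + a2^2 - 2*g*a1*a2 = 1)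
    (hV : b1^2 + b2^2 - 2*g*b1*b2 = 1) (hwl : a2*b1 ≤ a1*b2) :
    g*(a1*b2+a2*b1) - a1*b1 - a2*b2 ≤ g := by
  by_contra hcon
  push Not at hcon
  have p : 0 ≤ a2*b1 := by positivity
  have q : 0 ≤ a1*b1 + a2*b2 := by positivity
  have h1 : 2*(a2*b1) ≤ a1*b1 + a2*b2 := by
    apply le_of_sq_le_sq _ q
    nlinarith [sq_nonneg (a1*b1 - a2*b2), mul_le_mul_of_nonneg_left hwl p]
  have h2 : g*(a1*b2+a2*b1) - a1*b1 - a2*b2 ≤ g*(a1*b2 - a2*b1) := by nlinarith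
  have hL : (g*(a1*b2+a2*b1) - a1*b1 - a2*b2)^2 + (1-g^2)*(a1*b2 - a2*b1)^2 = 1 := by
    have : (a1^2 + a2^2 - 2*g*a1*a2) * (b1^2 + b2^2 - 2*g*b1*b2) = 1 := by rw [hU, hV]; ring
    linarith
  set Q := g*(a1*b2+a2*b1) - a1*b1 - a2*b2
  set P := a1*b2 - a2*b1
  have P0 : 0 ≤ P := by simp only [P]; linarith
  have h3 : Q^2 ≤ (g*P)^2 := pow_le_pow_left₀ (by linarith) h2 2
  have h4 : g^2 < Q^2 := by nlinarith
  have hg : g^2 ≤ 1 := by nlinarith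
  nlinarith
where
  le_of_sq_le_sq {x y : ℝ} (h : x^2 ≤ y^2) (hy : 0 ≤ y) : x ≤ y := by
    nlinarith [sq_nonneg (x+y), sq_nonneg (x - y)]

lemma algA {g a1 a2 b1 b2 : ℝ} (g0 : 0 ≤ g) (g1 : g ≤ 1) (ha1 : 0 ≤ a1) (ha2 : 0 ≤ a2)
    (hb1 : 0 ≤ b1) (hb2 : 0 ≤ b2) (hU : a1^2 + a2^2 - 2*g*a1*a2 = 1)
    (hV : b1^2 + b2^2 - 2*g*b1*b2 = 1) :
    g*(a1*b2+a2*b1) - a1*b1 - a2*b2 ≤ g := by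
  rcases le_total (a2*b1) (a1*b2) with h | h
  · exact algA' g0 g1 ha1 ha2 hb1 hb2 hU hV h
  · have := algA' (a1 := a2) (a2 := a1) (b1 := b2) (b2 := b1) g0 g1 ha2 ha1 hb2 hb1
      (by linarith) (by linarith) (by linarith)
    linarith

lemma algB1 {g k a1 a2 b2 b3 : ℝ} (g0 : 0 ≤ g) (g1 : g ≤ 1/2) (k0 : 0 ≤ k)
    (hk : k^2*(1-g) = 2*g^2) (ha1 : 0 ≤ a1) (ha2 : 0 ≤ a2)
    (hU : a1^2 + a2^2 - 2*g*a1*a2 = 1)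
    (hV : b2^2 + b3^2 - 2*g*b2*b3 = 1) (h : a2 ≤ 2*g*a1) :
    g*(a1*b2+a1*b3+a2*b3) - a2*b2 ≤ k := by
  have g1' : 0 < 1 - g := by linarith
  obtain ⟨m, hm1⟩ : ∃ m, m*(1-g) = g := ⟨g/(1-g), by field_simp⟩
  have hk2 : k^2 = 2*m^2*(1-g) := by
    apply mul_right_cancel₀ g1'.ne'
    linear_combination hk - 2*(m*(1-g)+g)*hm1
  have hk3 : k^2 ≤ 1 := by
    by_contra hc; push Not at hc
    nlinarith
  set x := a2 - m*a1 with hx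
  set y := -(m*a1) with hy
  have e1 : g*(a1*b2+a1*b3+a2*b3) - a2*b2 = -(x*b2+y*b3-g*(x*b3+y*b2)) := by
    rw [hx, hy]
    linear_combination -(a1*(b2+b3))*hm1
  have e2 : x^2+y^2-2*g*x*y ≤ k^2 := by
    have : x^2+y^2-2*g*x*y = a2^2 - 2*g*a1*a2 + a1^2*k^2 := by
      rw [hk2, hx, hy]
      linear_combination (-2*a1*a2) * hm1
    rw [this]
    have e3 : k^2 = k^2*(a1^2 + a2^2 - 2*g*a1*a2) := by rw [hU, mul_one]
    have e4 : 0 ≤ (1-k^2)*(a2*(2*g*a1-a2)) :=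
      mul_nonneg (by linarith) (mul_nonneg ha2 (by linarith))
    linarith
  have e5 : (x*b2+y*b3-g*(x*b3+y*b2))^2 + (1-g^2)*(x*b3-y*b2)^2 = x^2+y^2-2*g*x*y := by
    have : (x^2+y^2-2*g*x*y)*(b2^2 + b3^2 - 2*g*b2*b3) = x^2+y^2-2*g*x*y := by rw [hV, mul_one]
    linarith
  rw [e1]
  have e6 : (-(x*b2+y*b3-g*(x*b3+y*b2)))^2 ≤ k^2 := by
    have : 0 ≤ (1-g^2)*(x*b3-y*b2)^2 := mul_nonneg (by nlinarith) (sq_nonneg _)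
    linarith
  exact algA'.le_of_sq_le_sq e6 k0

lemma algk {g k : ℝ} (g0 : 0 ≤ g) (g1 : g ≤ 1/2) (k0 : 0 ≤ k) (hk : k^2*(1-g) = 2*g^2) :
    g ≤ k := by
  apply algA'.le_of_sq_le_sq _ k0
  nlinarith [mul_nonneg (sq_nonneg k) g0]

lemma algB {g k a1 a2 b2 b3 : ℝ} (g0 : 0 ≤ g) (g1 : g ≤ 1/2) (k0 : 0 ≤ k)
    (hk : k^2*(1-g) = 2*g^2) (ha1 : 0 ≤ a1) (ha2 : 0 ≤ a2) (hb2 : 0 ≤ b2) (hb3 : 0 ≤ b3)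
    (hU : a1^2 + a2^2 - 2*g*a1*a2 = 1)
    (hV : b2^2 + b3^2 - 2*g*b2*b3 = 1) :
    g*(a1*b2+a1*b3+a2*b3) - a2*b2 ≤ k := by
  rcases le_total a2 (2*g*a1) with h | h
  · exact algB1 g0 g1 k0 hk ha1 ha2 hU hV h
  rcases le_total b2 (2*g*b3) with h' | h'
  · have := algB1 (a1 := b3) (a2 := b2) (b2 := a2) (b3 := a1) g0 g1 k0 hk hb3 hb2
      (by linarith) (by linarith) h'
    linarith
  have h1 : a1^2 ≤ 1 := by nlinarith
  have h2 : b3^2 ≤ 1 := by nlinarith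
  have h3 : a1 ≤ 1 := by nlinarith
  have h4 : b3 ≤ 1 := by nlinarith
  have h5 : a1*b3 ≤ 1 := by nlinarith
  have h6 : g*(a1*b3) ≤ g := by nlinarith
  have h7 := mul_le_mul_of_nonneg_right h hb2
  have h8 := mul_le_mul_of_nonneg_left h' ha2
  have := algk g0 g1 k0 hk
  linarith

lemma algC {g k a0 a1 a2 b0 b1 b2 : ℝ} (g0 : 0 ≤ g) (g1 : g ≤ 1/2) (k0 : 0 ≤ k)
    (hk : k^2*(1-g) = 2*g^2) (ha0 : 0 ≤ a0) (ha1 : 0 ≤ a1) (ha2 : 0 ≤ a2)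
    (hb0 : 0 ≤ b0) (hb1 : 0 ≤ b1) (hb2 : 0 ≤ b2)
    (hU : a0^2 + a1^2 + a2^2 - 2*g*(a0*a1+a0*a2+a1*a2) = 1)
    (hV : b0^2 + b1^2 + b2^2 - 2*g*(b0*b1+b0*b2+b1*b2) = 1)
    (ha : a0 = 0 ∨ a1 = 0 ∨ a2 = 0) (hb : b0 = 0 ∨ b1 = 0 ∨ b2 = 0) :
    g*(a0*b1+a0*b2+a1*b0+a1*b2+a2*b0+a2*b1) - a0*b0 - a1*b1 - a2*b2 ≤ k := by
  have hgk := algk g0 g1 k0 hk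
  have g1' : g ≤ 1 := by linarith
  rcases ha with rfl | rfl | rfl <;> rcases hb with rfl | rfl | rfl
  · linarith [algA g0 g1' ha1 ha2 hb1 hb2 (by linarith) (by linarith)]
  · linarith [algB g0 g1 k0 hk ha1 ha2 hb2 hb0 (by linarith) (by linarith)]
  · linarith [algB g0 g1 k0 hk ha2 ha1 hb1 hb0 (by linarith) (by linarith)]
  · linarith [algB g0 g1 k0 hk ha0 ha2 hb2 hb1 (by linarith) (by linarith)]
  · linarith [algA g0 g1' ha0 ha2 hb0 hb2 (by linarith) (by linarith)]
  · linarith [algB g0 g1 k0 hk ha2 ha0 hb0 hb1 (by linarith) (by linarith)]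
  · linarith [algB g0 g1 k0 hk ha0 ha1 hb1 hb2 (by linarith) (by linarith)]
  · linarith [algB g0 g1 k0 hk ha1 ha0 hb0 hb2 (by linarith) (by linarith)]
  · linarith [algA g0 g1' ha0 ha1 hb0 hb1 (by linarith) (by linarith)]

lemma algN {g a0 a1 a2 b0 b1 b2 : ℝ} (g0 : g ≤ 0) (g1 : -1 ≤ g)
    (ha0 : 0 ≤ a0) (ha1 : 0 ≤ a1) (ha2 : 0 ≤ a2)
    (hb0 : 0 ≤ b0) (hb1 : 0 ≤ b1) (hb2 : 0 ≤ b2)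
    (hU : a0^2 + a1^2 + a2^2 - 2*g*(a0*a1+a0*a2+a1*a2) = 1)
    (hV : b0^2 + b1^2 + b2^2 - 2*g*(b0*b1+b0*b2+b1*b2) = 1) :
    g*(a0*b1+a0*b2+a1*b0+a1*b2+a2*b0+a2*b1) - a0*b0 - a1*b1 - a2*b2 ≤ g := by
  have g1' : 0 ≤ 1 + g := by linarith
  have hA : 1 ≤ a0+a1+a2 := by
    have := mul_nonneg g1' (by positivity : 0 ≤ a0*a1+a0*a2+a1*a2)
    nlinarith
  have hB : 1 ≤ b0+b1+b2 := by
    have := mul_nonneg g1' (by positivity : 0 ≤ b0*b1+b0*b2+b1*b2)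
    nlinarith
  have hAB : 1 ≤ (a0+a1+a2)*(b0+b1+b2) := by nlinarith
  have := mul_nonneg g1' (by positivity : 0 ≤ a0*b0+a1*b1+a2*b2)
  have := mul_nonneg (neg_nonneg.2 g0) (sub_nonneg.2 hAB)
  nlinarith

variable {o : E 2} {e : Fin 3 → E 2} {r R : ℝ}

lemma Reg.coef (H : Reg o e r R) {u : E 2} (hT : ∀ x ∈ tri o e r, ⟪x, u⟫ ≤ 0)
    (hc : ∃ x ∈ tri o e r, ⟪x, u⟫ = 0) : ∃ a0 a1 a2 : ℝ, 0 ≤ a0 ∧ 0 ≤ a1 ∧ 0 ≤ a2 ∧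
    (a0 = 0 ∨ a1 = 0 ∨ a2 = 0) ∧ u = a0 • uu o e r 0 + a1 • uu o e r 1 + a2 • uu o e r 2 := by
  have h5 := H.pos.2.2.2.2.1
  have i5 : 0 ≤ (sin (R + r))⁻¹ := by positivity
  have hv : ∀ i, 0 ≤ -⟪u, vv o e R i⟫ := fun i => by
    rw [real_inner_comm, neg_nonneg]; exact hT _ (H.vmem i)
  have hr := congrArg (fun y => (sin (R + r))⁻¹ • y) (H.repu u)
  simp only [smul_smul, smul_add] at hr
  rw [inv_mul_cancel₀ h5.ne', one_smul] at hr
  refine ⟨_, _, _, mul_nonneg i5 (hv 0), mul_nonneg i5 (hv 1), mul_nonneg i5 (hv 2), ?_, hr⟩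
  obtain ⟨x, hx, hxu⟩ := hc
  have h := congrArg (fun y => ⟪y, u⟫) (H.repv x)
  simp only [inner_add_left, real_inner_smul_left, hxu, mul_zero] at h
  have q : ∀ i, 0 ≤ -⟪x, uu o e r i⟫ := fun i => neg_nonneg.2 (hx.2 i)
  have p : ∀ i, ⟪vv o e R i, u⟫ ≤ 0 := fun i => hT _ (H.vmem i)
  have s : ∀ i, -⟪x, uu o e r i⟫ * ⟪vv o e R i, u⟫ ≤ 0 := fun i =>
    mul_nonpos_of_nonneg_of_nonpos (q i) (p i)
  have s0 := s 0
  have s1 := s 1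
  have s2 := s 2
  have t0 : -⟪x, uu o e r 0⟫ * ⟪vv o e R 0, u⟫ = 0 := by linarith
  have t1 : -⟪x, uu o e r 1⟫ * ⟪vv o e R 1, u⟫ = 0 := by linarith
  have t2 : -⟪x, uu o e r 2⟫ * ⟪vv o e R 2, u⟫ = 0 := by linarith
  rcases mul_eq_zero.1 t0 with z0 | z0
  swap
  · left; rw [real_inner_comm, z0]; simp
  rcases mul_eq_zero.1 t1 with z1 | z1
  swap
  · right; left; rw [real_inner_comm, z1]; simp
  rcases mul_eq_zero.1 t2 with z2 | z2
  swap
  · right; right; rw [real_inner_comm, z2]; simp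
  exfalso
  have hr := H.repv x
  rw [z0, z1, z2] at hr
  simp only [zero_smul, add_zero] at hr
  rcases smul_eq_zero.1 hr with h | h
  · linarith
  · have := hx.1; rw [h] at this; simp at this

lemma Reg.gram (H : Reg o e r R) {γ : ℝ} (hγ : γ = 3/2 * cos r ^ 2 - 1) (a0 a1 a2 b0 b1 b2 : ℝ) :
    ⟪a0 • uu o e r 0 + a1 • uu o e r 1 + a2 • uu o e r 2,
      b0 • uu o e r 0 + b1 • uu o e r 1 + b2 • uu o e r 2⟫ =
    -(γ*(a0*b1+a0*b2+a1*b0+a1*b2+a2*b0+a2*b1) - a0*b0 - a1*b1 - a2*b2) := by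
  simp only [inner_add_left, inner_add_right, real_inner_smul_left, real_inner_smul_right,
    sq_of_norm_one (H.un _)]
  rw [H.uu_ne (by decide : (0:Fin 3) ≠ 1), H.uu_ne (by decide : (0:Fin 3) ≠ 2),
    H.uu_ne (by decide : (1:Fin 3) ≠ 0), H.uu_ne (by decide : (1:Fin 3) ≠ 2),
    H.uu_ne (by decide : (2:Fin 3) ≠ 0), H.uu_ne (by decide : (2:Fin 3) ≠ 1), ← hγ]
  ring

/-- the extremal supporting lune -/
lemma Reg.lune (H : Reg o e r R) : ∃ u v, IsSupportingLune (tri o e r) u v ∧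
    arccos (-⟪u, v⟫) = R + r := by
  obtain ⟨p1, p2, p3, p4, p5, p6⟩ := H.pos
  have ho := sq_of_norm_one H.on
  set m : E 2 := -(sin R • o + cos R • e 0) with hm
  have hmn : ‖m‖ = 1 := by
    apply norm_one_of_sq
    rw [hm]
    simp only [inner_neg_left, inner_neg_right, inner_add_left, inner_add_right,
      real_inner_smul_left, real_inner_smul_right, H.oe, H.eo, H.ee.1, ho]
    linear_combination sin_sq_add_cos_sq R
  have hum : ⟪uu o e r 0, m⟫ = -cos (R + r) := by
    rw [hm, cos_add]; unfold uu
    simp only [inner_neg_right, inner_add_right, inner_sub_left,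
      real_inner_smul_left, real_inner_smul_right, H.oe, H.eo, H.ee.1, ho]
    ring
  have hlt : R + r < π := by linarith [H.R1, H.r1]
  have hgt : 0 < R + r := by linarith [H.R0, H.r0]
  have c1 : cos (R + r) < 1 := by
    rw [← cos_zero]; exact cos_lt_cos_of_nonneg_of_le_pi le_rfl hlt.le hgt
  have c2 : -1 < cos (R + r) := by
    rw [← cos_pi]; exact cos_lt_cos_of_nonneg_of_le_pi hgt.le le_rfl hlt
  have hmu : ∀ x, cos r * ⟪x, m⟫ = cos R * (⟪x, uu o e r 1⟫ + ⟪x, uu o e r 2⟫) := by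
    intro x
    have he0 : e 0 = -(e 1 + e 2) := by rw [eq_neg_iff_add_eq_zero, ← H.es]; abel
    rw [hm, he0]; unfold uu
    simp only [inner_neg_right, inner_add_right, inner_sub_right, real_inner_smul_right]
    linear_combination ⟪x, o⟫ * H.rel
  have hmneg : ∀ x ∈ tri o e r, ⟪x, m⟫ ≤ 0 := by
    intro x hx
    have := hmu x
    have := hx.2 1
    have := hx.2 2
    by_contra hc
    push Not at hc
    nlinarith [mul_pos p2 hc]
  have hv0m : ⟪vv o e R 0, m⟫ = 0 := by
    have := hmu (vv o e R 0)
    rw [H.vu (by decide), H.vu (by decide)] at this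
    simpa [p2.ne'] using this
  refine ⟨uu o e r 0, m, ⟨mem_unit.2 (H.un 0), mem_unit.2 hmn, ?_, ?_, ?_, ?_, ?_⟩, ?_⟩
  · intro h
    rw [h, sq_of_norm_one hmn] at hum; linarith
  · intro h
    rw [h, inner_neg_left, sq_of_norm_one hmn] at hum; linarith
  · intro x hx
    exact ⟨mem_unit.2 hx.1, hx.2 0, hmneg x hx⟩
  · exact ⟨vv o e R 1, H.vmem 1, mem_unit.2 (H.vn 1), H.vu (by decide), hmneg _ (H.vmem 1)⟩
  · exact ⟨vv o e R 0, H.vmem 0, mem_unit.2 (H.vn 0), hv0m, (H.vmem 0).2 0⟩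
  · rw [hum, neg_neg, arccos_cos hgt.le hlt.le]

lemma Reg.le_width (H : Reg o e r R) {t : ℝ}
    (h : ∀ u v, IsSupportingLune (tri o e r) u v → t ≤ arccos (-⟪u, v⟫)) :
    t ≤ width (tri o e r) := by
  apply le_csInf
  · obtain ⟨u, v, h, -⟩ := H.lune
    exact ⟨_, u, v, h, rfl⟩
  · rintro b ⟨u, v, huv, rfl⟩
    rw [breadth_eq (mem_unit.1 huv.1) (mem_unit.1 huv.2.1) huv.2.2.1 huv.2.2.2.1]
    exact h u v huv

lemma Reg.width_le (H : Reg o e r R) : width (tri o e r) ≤ R + r := by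
  obtain ⟨u, v, h, h2⟩ := H.lune
  rw [← h2]; exact Pal.width_le h

lemma Reg.lune_coef (H : Reg o e r R) {γ : ℝ} (hγ : γ = 3/2 * cos r ^ 2 - 1) {u v : E 2}
    (h : IsSupportingLune (tri o e r) u v) :
    ∃ a0 a1 a2 b0 b1 b2 : ℝ, 0 ≤ a0 ∧ 0 ≤ a1 ∧ 0 ≤ a2 ∧ 0 ≤ b0 ∧ 0 ≤ b1 ∧ 0 ≤ b2 ∧
    (a0 = 0 ∨ a1 = 0 ∨ a2 = 0) ∧ (b0 = 0 ∨ b1 = 0 ∨ b2 = 0) ∧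
    a0^2 + a1^2 + a2^2 - 2*γ*(a0*a1+a0*a2+a1*a2) = 1 ∧
    b0^2 + b1^2 + b2^2 - 2*γ*(b0*b1+b0*b2+b1*b2) = 1 ∧
    -⟪u, v⟫ = γ*(a0*b1+a0*b2+a1*b0+a1*b2+a2*b0+a2*b1) - a0*b0 - a1*b1 - a2*b2 := by
  obtain ⟨hu, hv, -, -, hsub, ⟨x, hx, hx2⟩, ⟨y, hy, hy2⟩⟩ := h
  obtain ⟨a0, a1, a2, p0, p1, p2, pz, hua⟩ := H.coef (u := u) (fun x hx => (hsub hx).2.1)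
    ⟨x, hx, hx2.2.1⟩
  obtain ⟨b0, b1, b2, q0, q1, q2, qz, hvb⟩ := H.coef (u := v) (fun x hx => (hsub hx).2.2)
    ⟨y, hy, hy2.2.1⟩
  have hu1 := sq_of_norm_one (mem_unit.1 hu)
  have hv1 := sq_of_norm_one (mem_unit.1 hv)
  rw [hua, H.gram hγ] at hu1
  rw [hvb, H.gram hγ] at hv1
  refine ⟨a0, a1, a2, b0, b1, b2, p0, p1, p2, q0, q1, q2, pz, qz, by linarith, by linarith, ?_⟩
  rw [hua, hvb, H.gram hγ, neg_neg]

lemma Reg.cosw (H : Reg o e r R) {γ : ℝ} (hγ : γ = 3/2 * cos r ^ 2 - 1) :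
    cos r * cos (R + r) = 2 * γ * cos R ∧ cos (R + r) ^ 2 * (1 - γ) = 2 * γ ^ 2 ∧
    γ ≤ 1 / 2 ∧ -1 ≤ γ := by
  obtain ⟨p1, p2, p3, p4, p5, p6⟩ := H.pos
  have rel := H.rel
  have s1 := sin_sq_add_cos_sq r
  have s2 := sin_sq_add_cos_sq R
  have h1 : cos r * cos (R + r) = 2 * γ * cos R := by
    rw [cos_add, hγ]
    linear_combination sin r * rel - 2 * cos R * s1
  refine ⟨h1, ?_, by nlinarith, by nlinarith⟩
  have h2 : cos R ^ 2 * (4 - 3 * cos r ^ 2) = cos r ^ 2 := by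
    have h : (2 * (sin r * cos R)) ^ 2 = (cos r * sin R) ^ 2 := by rw [rel]
    have e1 : sin r ^ 2 = 1 - cos r ^ 2 := by linarith
    have e2 : sin R ^ 2 = 1 - cos R ^ 2 := by linarith
    rw [mul_pow, mul_pow, mul_pow, e1, e2] at h
    linarith
  have h3 : cos r ^ 2 ≠ 0 := by positivity
  apply mul_left_cancel₀ h3
  have h4 : (cos r * cos (R + r)) ^ 2 = (2 * γ * cos R) ^ 2 := by rw [h1]
  have h5 : 4 - 3 * cos r ^ 2 = 2 * (1 - γ) := by rw [hγ]; ring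
  rw [h5] at h2
  linear_combination (1 - γ) * h4 + 2 * γ ^ 2 * h2

lemma Reg.width_eq (H : Reg o e r R) (hw : R + r ≤ π / 2) : width (tri o e r) = R + r := by
  apply le_antisymm H.width_le
  apply H.le_width
  intro u v h
  set γ := 3/2 * cos r ^ 2 - 1 with hγ
  obtain ⟨c1, c2, c3, c4⟩ := H.cosw hγ
  obtain ⟨p1, p2, p3, p4, p5, p6⟩ := H.pos
  obtain ⟨a0, a1, a2, b0, b1, b2, q0, q1, q2, q3, q4, q5, pz, qz, hU, hV, huv⟩ := H.lune_coef hγ h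
  have hk : 0 ≤ cos (R + r) := cos_nonneg_of_mem_Icc ⟨by linarith [H.r0, H.R0], hw⟩
  have hγ0 : 0 ≤ γ := by
    by_contra hc; push Not at hc
    nlinarith [mul_nonneg p2.le hk]
  have := algC hγ0 c3 hk c2 q0 q1 q2 q3 q4 q5 hU hV pz qz
  rw [← huv] at this
  have h2 := arccos_le_arccos this
  rwa [arccos_cos (by linarith [H.r0, H.R0]) (by linarith [pi_pos])] at h2

lemma Reg.width_obtuse (H : Reg o e r R) (hw : π / 2 < R + r) : π / 2 < width (tri o e r) := by
  set γ := 3/2 * cos r ^ 2 - 1 with hγ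
  obtain ⟨c1, c2, c3, c4⟩ := H.cosw hγ
  obtain ⟨p1, p2, p3, p4, p5, p6⟩ := H.pos
  have hk : cos (R + r) < 0 := cos_neg_of_pi_div_two_lt_of_lt hw
    (by linarith [H.r1, H.R1, pi_pos])
  have hγ0 : γ < 0 := by
    by_contra hc; push Not at hc
    nlinarith [mul_pos p2 (neg_pos.2 hk), mul_nonneg hc p4.le]
  have hlt : π / 2 < arccos γ := by
    rw [← not_le, arccos_le_pi_div_two]; linarith
  apply lt_of_lt_of_le hlt
  apply H.le_width
  intro u v h
  obtain ⟨a0, a1, a2, b0, b1, b2, q0, q1, q2, q3, q4, q5, pz, qz, hU, hV, huv⟩ := H.lune_coef hγ h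
  have := algN hγ0.le c4 q0 q1 q2 q3 q4 q5 hU hV
  rw [← huv] at this
  exact arccos_le_arccos this

lemma Reg.params (H : Reg o e r R) {w : ℝ} (hw0 : 0 < w) (hw : w ≤ π / 2)
    (h : width (tri o e r) = w) : R + r = w ∧ r = rr w (π / 3) := by
  have h1 : R + r ≤ π / 2 := by
    by_contra hc; push Not at hc
    linarith [H.width_obtuse hc]
  have h2 : R + r = w := by rw [← H.width_eq h1, h]
  refine ⟨h2, ?_⟩
  obtain ⟨p1, p2, p3, p4, p5, p6⟩ := H.pos
  have hR : w - r = R := by linarith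
  have hle : r ≤ R := by
    by_contra hc; push Not at hc
    have : sin (R - r) < 0 := by
      apply sin_neg_of_neg_of_neg_pi_lt <;> linarith [H.R0, H.r1]
    rw [sin_sub] at this
    nlinarith [H.rel, mul_pos p1 p4]
  apply eq_rr hw0 hw (by positivity) le_rfl H.r0 (by linarith)
  rw [hR, cos_pi_div_three]; linarith [H.rel]

lemma Reg.area (H : Reg o e r R) {w : ℝ} (hr : r = rr w (π / 3)) :
    area (tri o e r) = M * FF w (π / 3) := by
  rw [area_eq (fun x hx => mem_unit.2 hx.1)]
  have h1 : sm.real (tri o e r) = sm.real {x : E 2 | 0 ≤ ⟪x, -uu o e r 0⟫ ∧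
      0 ≤ ⟪x, -uu o e r 1⟫ ∧ 0 ≤ ⟪x, -uu o e r 2⟫} := by
    apply le_antisymm <;> apply sm_real_mono_sphere
    · intro x hx _
      simp only [Set.mem_ofPred_eq, inner_neg_right, neg_nonneg]
      exact ⟨hx.2 0, hx.2 1, hx.2 2⟩
    · intro x hx hx1
      simp only [Set.mem_ofPred_eq, inner_neg_right, neg_nonneg] at hx
      refine ⟨hx1, fun i => ?_⟩
      fin_cases i
      · exact hx.1
      · exact hx.2.1
      · exact hx.2.2
  rw [h1, tri_area (by rw [norm_neg, H.un]) (by rw [norm_neg, H.un]) (by rw [norm_neg, H.un])]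
  simp only [inner_neg_left, inner_neg_right, neg_neg]
  rw [H.uu_ne (by decide), H.uu_ne (by decide), H.uu_ne (by decide), arccos_neg]
  unfold FF
  rw [← hr, sin_pi_div_three]
  obtain ⟨p1, p2, p3, p4, p5, p6⟩ := H.pos
  have c1 := cos_le_one r
  have s3 : sqrt 3 ^ 2 = 3 := sq_sqrt (by norm_num)
  have s30 : 0 ≤ sqrt 3 := sqrt_nonneg _
  have b1 : cos r * (sqrt 3 / 2) ≤ 1 := by nlinarith
  have b0 : 0 ≤ cos r * (sqrt 3 / 2) := by positivity
  set β := arccos (cos r * (sqrt 3 / 2)) with hβ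
  have : arccos (3/2 * cos r ^ 2 - 1) = 2 * β := by
    have hc : cos β = cos r * (sqrt 3 / 2) := cos_arccos (by linarith) b1
    have : 3/2 * cos r ^ 2 - 1 = cos (2 * β) := by
      rw [cos_two_mul, hc, mul_pow, div_pow, s3]; ring
    rw [this, arccos_cos (by linarith [arccos_nonneg (cos r * (sqrt 3 / 2))])]
    have := arccos_le_pi_div_two.2 b0
    linarith
  rw [this]; ring

end Pal

namespace Pal

lemma gdist_le_norm {x y : E 2} (hx : ‖x‖ = 1) (hy : ‖y‖ = 1) : gdist x y ≤ 2 * ‖x - y‖ := by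
  have hb := abs_real_inner_le_norm x y
  rw [hx, hy, one_mul] at hb
  obtain ⟨b1, b2⟩ := abs_le.1 hb
  unfold gdist
  set θ := arccos ⟪x, y⟫ with hθ
  have h0 : 0 ≤ θ := arccos_nonneg _
  have h1 : θ ≤ π := arccos_le_pi _
  have hc : cos θ = ⟪x, y⟫ := cos_arccos b1 b2
  have hn : ‖x - y‖ ^ 2 = 2 - 2 * cos θ := by
    rw [norm_sub_sq_real, hx, hy, hc]; ring
  have hh : cos θ = 1 - 2 * sin (θ / 2) ^ 2 := by
    have := cos_two_mul (θ / 2)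
    rw [mul_div_cancel₀ _ (two_ne_zero)] at this
    have := sin_sq_add_cos_sq (θ / 2)
    linarith
  have hs : 2 / π * (θ / 2) ≤ sin (θ / 2) := mul_le_sin (by linarith) (by linarith)
  have hs2 : θ / 4 ≤ sin (θ / 2) := by
    refine le_trans ?_ hs
    rw [show 2 / π * (θ / 2) = θ / π by field_simp]
    exact div_le_div_of_nonneg_left h0 pi_pos pi_le_four
  have hnn := norm_nonneg (x - y)
  by_contra hcon
  push Not at hcon
  nlinarith

lemma near {y z : E 2} {ρ : ℝ} (hy : ‖y‖ = 1) (h : ‖z - y‖ ≤ ρ) (hρ : ρ < 1) :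
    z ≠ 0 ∧ ‖‖z‖⁻¹ • z‖ = 1 ∧ gdist y (‖z‖⁻¹ • z) ≤ 4 * ρ := by
  have hz : z ≠ 0 := by
    rintro rfl
    rw [zero_sub, norm_neg, hy] at h; linarith
  have hzn := norm_pos_iff.2 hz
  have h1 : ‖‖z‖⁻¹ • z‖ = 1 := by
    rw [norm_smul, norm_inv, norm_norm, inv_mul_cancel₀ hzn.ne']
  refine ⟨hz, h1, ?_⟩
  have h2 : ‖‖z‖⁻¹ • z - z‖ ≤ ρ := by
    have : ‖z‖⁻¹ • z - z = (‖z‖⁻¹ - 1) • z := by module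
    rw [this, norm_smul, norm_eq_abs, ← abs_norm z, ← abs_mul, sub_mul, abs_norm,
      inv_mul_cancel₀ hzn.ne', one_mul, ← hy, abs_sub_comm]
    exact (abs_norm_sub_norm_le z y).trans h
  have h3 := gdist_le_norm hy h1
  have h4 : ‖y - ‖z‖⁻¹ • z‖ ≤ ‖z - y‖ + ‖‖z‖⁻¹ • z - z‖ := by
    have : y - ‖z‖⁻¹ • z = -(z - y) - (‖z‖⁻¹ • z - z) := by abel
    rw [this]
    refine (norm_sub_le _ _).trans ?_
    rw [norm_neg]
  linarith

lemma sdist_le {x b : E 2} {B : Set (E 2)} (hb : b ∈ B) : sdist x B ≤ gdist x b := by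
  apply csInf_le
  · refine ⟨0, ?_⟩
    rintro _ ⟨y, -, rfl⟩
    exact arccos_nonneg _
  · exact ⟨b, hb, rfl⟩

lemma haus_le {A B : Set (E 2)} {c : ℝ} (hc : 0 ≤ c) (h1 : ∀ x ∈ A, ∃ y ∈ B, gdist x y ≤ c)
    (h2 : ∀ y ∈ B, ∃ x ∈ A, gdist y x ≤ c) : hausdorffG A B ≤ c := by
  apply max_le
  · apply Real.sSup_le _ hc
    rintro _ ⟨x, hx, rfl⟩
    obtain ⟨y, hy, h⟩ := h1 x hx
    exact (sdist_le hy).trans h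
  · apply Real.sSup_le _ hc
    rintro _ ⟨x, hx, rfl⟩
    obtain ⟨y, hy, h⟩ := h2 x hx
    exact (sdist_le hy).trans h

lemma alg_y {x y q η : ℝ} (hy : 0 ≤ y) (hq : 0 ≤ q) (hq2 : q ^ 2 = 3/4) (hxy : x ^ 2 + y ^ 2 = 1)
    (hx : |x + 1/2| ≤ η) : |y - q| ≤ 3 * η := by
  have hq1 : 4/5 ≤ q := by nlinarith
  have hx1 : -1 ≤ x := by nlinarith
  have hx2 : x ≤ 1 := by nlinarith
  have e : (y - q) * (y + q) = (1/2 - x) * (x + 1/2) := by linarith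
  have h : |y - q| * (y + q) = |1/2 - x| * |x + 1/2| := by
    rw [← abs_mul, ← e, abs_mul, abs_of_nonneg (by linarith : 0 ≤ y + q)]
  have h2 : |1/2 - x| ≤ 3/2 := by rw [abs_le]; constructor <;> linarith
  have h3 := abs_nonneg (y - q)
  have h4 := abs_nonneg (x + 1/2)
  nlinarith [mul_le_mul h2 hx h4 (by norm_num : (0:ℝ) ≤ 3/2)]

lemma reg_frame {o : E 2} {e : Fin 3 → E 2} (ho : ‖o‖ = 1) (en : ∀ i, ‖e i‖ = 1)
    (oe : ∀ i, ⟪o, e i⟫ = 0) {η : ℝ} (hη : ‖e 0 + e 1 + e 2‖ ≤ η) (hη1 : η ≤ 1) :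
    ∃ f : Fin 3 → E 2, (∀ i, ‖f i‖ = 1) ∧ (∀ i, ⟪o, f i⟫ = 0) ∧ f 0 + f 1 + f 2 = 0 ∧
      ∀ i, ‖e i - f i‖ ≤ 7 * η := by
  obtain ⟨n, F, hn⟩ : ∃ n, Frame o (e 0) n ∧ 0 ≤ ⟪e 1, n⟫ := by
    obtain ⟨n, F⟩ := exists_Frame ho (en 0) (oe 0)
    rcases le_total 0 ⟪e 1, n⟫ with h | h
    · exact ⟨n, F, h⟩
    · exact ⟨-n, F.neg, by rw [inner_neg_right]; linarith⟩
  have η0 : 0 ≤ η := (norm_nonneg _).trans hη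
  set σ := e 0 + e 1 + e 2 with hσ
  have e10 : ⟪e 1, o⟫ = 0 := by rw [real_inner_comm, oe]
  set x := ⟪e 1, e 0⟫ with hx
  set y := ⟪e 1, n⟫ with hy
  have hrep := F.rep (e 1)
  rw [e10, zero_smul, zero_add] at hrep
  have hsq := F.nsq (e 1)
  rw [sq_of_norm_one (en 1), e10, ← hx, ← hy] at hsq
  have hxb : |x + 1/2| ≤ 3/2 * η := by
    have h1 : ‖e 0 + e 1‖ ^ 2 = ‖σ - e 2‖ ^ 2 := by rw [hσ]; congr 2; abel
    rw [norm_add_sq_real, norm_sub_sq_real, en, en, en, real_inner_comm, ← hx] at h1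
    have h2 : |⟪σ, e 2⟫| ≤ η := by
      have := abs_real_inner_le_norm σ (e 2)
      rw [en, mul_one] at this; exact this.trans hη
    obtain ⟨h3, h4⟩ := abs_le.1 h2
    have h5 := norm_nonneg σ
    have h6 : ‖σ‖ ^ 2 ≤ η := by nlinarith
    have h7 : 0 ≤ ‖σ‖ ^ 2 := by positivity
    rw [abs_le]; constructor <;> linarith
  set q := sqrt 3 / 2 with hq
  have q0 : 0 ≤ q := by positivity
  have q2 : q ^ 2 = 3/4 := by rw [hq, div_pow, sq_sqrt (by norm_num)]; norm_num
  have hyb := alg_y hn q0 q2 (by linarith) hxb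
  have nn : ‖n‖ = 1 := norm_one_of_sq F.gg
  have f1n : ∀ s : ℝ, s ^ 2 = 3/4 → ‖(-(1/2) : ℝ) • e 0 + s • n‖ = 1 := by
    intro s hs
    apply norm_one_of_sq
    simp only [inner_add_left, inner_add_right, real_inner_smul_left, real_inner_smul_right,
      F.ff, F.gg, F.fg, real_inner_comm (e 0) n]
    linarith
  have f1o : ∀ s : ℝ, ⟪o, (-(1/2) : ℝ) • e 0 + s • n⟫ = 0 := by
    intro s
    rw [inner_add_right, real_inner_smul_right, real_inner_smul_right, F.of, F.og]; ring
  have hd1 : ‖e 1 - ((-(1/2) : ℝ) • e 0 + q • n)‖ ≤ 6 * η := by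
    have : e 1 - ((-(1/2) : ℝ) • e 0 + q • n) = (x + 1/2) • e 0 + (y - q) • n := by
      rw [hrep]; module
    rw [this]
    refine (norm_add_le _ _).trans ?_
    rw [norm_smul, norm_smul, en, nn, norm_eq_abs, norm_eq_abs]
    linarith
  refine ⟨![e 0, (-(1/2) : ℝ) • e 0 + q • n, (-(1/2) : ℝ) • e 0 + (-q) • n], ?_, ?_, ?_, ?_⟩
  · intro i
    fin_cases i
    · exact en 0
    · exact f1n q q2
    · exact f1n (-q) (by rw [neg_sq, q2])
  · intro i
    fin_cases i
    · exact oe 0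
    · exact f1o q
    · exact f1o (-q)
  · simp only [Matrix.cons_val_zero, Matrix.cons_val_one, Matrix.cons_val]
    module
  · intro i
    fin_cases i
    · change ‖e 0 - e 0‖ ≤ _
      rw [sub_self, norm_zero]; positivity
    · change ‖e 1 - ((-(1/2) : ℝ) • e 0 + q • n)‖ ≤ _
      linarith
    · change ‖e 2 - ((-(1/2) : ℝ) • e 0 + (-q) • n)‖ ≤ _
      have : e 2 - ((-(1/2) : ℝ) • e 0 + (-q) • n) =
          σ - (e 1 - ((-(1/2) : ℝ) • e 0 + q • n)) := by rw [hσ]; module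
      rw [this]
      refine (norm_sub_le _ _).trans ?_
      linarith

/-- bounds on the weights -/
lemma alg_a {a x d : ℝ} (hx : 1/2 ≤ x) (hxd : x ≤ 1/2 + d) (h : a * (1 + x) ≤ x) :
    a ≤ 1/3 + d/2 := by
  by_contra hc
  push Not at hc
  nlinarith

lemma alg_low {a0 a1 a2 S P0 P1 P2 d : ℝ} (d0 : 0 ≤ d) (d1 : d ≤ 1/9)
    (h0 : |a0 - 1/3| ≤ d) (h1 : |a1 - 1/3| ≤ d) (h2 : |a2 - 1/3| ≤ d)
    (z : a0 * P0 + a1 * P1 + a2 * P2 = 0) (S0 : 0 ≤ S) (S1 : S ≤ 1)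
    (b0 : |P0| ≤ 1) (b1 : |P1| ≤ 1) (u0 : P0 ≤ -S) (u1 : P1 ≤ S/2 + d) (u2 : P2 ≤ S/2 + d) :
    |P0 + S| ≤ 12 * d ∧ |P1 - S/2| ≤ 12 * d := by
  obtain ⟨h01, h02⟩ := abs_le.1 h0
  obtain ⟨h11, h12⟩ := abs_le.1 h1
  obtain ⟨h21, h22⟩ := abs_le.1 h2
  obtain ⟨b01, b02⟩ := abs_le.1 b0
  obtain ⟨b11, b12⟩ := abs_le.1 b1
  have k0 : a0 * P0 ≤ P0/3 + d := by
    have : |(a0 - 1/3) * P0| ≤ d * 1 := by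
      rw [abs_mul]; exact mul_le_mul h0 b0 (abs_nonneg _) d0
    linarith [(abs_le.1 this).2]
  have k1 : a1 * P1 ≤ P1/3 + d := by
    have : |(a1 - 1/3) * P1| ≤ d * 1 := by
      rw [abs_mul]; exact mul_le_mul h1 b1 (abs_nonneg _) d0
    linarith [(abs_le.1 this).2]
  have m1 : a1 * P1 ≤ (1/3 + d) * (S/2 + d) :=
    (mul_le_mul_of_nonneg_left u1 (by linarith)).trans
      (mul_le_mul_of_nonneg_right (by linarith) (by linarith))
  have m2 : a2 * P2 ≤ (1/3 + d) * (S/2 + d) :=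
    (mul_le_mul_of_nonneg_left u2 (by linarith)).trans
      (mul_le_mul_of_nonneg_right (by linarith) (by linarith))
  have m0 : a0 * P0 ≤ -((1/3 - d) * S) := by
    have := mul_le_mul_of_nonneg_left u0 (by linarith : 0 ≤ a0)
    nlinarith
  have hd2 : d * d ≤ d * (1/9) := mul_le_mul_of_nonneg_left d1 d0
  have hdS : d * S ≤ d * 1 := mul_le_mul_of_nonneg_left S1 d0
  have hdS0 : 0 ≤ d * S := mul_nonneg d0 S0
  constructor
  · rw [abs_le]; constructor <;> nlinarith
  · rw [abs_le]; constructor <;> nlinarith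

end Pal

namespace Pal

variable {K : Set (E 2)} {w r : ℝ} {o : E 2} {e p : Fin 3 → E 2} {a : Fin 3 → ℝ}

lemma Core.a_near (H : Core K w o r e a p) (hK : SConvex K) (hw0 : 0 < w) (hw : w ≤ π / 2)
    {x d : ℝ} (hx : 1/2 ≤ x) (hxd : x ≤ 1/2 + d)
    (hrel : sin r * cos (w - r) = cos r * sin (w - r) * x) (i : Fin 3) : |a i - 1/3| ≤ d := by
  obtain ⟨t1, t2, t3, t4, t5, t6, t7, -, t9, t10⟩ := H.trig hw0 hw
  have key : ∀ j, a j ≤ 1/3 + d/2 := by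
    intro j
    have h := H.a_up hK hw0 hw j
    rw [t7, hrel] at h
    apply alg_a hx hxd
    have hp : 0 < cos r * sin (w - r) := mul_pos t2 t3
    by_contra hc
    push Not at hc
    have := mul_lt_mul_of_pos_left hc hp
    nlinarith
  have h0 := key 0
  have h1 := key 1
  have h2 := key 2
  have hs := H.asum3
  rw [abs_le]
  fin_cases i <;> constructor <;> simp <;> linarith

lemma Core.sum_e (H : Core K w o r e a p) {d : ℝ} (h : ∀ i, |a i - 1/3| ≤ d) :
    ‖e 0 + e 1 + e 2‖ ≤ 9 * d := by
  have hz := H.ae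
  rw [Fin.sum_univ_three] at hz
  have : e 0 + e 1 + e 2 = (-3 * (a 0 - 1/3)) • e 0 + (-3 * (a 1 - 1/3)) • e 1
      + (-3 * (a 2 - 1/3)) • e 2 := by
    have : e 0 + e 1 + e 2 = e 0 + e 1 + e 2 - (3:ℝ) • (a 0 • e 0 + a 1 • e 1 + a 2 • e 2) := by
      rw [hz, smul_zero, sub_zero]
    rw [this]; module
  rw [this]
  refine (norm_add₃_le).trans ?_
  have hh : ∀ i, ‖(-3 * (a i - 1/3)) • e i‖ ≤ 3 * d := by
    intro i
    rw [norm_smul, H.en, mul_one, norm_eq_abs, abs_mul]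
    have := h i
    norm_num
    linarith
  linarith [hh 0, hh 1, hh 2]

lemma alg_h {s X C x a h d s0 : ℝ} (hs : s0 / 2 ≤ s) (hs0 : 0 < s0) (X0 : 0 ≤ X) (X1 : X ≤ 1)
    (d0 : 0 ≤ d) (hx1 : x ≤ 1) (hxd : x ≤ 1/2 + d) (hx : 1/2 ≤ x)
    (ha : |a - 1/3| ≤ d) (rel : s * C = X * x) (hl : a * (X * (1 + x)) ≤ s * h) (hu : h ≤ C) :
    |h - C| ≤ 10 * d / s0 := by
  obtain ⟨ha1, ha2⟩ := abs_le.1 ha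
  rw [abs_sub_comm, abs_of_nonneg (by linarith), le_div_iff₀ hs0]
  have b : x - a * (1 + x) ≤ 3 * d := by nlinarith
  have b2 : X * (x - a * (1 + x)) ≤ X * (3 * d) := mul_le_mul_of_nonneg_left b X0
  have b3 : X * (3 * d) ≤ 3 * d := by nlinarith
  have b4 : s * (C - h) ≤ 3 * d := by nlinarith
  nlinarith [mul_le_mul_of_nonneg_right hs (sub_nonneg.2 hu)]

lemma Core.p_near (H : Core K w o r e a p) (hK : SConvex K) (hw0 : 0 < w) (hw : w ≤ π / 2)
    {x d s0 : ℝ} (d0 : 0 ≤ d) (d1 : d ≤ 1/9) (hx : 1/2 ≤ x) (hxd : x ≤ 1/2 + d) (hx1 : x ≤ 1)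
    (hs : s0 / 2 ≤ sin r) (hs0 : 0 < s0)
    (hrel : sin r * cos (w - r) = cos r * sin (w - r) * x) (i : Fin 3) :
    |⟪p i, o⟫ - cos (w - r)| ≤ 10 * d / s0 ∧ |⟪p i, e i⟫ + sin (w - r)| ≤ 12 * d ∧
    ∀ j, j ≠ i → |⟪p i, e j⟫ - sin (w - r) / 2| ≤ 12 * d := by
  have ha := H.a_near hK hw0 hw hx hxd hrel
  obtain ⟨t1, t2, t3, t4, t5, t6, t7, -, t9, t10⟩ := H.trig hw0 hw
  have hu := H.h_up hK hw0 hw i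
  have hp : 0 < cos r * sin (w - r) := mul_pos t2 t3
  have hS1 := sin_le_one (w - r)
  have hc1 := cos_le_one r
  have hfar : ⟪p i, e i⟫ ≤ -sin (w - r) := by
    have h1 := H.far i
    have h2 := mul_le_mul_of_nonneg_left hu t1.le
    have h3 : cos r * ⟪p i, e i⟫ ≤ cos r * (-sin (w - r)) := by linarith
    exact le_of_mul_le_mul_left h3 t2
  have hsup : ∀ j, ⟪p i, e j⟫ ≤ sin (w - r) / 2 + d := by
    intro j
    have h1 := H.sup j _ (H.pK i)
    have h2 := mul_le_mul_of_nonneg_left hu t1.le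
    have h3 : cos r * ⟪p i, e j⟫ ≤ cos r * (sin (w - r) * x) := by linarith
    have h4 := le_of_mul_le_mul_left h3 t2
    have h5 : sin (w - r) * x ≤ sin (w - r) * (1/2 + d) := mul_le_mul_of_nonneg_left hxd t3.le
    have h6 : sin (w - r) * d ≤ 1 * d := mul_le_mul_of_nonneg_right hS1 d0
    linarith
  have hb : ∀ j, |⟪p i, e j⟫| ≤ 1 := by
    intro j
    have := abs_real_inner_le_norm (p i) (e j)
    rwa [H.pn hK, H.en, one_mul] at this
  have hz := H.zero (p i)
  refine ⟨?_, ?_⟩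
  · refine alg_h (X := cos r * sin (w - r)) (x := x) (a := a i) hs hs0 hp.le
      (by nlinarith) d0 hx1 hxd hx (ha i) hrel ?_ hu
    have := H.h_lower i
    rw [t7] at this
    calc _ = a i * (cos r * sin (w - r) + sin r * cos (w - r)) := by rw [hrel]; ring
      _ ≤ _ := this
  · have main : ∀ j k, a i * ⟪p i, e i⟫ + a j * ⟪p i, e j⟫ + a k * ⟪p i, e k⟫ = 0 →
      |⟪p i, e i⟫ + sin (w - r)| ≤ 12 * d ∧ |⟪p i, e j⟫ - sin (w - r) / 2| ≤ 12 * d :=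
      fun j k hz => alg_low d0 d1 (ha i) (ha j) (ha k) hz t3.le hS1 (hb i) (hb j) hfar
        (hsup j) (hsup k)
    have main2 : ∀ j k, a i * ⟪p i, e i⟫ + a j * ⟪p i, e j⟫ + a k * ⟪p i, e k⟫ = 0 →
      (∀ l, l ≠ i → l = j ∨ l = k) → (|⟪p i, e i⟫ + sin (w - r)| ≤ 12 * d ∧
        ∀ l, l ≠ i → |⟪p i, e l⟫ - sin (w - r) / 2| ≤ 12 * d) := by
      intro j k hz hl
      refine ⟨(main j k hz).1, fun l h => ?_⟩
      rcases hl l h with rfl | rfl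
      · exact (main _ k hz).2
      · exact (main _ j (by linarith)).2
    have hi : i = 0 ∨ i = 1 ∨ i = 2 := by fin_cases i <;> simp
    rcases hi with rfl | rfl | rfl
    · exact main2 1 2 (by linarith) (by decide)
    · exact main2 0 2 (by linarith) (by decide)
    · exact main2 0 1 (by linarith) (by decide)

set_option maxHeartbeats 2000000 in
lemma stab {w : ℝ} (hw0 : 0 < w) (hw : w ≤ π / 2) : ∃ C > 0, ∃ d0 > 0,
    ∀ (K : Set (E 2)) (o : E 2) (r : ℝ) (e : Fin 3 → E 2) (a : Fin 3 → ℝ) (p : Fin 3 → E 2),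
    SConvex K → Core K w o r e a p → ∀ φ, 0 ≤ φ → φ ≤ π / 3 →
    sin r * cos (w - r) = cos r * sin (w - r) * cos φ → π / 3 - φ ≤ d0 →
    ∃ T, IsRegularTriangle T ∧ width T = w ∧ hausdorffG K T ≤ C * (π / 3 - φ) := by
  have hpi := pi_pos
  obtain ⟨r0, hr0⟩ : ∃ r0, r0 = rr w (π / 3) := ⟨_, rfl⟩
  have bd := rr_bd hw0 hw (φ := π / 3) (by linarith) le_rfl
  have rel0 := rr_rel hw0 hw (φ := π / 3) (by linarith) le_rfl
  rw [← hr0] at bd rel0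
  rw [cos_pi_div_three] at rel0
  have s0p : 0 < sin r0 := sin_pos_of_pos_of_lt_pi bd.1 (by linarith [bd.2.1])
  have C0p : 0 < cos (w - r0) := cos_pos_of_mem_Ioo ⟨by linarith [bd.2.1], by linarith [bd.2.1]⟩
  have s01 := sin_le_one r0
  have C01 := cos_le_one (w - r0)
  have q0 : 0 < sin r0 * cos (w - r0) := mul_pos s0p C0p
  have q1 : sin r0 * cos (w - r0) ≤ sin r0 := by nlinarith
  refine ⟨664 / (sin r0 * cos (w - r0)), by positivity, sin r0 * cos (w - r0) / 332,
    by positivity, ?_⟩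
  intro K o r e a p hK H φ h0 h1 hrel hd
  obtain ⟨d, hdd⟩ : ∃ d, d = π / 3 - φ := ⟨_, rfl⟩
  rw [← hdd] at hd ⊢
  have d0 : 0 ≤ d := by linarith
  have d1 : d ≤ 1/9 := by linarith
  have d2 : d ≤ sin r0 / 4 := by linarith
  have hr : r = rr w φ := eq_rr hw0 hw h0 h1 H.rpos H.rle hrel
  have hlip := rr_lip hw0 hw h0 h1
  rw [← hr, ← hr0, ← hdd] at hlip
  have l1 := (abs_sin_sub_sin_le r r0).trans hlip
  have l2 := (abs_cos_sub_cos_le r r0).trans hlip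
  have hlip' : |(w - r) - (w - r0)| ≤ 2 * d := by
    rw [show (w - r) - (w - r0) = -(r - r0) by ring, abs_neg]; exact hlip
  have l3 := (abs_sin_sub_sin_le (w - r) (w - r0)).trans hlip'
  have l4 := (abs_cos_sub_cos_le (w - r) (w - r0)).trans hlip'
  have hx := cos_half h0 h1
  have hxd : cos φ ≤ 1/2 + d := by
    have := abs_cos_sub_cos_le φ (π / 3)
    rw [cos_pi_div_three, abs_sub_comm φ, ← hdd, abs_of_nonneg d0] at this
    linarith [(abs_le.1 this).2]
  have hs2 : sin r0 / 2 ≤ sin r := by linarith [(abs_le.1 l1).1]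
  have hp := H.p_near hK hw0 hw d0 d1 hx hxd (cos_le_one φ) hs2 s0p hrel
  have hsum := H.sum_e (H.a_near hK hw0 hw hx hxd hrel)
  obtain ⟨f, fn, fo, fs, fe⟩ := reg_frame H.on H.en H.oe hsum (by linarith)
  have G : Reg o f r0 (w - r0) := ⟨H.on, fn, fo, fs, bd.1, by linarith [bd.2.1],
    by linarith [bd.2.1], by linarith [bd.2.1], by linarith⟩
  -- closeness of inner products with e and f
  have hef : ∀ x : E 2, ‖x‖ = 1 → ∀ i, |⟪x, f i⟫ - ⟪x, e i⟫| ≤ 63 * d := by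
    intro x hx i
    rw [← inner_sub_right]
    refine (abs_real_inner_le_norm _ _).trans ?_
    rw [hx, one_mul, norm_sub_rev]
    linarith [fe i]
  have hds : d ≤ d / sin r0 := by rw [le_div_iff₀ s0p]; nlinarith
  obtain ⟨D, hD⟩ : ∃ D, D = d / sin r0 := ⟨_, rfl⟩
  rw [← hD] at hds
  have hpv : ∀ i, ‖p i - vv o f (w - r0) i‖ ≤ 166 * D := by
    intro i
    obtain ⟨i1, i2, i3⟩ := hp i
    rw [mul_div_assoc, ← hD] at i1
    have oo := sq_of_norm_one H.on
    have j1 : |⟪p i - vv o f (w - r0) i, o⟫| ≤ 12 * D := by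
      have : ⟪p i - vv o f (w - r0) i, o⟫ = (⟪p i, o⟫ - cos (w - r)) + (cos (w - r) - cos (w - r0)) := by
        rw [vv, inner_sub_left, inner_sub_left, inner_smul_left, inner_smul_left, G.eo, oo]
        simp
      rw [this]
      refine (abs_add_le _ _).trans ?_
      linarith
    obtain ⟨ee, h01, h02, h12, h10, h20, h21⟩ := G.ee
    have hne : ∀ j, j ≠ i → ⟪f i, f j⟫ = -(1/2) := by
      intro j hj
      fin_cases i <;> fin_cases j <;> first | exact absurd rfl hj | assumption
    have hvf : ∀ j, ⟪p i - vv o f (w - r0) i, f j⟫ = ⟪p i, f j⟫ + sin (w - r0) * ⟪f i, f j⟫ := by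
      intro j
      rw [vv, inner_sub_left, inner_sub_left, inner_smul_left, inner_smul_left, G.oe]
      simp
    have j2 : ∀ j, |⟪p i - vv o f (w - r0) i, f j⟫| ≤ 77 * d := by
      intro j
      rw [hvf j]
      have k1 := abs_le.1 (hef (p i) (H.pn hK i) j)
      have k2 := abs_le.1 l3
      rw [abs_le]
      by_cases hj : j = i
      · subst hj
        rw [ee]
        have k3 := abs_le.1 i2
        constructor <;> linarith [k1.1, k1.2, k2.1, k2.2, k3.1, k3.2]
      · rw [hne j hj]
        have k3 := abs_le.1 (i3 j hj)
        constructor <;> linarith [k1.1, k1.2, k2.1, k2.2, k3.1, k3.2]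
    have hrep := G.rep (p i - vv o f (w - r0) i)
    rw [hrep]
    refine (norm_add_le _ _).trans ?_
    have m1 : ‖⟪p i - vv o f (w - r0) i, o⟫ • o‖ ≤ 12 * D := by
      rw [norm_smul, H.on, mul_one, norm_eq_abs]; exact j1
    have m2 : ∀ j, ‖⟪p i - vv o f (w - r0) i, f j⟫ • f j‖ ≤ 77 * d := by
      intro j
      rw [norm_smul, fn, mul_one, norm_eq_abs]; exact j2 j
    have m3 : ‖(2/3:ℝ) • (⟪p i - vv o f (w - r0) i, f 0⟫ • f 0 + ⟪p i - vv o f (w - r0) i, f 1⟫ • f 1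
        + ⟪p i - vv o f (w - r0) i, f 2⟫ • f 2)‖ ≤ 2/3 * (231 * d) := by
      rw [norm_smul, norm_eq_abs, abs_of_pos (by norm_num : (0:ℝ) < 2/3)]
      refine mul_le_mul_of_nonneg_left (norm_add₃_le.trans ?_) (by norm_num)
      linarith [m2 0, m2 1, m2 2]
    linarith
  obtain ⟨ρ, hρ⟩ : ∃ ρ, ρ = 166 * D / cos (w - r0) := ⟨_, rfl⟩
  have hρ' : ρ * cos (w - r0) = 166 * D := by rw [hρ]; field_simp
  have hC : 664 / (sin r0 * cos (w - r0)) * d = 4 * ρ := by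
    rw [hρ, hD]; field_simp; ring
  have hρ1 : ρ < 1 := by
    have : 664 / (sin r0 * cos (w - r0)) * d ≤ 664 / (sin r0 * cos (w - r0)) * (sin r0 * cos (w - r0) / 332) :=
      mul_le_mul_of_nonneg_left hd (by positivity)
    rw [hC] at this
    have h2 : 664 / (sin r0 * cos (w - r0)) * (sin r0 * cos (w - r0) / 332) = 2 := by
      field_simp; norm_num
    linarith
  have hD0 : 0 ≤ D := by rw [hD]; positivity
  have hρ0 : 0 ≤ ρ := by rw [hρ]; positivity
  have hDρ : 67 * D ≤ ρ := by nlinarith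
  rw [hC]
  obtain ⟨T, hTdef⟩ : ∃ T, T = tri o f r0 := ⟨_, rfl⟩
  have hRr : w - r0 + r0 = w := by ring
  refine ⟨tri o f r0, G.isReg, ?_, haus_le (by positivity) ?_ ?_⟩
  · rw [G.width_eq (by linarith), hRr]
  · -- K near T
    intro x hx
    have xn : ‖x‖ = 1 := mem_unit.1 (hK.1 hx)
    have hxo : |⟪x, o⟫| ≤ 1 := by
      have := abs_real_inner_le_norm x o
      rwa [xn, H.on, one_mul] at this
    have hsD : sin r0 * D = d := by rw [hD]; field_simp
    have hz : ‖(x + (67 * D) • o) - x‖ ≤ ρ := by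
      rw [add_sub_cancel_left, norm_smul, H.on, mul_one, norm_eq_abs, abs_of_nonneg (by positivity)]
      exact hDρ
    obtain ⟨n1, n2, n3⟩ := near xn hz hρ1
    refine ⟨_, ⟨n2, fun i => ?_⟩, n3⟩
    rw [inner_smul_left]
    refine mul_nonpos_of_nonneg_of_nonpos (by simp) ?_
    have hu : ⟪x, uu o f r0 i⟫ ≤ 67 * d := by
      rw [uu, inner_sub_right, inner_smul_right, inner_smul_right]
      have g1 := H.sup i x hx
      have g2 := (abs_le.1 (hef x xn i)).2
      have hxe : |⟪x, e i⟫| ≤ 1 := by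
        have := abs_real_inner_le_norm x (e i)
        rwa [xn, H.en, one_mul] at this
      have hc0 : 0 ≤ cos r0 := G.pos.2.1.le
      have hc1 := cos_le_one r0
      have g3 : cos r0 * (⟪x, f i⟫ - ⟪x, e i⟫) ≤ 63 * d := by
        calc _ ≤ cos r0 * (63 * d) := mul_le_mul_of_nonneg_left g2 hc0
          _ ≤ 1 * (63 * d) := mul_le_mul_of_nonneg_right hc1 (by positivity)
          _ = _ := one_mul _
      have g4 : |(cos r - cos r0) * ⟪x, e i⟫| ≤ 2 * d := by
        rw [abs_mul]
        calc _ ≤ 2 * d * 1 := mul_le_mul l2 hxe (abs_nonneg _) (by positivity)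
          _ = _ := mul_one _
      have g5 : |(sin r - sin r0) * ⟪x, o⟫| ≤ 2 * d := by
        rw [abs_mul]
        calc _ ≤ 2 * d * 1 := mul_le_mul l1 hxo (abs_nonneg _) (by positivity)
          _ = _ := mul_one _
      have g6 := (abs_le.1 g4).1
      have g7 := (abs_le.1 g5).2
      linarith
    have ho : ⟪o, uu o f r0 i⟫ = - sin r0 := by
      rw [uu, inner_sub_right, inner_smul_right, inner_smul_right, fo, sq_of_norm_one H.on]
      ring
    rw [inner_add_left, inner_smul_left, ho]
    simp only [map_mul, conj_trivial]
    linarith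
  · -- T near K
    rintro y ⟨yn, hy⟩
    have hsw : 0 < sin w := by have := G.pos.2.2.2.2.1; rwa [hRr] at this
    have hrv := G.repv y
    rw [hRr] at hrv
    obtain ⟨b, hb⟩ : ∃ b : Fin 3 → ℝ, ∀ i, b i = -⟪y, uu o f r0 i⟫ / sin w := ⟨_, fun _ => rfl⟩
    have hb0 : ∀ i, 0 ≤ b i := fun i => by
      rw [hb]; exact div_nonneg (by linarith [hy i]) hsw.le
    have hyb : y = b 0 • vv o f (w - r0) 0 + b 1 • vv o f (w - r0) 1 + b 2 • vv o f (w - r0) 2 := by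
      have : y = (sin w)⁻¹ • (sin w • y) := by rw [smul_smul, inv_mul_cancel₀ hsw.ne', one_smul]
      rw [this, hrv, hb, hb, hb]
      simp only [smul_add, smul_smul, div_eq_inv_mul]
    have hvo : ∀ i, ⟪vv o f (w - r0) i, o⟫ = cos (w - r0) := by
      intro i
      rw [vv, inner_sub_left, inner_smul_left, inner_smul_left, G.eo, sq_of_norm_one H.on]
      simp
    have hbs : (b 0 + b 1 + b 2) * cos (w - r0) ≤ 1 := by
      have h1 : ⟪y, o⟫ = (b 0 + b 1 + b 2) * cos (w - r0) := by
        conv_lhs => rw [hyb]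
        simp only [inner_add_left, inner_smul_left, hvo, conj_trivial]
        ring
      rw [← h1]
      have := abs_real_inner_le_norm y o
      rw [yn, H.on, one_mul] at this
      exact (le_abs_self _).trans this
    have hz : ‖(b 0 • p 0 + b 1 • p 1 + b 2 • p 2) - y‖ ≤ ρ := by
      have : (b 0 • p 0 + b 1 • p 1 + b 2 • p 2) - y = b 0 • (p 0 - vv o f (w - r0) 0)
        + b 1 • (p 1 - vv o f (w - r0) 1) + b 2 • (p 2 - vv o f (w - r0) 2) := by
        conv_lhs => rw [hyb]
        module
      rw [this]
      refine norm_add₃_le.trans ?_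
      have hh : ∀ i, ‖b i • (p i - vv o f (w - r0) i)‖ ≤ b i * (166 * D) := by
        intro i
        rw [norm_smul, norm_eq_abs, abs_of_nonneg (hb0 i)]
        exact mul_le_mul_of_nonneg_left (hpv i) (hb0 i)
      have h3 : (b 0 + b 1 + b 2) * (166 * D) ≤ ρ := by
        rw [← hρ']
        calc _ = ((b 0 + b 1 + b 2) * cos (w - r0)) * ρ := by ring
          _ ≤ 1 * ρ := mul_le_mul_of_nonneg_right hbs hρ0
          _ = ρ := one_mul _
      linarith [hh 0, hh 1, hh 2]
    obtain ⟨n1, n2, n3⟩ := near yn hz hρ1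
    refine ⟨_, ?_, n3⟩
    obtain ⟨m, hm⟩ : ∃ m, m = ‖b 0 • p 0 + b 1 • p 1 + b 2 • p 2‖⁻¹ := ⟨_, rfl⟩
    have hm0 : 0 ≤ m := by rw [hm]; positivity
    rw [← hm] at n2 ⊢
    have e3 : m • (b 0 • p 0 + b 1 • p 1 + b 2 • p 2) =
        (m * b 0) • p 0 + (m * b 1) • p 1 + (m * b 2) • p 2 := by module
    rw [e3] at n2 ⊢
    exact posClosed hK _ (H.pK 0) _ (H.pK 1) _ (H.pK 2) _ _ _ (mul_nonneg hm0 (hb0 0))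
      (mul_nonneg hm0 (hb0 1)) (mul_nonneg hm0 (hb0 2)) n2

end Pal

/-- stability of the spherical isominwidth inequality for `w ≤ π/2`. -/
theorem pal_stability_small_width (w : ℝ) (hw0 : 0 < w) (hw : w ≤ π / 2)
    (T_w : Set (E 2)) (hT : IsRegularTriangle T_w) (hTw : width T_w = w) :
    ∃ c > 0, ∀ ε > 0, ∀ K : Set (E 2), IsConvexBody K → width K = w →
      area K ≤ area T_w + ε →
      ∃ T : Set (E 2), IsRegularTriangle T ∧ width T = w ∧ hausdorffG K T ≤ c * ε := by
  obtain ⟨o₀, e₀, r₀, R₀, G, hTe⟩ := Pal.exists_reg hT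
  have hpar := G.params hw0 hw (hTe ▸ hTw)
  have hareaT : area T_w = Pal.M * Pal.FF w (π / 3) := by rw [hTe]; exact G.area hpar.2
  obtain ⟨C, hC, d0, hd0, hst⟩ := Pal.stab hw0 hw
  obtain ⟨k, hk, hF⟩ := Pal.FF_bound hw0 hw
  have hM := Pal.M_pos
  have hpi := pi_pos
  refine ⟨(C + π / d0) / (Pal.M * k), by positivity, ?_⟩
  intro ε hε K hK hwK hA
  have hKs := hK.1
  obtain ⟨o, r, e, a, p, H⟩ := Pal.exists_core hK (hwK ▸ hw) (hwK ▸ hw0)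
  rw [hwK] at H
  obtain ⟨φ, h0, h1, hrel, hlow⟩ := H.area hKs hw0 hw
  have hr : r = Pal.rr w φ := Pal.eq_rr hw0 hw h0 h1 H.rpos H.rle hrel
  have hlow' : Pal.M * Pal.FF w φ ≤ area K := by
    rw [Pal.area_eq hKs.1, Pal.FF, ← hr]; exact hlow
  have hFF := mul_le_mul_of_nonneg_left (hF φ h0 h1) hM.le
  have hδ : Pal.M * k * (π / 3 - φ) ≤ ε := by
    rw [hareaT] at hA
    linarith
  have hδ0 : 0 ≤ π / 3 - φ := by linarith
  have hfin : (C + π / d0) * (π / 3 - φ) ≤ (C + π / d0) / (Pal.M * k) * ε := by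
    rw [div_mul_eq_mul_div, le_div_iff₀ (by positivity)]
    calc _ = (C + π / d0) * (Pal.M * k * (π / 3 - φ)) := by ring
      _ ≤ _ := mul_le_mul_of_nonneg_left hδ (by positivity)
  by_cases hd : π / 3 - φ ≤ d0
  · obtain ⟨T, t1, t2, t3⟩ := hst K o r e a p hKs H φ h0 h1 hrel hd
    refine ⟨T, t1, t2, t3.trans (le_trans ?_ hfin)⟩
    exact mul_le_mul_of_nonneg_right (by linarith [div_pos hpi hd0]) hδ0
  · push Not at hd
    refine ⟨T_w, hT, hTw, le_trans ?_ hfin⟩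
    have hb : π ≤ (C + π / d0) * (π / 3 - φ) := by
      have e1 : π = π / d0 * d0 := by field_simp
      have e2 : π / d0 * d0 ≤ π / d0 * (π / 3 - φ) :=
        mul_le_mul_of_nonneg_left hd.le (by positivity)
      have e3 := mul_nonneg hC.le hδ0
      linarith
    refine le_trans ?_ hb
    refine Pal.haus_le hpi.le (fun x _ => ⟨_, hTe ▸ G.vmem 0, arccos_le_pi _⟩)
      (fun x _ => ⟨_, H.pK 0, arccos_le_pi _⟩)
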